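/- Let p be a prime number and let f(x,y,z) ∈ ℤ_p[x,y,z] be a nonzero polynomial with f(0,0,0)=0 that is non-degenerated over 𝔽_p with respect to all compact faces of its Newton polyhedron Γ_f. Let s₀ ∈ ℂ be a candidate pole of Z⁰_f with Re(s₀) ≠ −1, and suppose that every facet of Γ_f contributing to s₀ is a B₁-facet, and that for any pair of contributing B₁-facets either they are B₁-facets for a same variable or they have at most one point in common. Then s₀ is not a pole of Z⁰_f; i.e., the meromorphic continuation of Z⁰_f to ℂ is holomorphic at s₀. -/

import Mathlib

open MeasureTheory MvPolynomial

noncomputable section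

/-- The point of `ℝ³` corresponding to an exponent tuple `ω ∈ ℤ≥0³`. -/
def expR (a : Fin 3 →₀ ℕ) : Fin 3 → ℝ := fun i => (a i : ℝ)

/-- The point of `ℝ³` corresponding to an integral vector. -/
def intR (v : Fin 3 → ℤ) : Fin 3 → ℝ := fun i => (v i : ℝ)

/-- The standard scalar product on `ℝ³`. -/
def dot3 (k x : Fin 3 → ℝ) : ℝ := ∑ i, k i * x i

variable {p : ℕ} [Fact p.Prime]

/-- The Newton polyhedron `Γ_f` of `f`: the convex hull of `⋃_{ω ∈ supp f} (ω + ℝ≥0³)`. -/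
def newtonPolyhedron (f : MvPolynomial (Fin 3) ℤ_[p]) : Set (Fin 3 → ℝ) :=
  convexHull ℝ (⋃ a ∈ f.support, {x : Fin 3 → ℝ | ∀ i, (a i : ℝ) ≤ x i})

/-- `m(k) = inf_{x ∈ Γ_f} k·x`. -/
def mval (f : MvPolynomial (Fin 3) ℤ_[p]) (k : Fin 3 → ℝ) : ℝ :=
  sInf (dot3 k '' newtonPolyhedron f)

/-- A face of `Γ_f`: either `Γ_f` itself, or the subset of `Γ_f` where some nonzero
`k ∈ ℝ≥0³` attains its minimum `m(k)` (the first meet locus `F(k)`). -/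
def IsFaceOf (f : MvPolynomial (Fin 3) ℤ_[p]) (τ : Set (Fin 3 → ℝ)) : Prop :=
  τ = newtonPolyhedron f ∨
    ∃ k : Fin 3 → ℝ, (∀ i, 0 ≤ k i) ∧ k ≠ 0 ∧
      τ = {x ∈ newtonPolyhedron f | dot3 k x = mval f k}

/-- A facet of `Γ_f`: a face of dimension `2` (codimension one). -/
def IsFacetOf (f : MvPolynomial (Fin 3) ℤ_[p]) (τ : Set (Fin 3 → ℝ)) : Prop :=
  IsFaceOf f τ ∧ Module.finrank ℝ (vectorSpan ℝ τ) = 2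

/-- `v ∈ ℤ≥0³` is the primitive vector perpendicular to the facet `τ` of `Γ_f`:
`v` is primitive and `τ` is the locus of `Γ_f` where `v` attains its minimum `m(v)`. -/
def IsPrimNormal (f : MvPolynomial (Fin 3) ℤ_[p]) (τ : Set (Fin 3 → ℝ))
    (v : Fin 3 → ℤ) : Prop :=
  (∀ i, 0 ≤ v i) ∧ Int.gcd (v 0) (Int.gcd (v 1) (v 2)) = 1 ∧
    τ = {x ∈ newtonPolyhedron f | dot3 (intR v) x = mval f (intR v)}

open Classical in
/-- `f_τ`, the part of `f` supported on the face `τ`. -/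
def facePoly (f : MvPolynomial (Fin 3) ℤ_[p]) (τ : Set (Fin 3 → ℝ)) :
    MvPolynomial (Fin 3) ℤ_[p] :=
  ∑ a ∈ f.support.filter (fun a => expR a ∈ τ), monomial a (coeff a f)

/-- `f` is non-degenerated over `𝔽_p` with respect to all the compact faces of its Newton
polyhedron: for every compact face `τ`, the system
`f_τ(x) ≡ ∂f_τ/∂x₁(x) ≡ ∂f_τ/∂x₂(x) ≡ ∂f_τ/∂x₃(x) ≡ 0 mod p` has no solution
`x ∈ (ℤ_p^×)³`. -/
def IsNonDegenerateModP (f : MvPolynomial (Fin 3) ℤ_[p]) : Prop :=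
  ∀ τ : Set (Fin 3 → ℝ), IsFaceOf f τ → IsCompact τ →
    ¬ ∃ x : Fin 3 → ℤ_[p], (∀ i, ‖x i‖ = 1) ∧
        ‖eval x (facePoly f τ)‖ < 1 ∧
        ∀ i, ‖eval x (pderiv i (facePoly f τ))‖ < 1

/-- `σ(v) = v₁ + v₂ + v₃`. -/
def sigma3 (v : Fin 3 → ℤ) : ℤ := v 0 + v 1 + v 2

/-- `s₀` is a candidate pole of `Z⁰_f`: either `Re(s₀) = −1`, or
`s₀ = −σ(v)/m(v) + 2kπi/(m(v)·log p)` for the primitive normal vector `v` of some facet of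
`Γ_f` with `m(v) ≠ 0` and some `k ∈ ℤ`. -/
def IsCandidatePole (p : ℕ) [Fact p.Prime] (f : MvPolynomial (Fin 3) ℤ_[p])
    (s₀ : ℂ) : Prop :=
  s₀.re = -1 ∨
    ∃ (τ : Set (Fin 3 → ℝ)) (v : Fin 3 → ℤ) (k : ℤ),
      IsFacetOf f τ ∧ IsPrimNormal f τ v ∧ mval f (intR v) ≠ 0 ∧
      s₀ = -((sigma3 v : ℂ) / ((mval f (intR v) : ℝ) : ℂ)) +
        (2 * (k : ℂ) * (Real.pi : ℂ) * Complex.I) /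
          (((mval f (intR v) : ℝ) : ℂ) * ((Real.log p : ℝ) : ℂ))

/-- The facet `τ` of `Γ_f` (with primitive normal vector `v`) contributes to `s₀` if
`p^(σ(v) + m(v)·s₀) = 1`. -/
def Contributes (p : ℕ) [Fact p.Prime] (f : MvPolynomial (Fin 3) ℤ_[p])
    (τ : Set (Fin 3 → ℝ)) (s₀ : ℂ) : Prop :=
  ∃ v : Fin 3 → ℤ, IsPrimNormal f τ v ∧
    (p : ℂ) ^ ((sigma3 v : ℂ) + ((mval f (intR v) : ℝ) : ℂ) * s₀) = 1

/-- `τ` is a `B₁`-simplex for the variable `x_i`: a simplex with two vertices in the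
coordinate plane `{x_i = 0}` and one vertex in the plane `{x_i = 1}`. -/
def IsB1SimplexFor (τ : Set (Fin 3 → ℝ)) (i : Fin 3) : Prop :=
  ∃ A B C : Fin 3 → ℝ, AffineIndependent ℝ ![A, B, C] ∧
    τ = convexHull ℝ {A, B, C} ∧ A i = 0 ∧ B i = 0 ∧ C i = 1

/-- `τ` is non-compact for the variable `x_j`: `τ + e_j = τ`. -/
def NoncompactFor (τ : Set (Fin 3 → ℝ)) (j : Fin 3) : Prop :=
  ∀ x ∈ τ, x + Pi.single j (1 : ℝ) ∈ τ

/-- `τ` is a non-compact `B₁`-facet for the variable `x_i`: `τ` is non-compact for exactly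
one variable `x_j ≠ x_i`, and the projection of `τ` obtained by deleting the `j`-th
coordinate (realized here inside `{x_j = 0} ≅ ℝ²`) is a simplex with one vertex in
`{x_i = 0}` and one vertex in `{x_i = 1}`. -/
def IsNoncompactB1For (τ : Set (Fin 3 → ℝ)) (i : Fin 3) : Prop :=
  ∃ j : Fin 3, j ≠ i ∧ NoncompactFor τ j ∧ (∀ j', NoncompactFor τ j' → j' = j) ∧
    ∃ A B : Fin 3 → ℝ, A ≠ B ∧ A j = 0 ∧ B j = 0 ∧ A i = 0 ∧ B i = 1 ∧
      (fun x => Function.update x j (0 : ℝ)) '' τ = convexHull ℝ {A, B}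

/-- `τ` is a `B₁`-facet for the variable `x_i`. -/
def IsB1For (τ : Set (Fin 3 → ℝ)) (i : Fin 3) : Prop :=
  IsB1SimplexFor τ i ∨ IsNoncompactB1For τ i

/-- `τ` is a `B₁`-facet (for some variable). -/
def IsB1Facet (τ : Set (Fin 3 → ℝ)) : Prop := ∃ i, IsB1For τ i

/-- The local Igusa zeta function
`Z⁰_f(s) = ∫_{(pℤ_p)³} |f(x)|_p^s |dx|`, the Haar measure `μ` on `ℤ_p³` being normalized so
that `ℤ_p³` has measure one. -/
def Zlocal [MeasurableSpace ℤ_[p]] (μ : Measure (Fin 3 → ℤ_[p]))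
    (f : MvPolynomial (Fin 3) ℤ_[p]) (s : ℂ) : ℂ :=
  ∫ x in {x : Fin 3 → ℤ_[p] | ∀ i, ‖x i‖ < 1}, (‖eval x f‖ : ℂ) ^ s ∂μ

section PartA

/-- vectors of exponents -/
abbrev Vec := Fin 3 → ℕ

noncomputable def mon {ι : Type*} [Fintype ι] (y : ι → ℂ) (n : ι → ℕ) : ℂ := ∏ j, y j ^ n j

theorem mon_add {ι : Type*} [Fintype ι] (y : ι → ℂ) (n m : ι → ℕ) :
    mon y (n + m) = mon y n * mon y m := by
  simp [mon, pow_add, Finset.prod_mul_distrib]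

theorem mon_zero {ι : Type*} [Fintype ι] (y : ι → ℂ) : mon y 0 = 1 := by
  simp [mon]

theorem hasSum_mon : ∀ (r : ℕ) (y : Fin r → ℂ), (∀ j, ‖y j‖ < 1) →
    Summable (fun n => ‖mon y n‖) ∧ HasSum (mon y) (∏ j, (1 - y j)⁻¹)
  | 0, y, _ => by
    constructor
    · exact Summable.of_finite
    · have := hasSum_fintype (mon y)
      simpa [mon] using this
  | r+1, y, hy => by
    obtain ⟨h1, h2⟩ := hasSum_mon r (fun j => y j.succ) (fun j => hy _)
    have g1 : Summable (fun n : ℕ => ‖y 0 ^ n‖) := by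
      simpa using summable_geometric_of_lt_one (norm_nonneg _) (hy 0)
    have g2 := hasSum_geometric_of_norm_lt_one (hy 0)
    have e : ∀ q : ℕ × (Fin r → ℕ), mon y (Fin.consEquiv (fun _ => ℕ) q)
        = y 0 ^ q.1 * mon (fun j => y j.succ) q.2 := by
      intro q
      simp [mon, Fin.prod_univ_succ, Fin.consEquiv]
    have s1 := summable_mul_of_summable_norm g1 h1
    have s2 := g1.mul_norm h1
    constructor
    · rw [← (Fin.consEquiv (fun _ => ℕ)).summable_iff]
      refine s2.congr ?_
      intro q; simp only [Function.comp, e]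
    · rw [← (Fin.consEquiv (fun _ => ℕ)).hasSum_iff, Fin.prod_univ_succ]
      have := g2.mul h2 s1
      refine this.congr_fun ?_ |> fun h => h
      intro q; simp only [Function.comp, e]

theorem norm_mon_lt_one {y : Fin 3 → ℂ} (hy : ∀ j, ‖y j‖ < 1) {k : Vec} (hk : k ≠ 0) :
    ‖mon y k‖ < 1 := by
  obtain ⟨l, hl⟩ := Function.ne_iff.mp hk
  unfold mon
  rw [norm_prod]
  have : ∏ j, ‖y j ^ k j‖ = ‖y l ^ k l‖ * ∏ j ∈ Finset.univ.erase l, ‖y j ^ k j‖ :=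
    (Finset.mul_prod_erase _ _ (Finset.mem_univ l)).symm
  rw [this]
  have h1 : ‖y l ^ k l‖ < 1 := by
    rw [norm_pow]; exact pow_lt_one₀ (norm_nonneg _) (hy l) hl
  have h2 : ∏ j ∈ Finset.univ.erase l, ‖y j ^ k j‖ ≤ 1 := by
    apply Finset.prod_le_one (fun _ _ => norm_nonneg _)
    intro j _
    rw [norm_pow]; exact pow_le_one₀ (norm_nonneg _) (hy j).le
  calc _ ≤ ‖y l ^ k l‖ * 1 := by gcongr
    _ < 1 := by simpa using h1

/-- generating function times the product is polynomial -/
def RatGF (r : ℕ) (U : Set (Fin r → ℕ)) : Prop :=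
  ∃ c : MvPolynomial (Fin r) ℂ, ∀ y : Fin r → ℂ, (∀ j, ‖y j‖ < 1) →
    (∏ j, (1 - y j)) * (∑' n, U.indicator (mon y) n) = MvPolynomial.eval y c

theorem eval_monomial_mon {r : ℕ} (y : Fin r → ℂ) (n : Fin r → ℕ) :
    MvPolynomial.eval y (∏ j, MvPolynomial.X j ^ n j) = mon y n := by
  simp [mon]

theorem ratGF_Ici {r : ℕ} (n : Fin r → ℕ) : RatGF r (Set.Ici n) := by
  refine ⟨∏ j, MvPolynomial.X j ^ n j, fun y hy => ?_⟩
  rw [eval_monomial_mon]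
  obtain ⟨h1, h2⟩ := hasSum_mon r y hy
  have inj : Function.Injective (fun m : Fin r → ℕ => n + m) := add_right_injective n
  have : ∑' k, (Set.Ici n).indicator (mon y) k = ∑' m, mon y (n + m) := by
    rw [← inj.tsum_eq (f := (Set.Ici n).indicator (mon y))]
    · apply tsum_congr; intro m
      rw [Set.indicator_of_mem]
      intro j; simp
    · intro k hk
      have hk' : k ∈ Set.Ici n := by
        by_contra h
        exact hk (Set.indicator_of_notMem h _)
      exact ⟨k - n, add_tsub_cancel_of_le hk'⟩
  rw [this]
  simp_rw [mon_add]
  rw [tsum_mul_left, h2.tsum_eq]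
  have : ∏ j, (1 - y j) ≠ 0 := by
    apply Finset.prod_ne_zero_iff.mpr
    intro j _ h
    have := hy j
    rw [sub_eq_zero] at h
    rw [← h] at this; simp at this
  rw [Finset.prod_inv_distrib]
  field_simp

theorem ratGF_union {r : ℕ} {U V : Set (Fin r → ℕ)} (hU : RatGF r U) (hV : RatGF r V)
    (hUV : RatGF r (U ∩ V)) : RatGF r (U ∪ V) := by
  obtain ⟨a, ha⟩ := hU
  obtain ⟨b, hb⟩ := hV
  obtain ⟨c, hc⟩ := hUV
  refine ⟨a + b - c, fun y hy => ?_⟩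
  have hs : Summable (mon y) := (hasSum_mon r y hy).2.summable
  have e : ∑' n, (U ∪ V).indicator (mon y) n = ∑' n, U.indicator (mon y) n
      + ∑' n, V.indicator (mon y) n - ∑' n, (U ∩ V).indicator (mon y) n := by
    rw [← (hs.indicator U).tsum_add (hs.indicator V), ← ((hs.indicator U).add (hs.indicator V)).tsum_sub (hs.indicator _)]
    apply tsum_congr
    intro n
    have := congrFun (Set.indicator_union_add_inter (mon y) U V) n
    simp only [Pi.add_apply] at this
    rw [← this]; ring
  rw [e, mul_sub, mul_add, ha y hy, hb y hy, hc y hy]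
  simp

theorem ratGF_upper_finset {r : ℕ} : ∀ (N : ℕ) (F : Finset (Fin r → ℕ)), F.card ≤ N →
    RatGF r {n | ∃ q ∈ F, q ≤ n}
  | 0, F, h => by
    have : F = ∅ := by simpa using h
    subst this
    refine ⟨0, fun y hy => ?_⟩
    simp
  | N+1, F, h => by
    classical
    rcases F.eq_empty_or_nonempty with rfl | ⟨q, hq⟩
    · exact ratGF_upper_finset N ∅ (by simp)
    have hc : (F.erase q).card ≤ N := by rw [Finset.card_erase_of_mem hq]; omega
    have e : {n | ∃ q ∈ F, q ≤ n} = Set.Ici q ∪ {n | ∃ q' ∈ F.erase q, q' ≤ n} := by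
      ext n
      simp only [Set.mem_ofPred_eq, Set.mem_union, Set.mem_Ici, Finset.mem_erase]
      constructor
      · rintro ⟨q', h1, h2⟩
        by_cases h3 : q' = q
        · subst h3; exact Or.inl h2
        · exact Or.inr ⟨q', ⟨h3, h1⟩, h2⟩
      · rintro (h | ⟨q', ⟨_, h1⟩, h2⟩)
        · exact ⟨q, hq, h⟩
        · exact ⟨q', h1, h2⟩
    rw [e]
    apply ratGF_union (ratGF_Ici q) (ratGF_upper_finset N _ hc)
    have e2 : Set.Ici q ∩ {n | ∃ q' ∈ F.erase q, q' ≤ n}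
        = {n | ∃ q' ∈ (F.erase q).image (fun q' => q ⊔ q'), q' ≤ n} := by
      ext n
      simp only [Set.mem_ofPred_eq, Set.mem_inter_iff, Set.mem_Ici, Finset.mem_image]
      constructor
      · rintro ⟨h1, q', h2, h3⟩
        exact ⟨q ⊔ q', ⟨q', h2, rfl⟩, sup_le h1 h3⟩
      · rintro ⟨_, ⟨q', h2, rfl⟩, h3⟩
        exact ⟨le_trans le_sup_left h3, q', h2, le_trans le_sup_right h3⟩
    rw [e2]
    exact ratGF_upper_finset N _ (Finset.card_image_le.trans hc)

/-- Dickson -/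
theorem dickson {β κ : Type*} [Finite κ] (Φ : β → (κ → ℕ)) (P : Set β) :
    ∃ F : Set β, F.Finite ∧ F ⊆ P ∧ ∀ k ∈ P, ∃ q ∈ F, Φ q ≤ Φ k := by
  classical
  set S : Set (κ → ℕ) := Φ '' P
  have hfin : {x | Minimal (· ∈ S) x}.Finite := by
    exact (setOfPred_minimal_antichain _).finite_of_partiallyWellOrderedOn
      (Set.isPWO_of_wellQuasiOrderedLE _)
  have hch : ∀ x ∈ {x | Minimal (· ∈ S) x}, ∃ q, q ∈ P ∧ Φ q = x := by
    rintro x hx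
    obtain ⟨q, hq, h⟩ := hx.prop
    exact ⟨q, hq, h⟩
  rcases isEmpty_or_nonempty β with he | he
  · exact ⟨∅, Set.finite_empty, Set.empty_subset _, fun k => (he.false k).elim⟩
  choose! g hg using hch
  refine ⟨g '' {x | Minimal (· ∈ S) x}, hfin.image _, ?_, ?_⟩
  · rintro _ ⟨x, hx, rfl⟩; exact (hg x hx).1
  · intro k hk
    obtain ⟨x, hx, hmin⟩ := exists_minimal_le_of_wellFoundedLT (· ∈ S) (Φ k)
      ⟨k, hk, rfl⟩
    exact ⟨g x, ⟨x, hmin, rfl⟩, by rw [(hg x hmin).2]; exact hx⟩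

theorem ratGF_upper {r : ℕ} (U : Set (Fin r → ℕ)) (hU : IsUpperSet U) : RatGF r U := by
  obtain ⟨F, hF, hFU, h⟩ := dickson (fun n : Fin r → ℕ => n) U
  have : U = {n | ∃ q ∈ hF.toFinset, q ≤ n} := by
    ext n
    simp only [Set.Finite.mem_toFinset, Set.mem_ofPred_eq]
    exact ⟨fun hn => h n hn, fun ⟨q, hq, hqn⟩ => hU hqn (hFU hq)⟩
  rw [this]
  exact ratGF_upper_finset _ _ le_rfl


noncomputable def comb {r : ℕ} (w : Fin r → Vec) (n : Fin r → ℕ) : Vec := ∑ j, n j • w j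

theorem comb_add {r : ℕ} (w : Fin r → Vec) (n m : Fin r → ℕ) :
    comb w (n + m) = comb w n + comb w m := by
  simp [comb, add_smul, Finset.sum_add_distrib]

theorem mon_sum {α : Type*} (x : Fin 3 → ℂ) (s : Finset α) (g : α → Vec) :
    mon x (∑ j ∈ s, g j) = ∏ j ∈ s, mon x (g j) := by
  classical
  induction s using Finset.induction_on with
  | empty => simp [mon_zero]
  | insert a s ha ih => rw [Finset.sum_insert ha, Finset.prod_insert ha, mon_add, ih]

theorem mon_nsmul (x : Fin 3 → ℂ) (n : ℕ) (k : Vec) : mon x (n • k) = mon x k ^ n := by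
  induction n with
  | zero => simp [mon_zero]
  | succ n ih => rw [succ_nsmul, mon_add, ih, pow_succ]

theorem mon_comb {r : ℕ} (w : Fin r → Vec) (n : Fin r → ℕ) (x : Fin 3 → ℂ) :
    mon x (comb w n) = mon (fun j => mon x (w j)) n := by
  rw [comb, mon_sum]
  simp only [mon_nsmul]
  rfl

theorem summable_mon3 {x : Fin 3 → ℂ} (hx : ∀ l, ‖x l‖ < 1) : Summable (mon x) :=
  (hasSum_mon 3 x hx).2.summable

theorem add_comb_mem {r : ℕ} {w : Fin r → Vec} {M : Set Vec} (hM : ∀ k ∈ M, ∀ j, k + w j ∈ M)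
    {k : Vec} (hk : k ∈ M) (n : Fin r → ℕ) : k + comb w n ∈ M := by
  have h1 : ∀ (N : ℕ) (j : Fin r) (k : Vec), k ∈ M → k + N • w j ∈ M := by
    intro N j
    induction N with
    | zero => intro k hk; simpa using hk
    | succ N ih => intro k hk; rw [succ_nsmul, ← add_assoc]; exact hM _ (ih k hk) j
  have h2 : ∀ s : Finset (Fin r), k + ∑ j ∈ s, n j • w j ∈ M := by
    intro s
    induction s using Finset.induction_on with
    | empty => simpa using hk
    | insert a s ha ih =>
      rw [Finset.sum_insert ha, add_comm (n a • w a), ← add_assoc]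
      exact h1 _ _ _ ih
  exact h2 _

/-- main generating function lemma -/
theorem gf_lemma {r : ℕ} (w : Fin r → Vec) (hw : ∀ j, w j ≠ 0) (M : Set Vec)
    (hM : ∀ k ∈ M, ∀ j, k + w j ∈ M) (F : Finset Vec)
    (hF : ∀ k ∈ M, ∃ q ∈ F, ∃ n : Fin r → ℕ, k = q + comb w n) :
    ∃ c : MvPolynomial (Fin 3) ℂ, ∀ x : Fin 3 → ℂ, (∀ l, ‖x l‖ < 1) →
      (∏ j, (1 - mon x (w j))) * (∑' k, M.indicator (mon x) k) = MvPolynomial.eval x c := by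
  classical
  let A : Vec → Set (Fin r → ℕ) := fun q => {n | q + comb w n ∈ M}
  let B : Vec → Set (Fin r → ℕ) := fun q => {n | q + comb w n ∈ M ∧
    ∃ q' ∈ F, ∃ n', q' + comb w n' = q + comb w n ∧ toLex n' < toLex n}
  have hA : ∀ q, IsUpperSet (A q) := by
    intro q n n' hnn hn
    obtain ⟨m, rfl⟩ := exists_add_of_le hnn
    show q + comb w (n + m) ∈ M
    rw [comb_add, ← add_assoc]
    exact add_comb_mem hM hn m
  have hB : ∀ q, IsUpperSet (B q) := by
    rintro q n n' hnn ⟨hn, q', hq', n1, h1, h2⟩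
    obtain ⟨m, rfl⟩ := exists_add_of_le hnn
    refine ⟨hA q (by simp) hn, q', hq', n1 + m, ?_, ?_⟩
    · rw [comb_add, comb_add, ← add_assoc, h1, add_assoc]
    · rw [toLex_add, toLex_add]
      exact add_lt_add_left h2 _
  choose cA hcA using fun q => ratGF_upper (A q) (hA q)
  choose cB hcB using fun q => ratGF_upper (B q) (hB q)
  let τ : MvPolynomial (Fin r) ℂ → MvPolynomial (Fin 3) ℂ :=
    fun c => MvPolynomial.bind₁ (fun j => ∏ l, MvPolynomial.X l ^ (w j l)) c
  refine ⟨∑ q ∈ F, (∏ l, MvPolynomial.X l ^ (q l)) * (τ (cA q) - τ (cB q)), fun x hx => ?_⟩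
  set y : Fin r → ℂ := fun j => mon x (w j) with hy
  have hy1 : ∀ j, ‖y j‖ < 1 := fun j => norm_mon_lt_one hx (hw j)
  have hτ : ∀ c, MvPolynomial.eval x (τ c) = MvPolynomial.eval y c := by
    intro c
    simp only [τ]
    rw [← MvPolynomial.aeval_eq_eval, MvPolynomial.aeval_bind₁]
    simp only [MvPolynomial.aeval_eq_eval, eval_monomial_mon]
    rfl
  have hsy : Summable (mon y) := (hasSum_mon r y hy1).2.summable
  -- representatives
  let R : Set (F × (Fin r → ℕ)) := {z | z.2 ∈ A z.1 \ B z.1}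
  let Ψ : R → M := fun z => ⟨z.1.1 + comb w z.1.2, z.2.1⟩
  have hΨ : Function.Bijective Ψ := by
    constructor
    · rintro ⟨⟨⟨q, hq⟩, n⟩, h1, h2⟩ ⟨⟨⟨q', hq'⟩, n'⟩, h1', h2'⟩ he
      have he : q + comb w n = q' + comb w n' := congrArg Subtype.val he
      have e1 : ¬ toLex n' < toLex n := fun hlt => h2 ⟨h1, q', hq', n', he.symm, hlt⟩
      have e2 : ¬ toLex n < toLex n' := fun hlt => h2' ⟨h1', q, hq, n, he, hlt⟩
      have e3 : n = n' := toLex.injective (le_antisymm (not_lt.mp e1) (not_lt.mp e2))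
      subst e3
      have e4 : q = q' := add_right_cancel he
      subst e4
      rfl
    · rintro ⟨k, hk⟩
      let S : Set (Lex (Fin r → ℕ)) := {n | ∃ q ∈ F, k = q + comb w (ofLex n)}
      have hS : S.Nonempty := by
        obtain ⟨q, hq, n, h⟩ := hF k hk
        exact ⟨toLex n, q, hq, h⟩
      obtain ⟨n, ⟨q, hq, hn⟩, hmin⟩ := WellFounded.has_min
        (wellFounded_lt : WellFounded ((· < ·) : Lex (Fin r → ℕ) → _ → Prop)) S hS
      refine ⟨⟨⟨⟨q, hq⟩, ofLex n⟩, ?_, ?_⟩, ?_⟩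
      · show q + comb w (ofLex n) ∈ M
        rw [← hn]; exact hk
      · rintro ⟨h1, q', hq', n', h2, h3⟩
        exact hmin (toLex n') ⟨q', hq', by rw [hn]; exact h2.symm⟩ h3
      · apply Subtype.ext
        exact hn.symm
  have t1 : ∑' k, M.indicator (mon x) k = ∑' z : R, mon x (Ψ z).1 := by
    rw [← tsum_subtype M (mon x), ← (Equiv.ofBijective Ψ hΨ).tsum_eq]
    rfl
  have hsum : Summable (fun z : F × (Fin r → ℕ) => mon x z.1 * mon y z.2) := by
    apply summable_mul_of_summable_norm (f := fun q : F => mon x q.1)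
    · exact Summable.of_finite
    · exact (hasSum_mon r y hy1).1
  have t2 : ∑' z : R, mon x (Ψ z).1
      = ∑ q ∈ F, mon x q * (∑' n, (A q).indicator (mon y) n - ∑' n, (B q).indicator (mon y) n) := by
    have e1 : ∑' z : R, mon x (Ψ z).1
        = ∑' z : R, (fun z : F × (Fin r → ℕ) => mon x z.1 * mon y z.2) z := by
      apply tsum_congr
      intro z
      simp only [Ψ, mon_add, mon_comb, y]
    rw [e1, tsum_subtype R (fun z : F × (Fin r → ℕ) => mon x z.1 * mon y z.2), (hsum.indicator R).tsum_prod, tsum_fintype, ← Finset.sum_coe_sort F]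
    apply Finset.sum_congr rfl
    rintro q _
    rw [← (hsy.indicator _).tsum_sub (hsy.indicator _), ← tsum_mul_left]
    apply tsum_congr
    intro n
    by_cases ha : n ∈ A q
    · by_cases hb : n ∈ B q
      · rw [Set.indicator_of_notMem (fun h : (q, n) ∈ R => h.2 hb), Set.indicator_of_mem ha,
          Set.indicator_of_mem hb]; simp
      · rw [Set.indicator_of_mem (show (q, n) ∈ R from ⟨ha, hb⟩), Set.indicator_of_mem ha,
          Set.indicator_of_notMem hb]; simp
    · have hb : n ∉ B q := fun h => ha h.1
      rw [Set.indicator_of_notMem (fun h : (q, n) ∈ R => ha h.1), Set.indicator_of_notMem ha,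
          Set.indicator_of_notMem hb]; simp
  rw [t1, t2, Finset.mul_sum, map_sum]
  apply Finset.sum_congr rfl
  intro q _
  rw [map_mul, map_sub, hτ, hτ, ← hcA q y hy1, ← hcB q y hy1, eval_monomial_mon]
  ring

theorem gf_finset (W : Finset Vec) (hW : 0 ∉ W) (M : Set Vec)
    (hM : ∀ k ∈ M, ∀ w ∈ W, k + w ∈ M) (F : Finset Vec)
    (hF : ∀ k ∈ M, ∃ q ∈ F, ∃ n : Vec → ℕ, k = q + ∑ w ∈ W, n w • w) :
    ∃ c : MvPolynomial (Fin 3) ℂ, ∀ x : Fin 3 → ℂ, (∀ l, ‖x l‖ < 1) →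
      (∏ w ∈ W, (1 - mon x w)) * (∑' k, M.indicator (mon x) k) = MvPolynomial.eval x c := by
  obtain ⟨c, hc⟩ := gf_lemma (fun j : Fin W.card => (W.equivFin.symm j : Vec))
    (fun j h => hW (h ▸ (W.equivFin.symm j).2)) M (fun k hk j => hM k hk _ (W.equivFin.symm j).2) F
    (by
      intro k hk
      obtain ⟨q, hq, n, h⟩ := hF k hk
      refine ⟨q, hq, fun j => n (W.equivFin.symm j), ?_⟩
      rw [h, comb]
      congr 1
      rw [← Finset.sum_coe_sort W, ← W.equivFin.symm.sum_comp])
  refine ⟨c, fun x hx => ?_⟩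
  rw [← hc x hx]
  congr 1
  rw [← Finset.prod_coe_sort W, ← W.equivFin.symm.prod_comp]

theorem gf_cell (W : Finset Vec) (hW : 0 ∉ W) (M : Set Vec)
    (hM : ∀ k ∈ M, ∀ w ∈ W, k + w ∈ M)
    (hN : ∀ k ∈ M, ∃ N : ℕ, 0 < N ∧ N • k ∈ AddSubmonoid.closure (W : Set Vec)) :
    ∃ c : MvPolynomial (Fin 3) ℂ, ∀ x : Fin 3 → ℂ, (∀ l, ‖x l‖ < 1) →
      (∏ w ∈ W, (1 - mon x w)) * (∑' k, M.indicator (mon x) k) = MvPolynomial.eval x c := by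
  apply gf_finset W hW M hM (Finset.Iic (∑ w ∈ W, w))
  intro k hk
  obtain ⟨N, hN0, hNk⟩ := hN k hk
  rw [AddSubmonoid.mem_closure_finset] at hNk
  obtain ⟨n, -, hn⟩ := hNk
  have key : ∀ l, N * k l = N * (∑ w ∈ W, (n w / N) • w) l + (∑ w ∈ W, (n w % N) • w) l := by
    intro l
    have := congrFun hn l
    simp only [Finset.sum_apply, Pi.smul_apply, smul_eq_mul] at this ⊢
    rw [← this, Finset.mul_sum, ← Finset.sum_add_distrib]
    apply Finset.sum_congr rfl
    intro w _
    conv_lhs => rw [← Nat.div_add_mod (n w) N]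
    ring
  have hle : ∑ w ∈ W, (n w / N) • w ≤ k := by
    intro l
    have := key l
    exact Nat.le_of_mul_le_mul_left (by omega) hN0
  refine ⟨k - ∑ w ∈ W, (n w / N) • w, ?_, fun w => n w / N, (tsub_add_cancel_of_le hle).symm⟩
  rw [Finset.mem_Iic]
  intro l
  have h1 := key l
  have h2 : (∑ w ∈ W, (n w % N) • w) l ≤ N * (∑ w ∈ W, w) l := by
    simp only [Finset.sum_apply, Pi.smul_apply, smul_eq_mul]
    rw [Finset.mul_sum]
    apply Finset.sum_le_sum
    intro w _
    exact Nat.mul_le_mul_right _ (Nat.mod_lt _ hN0).le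
  have h3 : N * k l ≤ N * ((∑ w ∈ W, (n w / N) • w) l + (∑ w ∈ W, w) l) := by
    rw [mul_add]; omega
  have h4 := Nat.le_of_mul_le_mul_left h3 hN0
  simp only [Pi.sub_apply]
  omega

/-- integer pairing -/
def zdp (c : Fin 3 → ℤ) (k : Vec) : ℤ := c 0 * k 0 + c 1 * k 1 + c 2 * k 2

theorem zdp_add (c : Fin 3 → ℤ) (k k' : Vec) : zdp c (k + k') = zdp c k + zdp c k' := by
  simp [zdp]; ring

theorem gf_poly (Cs : Finset ((Fin 3 → ℤ) × ℤ)) :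
    ∃ W : Finset Vec, (∀ w ∈ W, w ≠ 0 ∧ ∀ c ∈ Cs, 0 ≤ zdp c.1 w) ∧
    ∃ c : MvPolynomial (Fin 3) ℂ, ∀ x : Fin 3 → ℂ, (∀ l, ‖x l‖ < 1) →
      (∏ w ∈ W, (1 - mon x w)) *
        (∑' k, {k : Vec | ∀ c ∈ Cs, c.2 ≤ zdp c.1 k}.indicator (mon x) k)
        = MvPolynomial.eval x c := by
  classical
  obtain ⟨F, hFfin, hFP, hF⟩ := dickson (κ := Fin 3 ⊕ Cs)
    (fun k : Vec => Sum.elim k (fun c => (zdp c.1.1 k - c.1.2).toNat))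
    {k : Vec | ∀ c ∈ Cs, c.2 ≤ zdp c.1 k}
  obtain ⟨W, hWfin, hWP, hW⟩ := dickson (κ := Fin 3 ⊕ Cs)
    (fun k : Vec => Sum.elim k (fun c => (zdp c.1.1 k).toNat))
    {k : Vec | k ≠ 0 ∧ ∀ c ∈ Cs, 0 ≤ zdp c.1 k}
  have hgen : ∀ (N : ℕ) (k : Vec), k 0 + k 1 + k 2 ≤ N → (∀ c ∈ Cs, 0 ≤ zdp c.1 k) →
      k ∈ AddSubmonoid.closure (hWfin.toFinset : Set Vec) := by
    intro N
    induction N with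
    | zero =>
      intro k hk _
      have : k = 0 := by ext l; fin_cases l <;> simp <;> omega
      rw [this]; exact zero_mem _
    | succ N ih =>
      intro k hk hc
      by_cases h0 : k = 0
      · rw [h0]; exact zero_mem _
      obtain ⟨q, hq, hle⟩ := hW k ⟨h0, hc⟩
      have hqk : q ≤ k := fun l => hle (Sum.inl l)
      obtain ⟨h, rfl⟩ := exists_add_of_le hqk
      have hq' := hWP hq
      apply add_mem
      · apply AddSubmonoid.subset_closure; simpa using hq
      · apply ih
        · have : q 0 + q 1 + q 2 ≠ 0 := by
            intro h'
            apply hq'.1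
            ext l; fin_cases l <;> simp <;> omega
          simp only [Pi.add_apply] at hk
          omega
        · intro c hcc
          have := hle (Sum.inr ⟨c, hcc⟩)
          simp only [Sum.elim_inr, zdp_add] at this
          have h2 := hq'.2 c hcc
          have h3 := hc c hcc
          rw [zdp_add] at h3
          omega
  refine ⟨hWfin.toFinset, fun w hw => hWP (by simpa using hw), ?_⟩
  apply gf_finset _ (fun h => (hWP (by simpa using h)).1 rfl) _ _ hFfin.toFinset
  · intro k hk
    obtain ⟨q, hq, hle⟩ := hF k hk
    have hqk : q ≤ k := fun l => hle (Sum.inl l)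
    obtain ⟨h, rfl⟩ := exists_add_of_le hqk
    have hh : h ∈ AddSubmonoid.closure (hWfin.toFinset : Set Vec) := by
      apply hgen _ h le_rfl
      intro c hcc
      have := hle (Sum.inr ⟨c, hcc⟩)
      simp only [Sum.elim_inr, zdp_add] at this
      have h2 := hFP hq c hcc
      have h3 := hk c hcc
      rw [zdp_add] at h3
      omega
    rw [AddSubmonoid.mem_closure_finset] at hh
    obtain ⟨n, -, hn⟩ := hh
    exact ⟨q, by simpa using hq, n, by rw [hn]⟩
  · intro k hk w hw c hc
    have h1 := hk c hc
    have h2 := (hWP (by simpa using hw)).2 c hc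
    rw [zdp_add]; omega

end PartA

section PartB

def zz (c d : Fin 3 → ℤ) : ℤ := c 0 * d 0 + c 1 * d 1 + c 2 * d 2

def zv (k : Vec) : Fin 3 → ℤ := fun l => (k l : ℤ)

theorem zdp_eq (c : Fin 3 → ℤ) (k : Vec) : zdp c k = zz c (zv k) := rfl

theorem zz_add (c d d' : Fin 3 → ℤ) : zz c (d + d') = zz c d + zz c d' := by
  simp [zz]; ring

theorem zz_comm (c d : Fin 3 → ℤ) : zz c d = zz d c := by
  simp [zz]; ring

theorem zz_smul (c : Fin 3 → ℤ) (a : ℤ) (d : Fin 3 → ℤ) : zz c (a • d) = a * zz c d := by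
  simp [zz]; ring

theorem zz_single (l : Fin 3) (d : Fin 3 → ℤ) : zz (Pi.single l 1) d = d l := by
  fin_cases l <;> simp [zz, Pi.single_apply]

def sg (k : Vec) : ℕ := k 0 + k 1 + k 2

def zs (d : Fin 3 → ℤ) : ℤ := d 0 + d 1 + d 2

theorem zs_zv (k : Vec) : zs (zv k) = sg k := by simp [zs, zv, sg]

theorem sg_pos {k : Vec} (hk : k ≠ 0) : 0 < sg k := by
  by_contra h
  apply hk
  unfold sg at h
  ext l; fin_cases l <;> simp <;> omega

theorem zv_add (k k' : Vec) : zv (k + k') = zv k + zv k' := by ext l; simp [zv]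

theorem zv_nsmul (n : ℕ) (k : Vec) : zv (n • k) = (n : ℤ) • zv k := by ext l; simp [zv]

theorem zv_inj {k k' : Vec} (h : zv k = zv k') : k = k' := by
  ext l; have := congrFun h l; simpa [zv] using this

def Prim (u : Vec) : Prop := Nat.gcd (u 0) (Nat.gcd (u 1) (u 2)) = 1

theorem prim_eq {u u' : Vec} (hu : Prim u) (hu' : Prim u') {s s' : ℕ} (hs : 0 < s)
    (h : ∀ l, s * u' l = s' * u l) : u = u' := by
  have e1 : Nat.gcd (s * u' 0) (Nat.gcd (s * u' 1) (s * u' 2)) = s := by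
    rw [Nat.gcd_mul_left, Nat.gcd_mul_left, hu', mul_one]
  have e2 : Nat.gcd (s' * u 0) (Nat.gcd (s' * u 1) (s' * u 2)) = s' := by
    rw [Nat.gcd_mul_left, Nat.gcd_mul_left, hu, mul_one]
  rw [h, h, h, e2] at e1
  subst e1
  ext l
  exact (Nat.eq_of_mul_eq_mul_left hs (h l)).symm

theorem exists_prim {k : Vec} (hk : k ≠ 0) : ∃ (g : ℕ) (u : Vec), 0 < g ∧ Prim u ∧ k = g • u := by
  set g := Nat.gcd (k 0) (Nat.gcd (k 1) (k 2)) with hg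
  have hd0 : g ∣ k 0 := Nat.gcd_dvd_left _ _
  have hd1 : g ∣ k 1 := (Nat.gcd_dvd_right _ _).trans (Nat.gcd_dvd_left _ _)
  have hd2 : g ∣ k 2 := (Nat.gcd_dvd_right _ _).trans (Nat.gcd_dvd_right _ _)
  have hg0 : 0 < g := by
    rcases Nat.eq_zero_or_pos g with h | h
    · exfalso; apply hk
      rw [h, zero_dvd_iff] at hd0 hd1 hd2
      ext l; fin_cases l <;> simp [*]
    · exact h
  have hd : ∀ l, g ∣ k l := by intro l; fin_cases l <;> assumption
  refine ⟨g, fun l => k l / g, hg0, ?_, ?_⟩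
  · unfold Prim
    have : g * Nat.gcd (k 0 / g) (Nat.gcd (k 1 / g) (k 2 / g)) = g * 1 := by
      rw [← Nat.gcd_mul_left, ← Nat.gcd_mul_left, Nat.mul_div_cancel' hd0,
        Nat.mul_div_cancel' hd1, Nat.mul_div_cancel' hd2, mul_one]
    exact Nat.eq_of_mul_eq_mul_left hg0 this
  · ext l
    simp [Nat.mul_div_cancel' (hd l)]

def GRay (Cs : Finset (Fin 3 → ℤ)) (u : Vec) : Prop :=
  ∀ w : Fin 3 → ℤ, (∀ c ∈ Cs, zz c (zv u) = 0 → zz c w = 0) → ∀ l, (sg u : ℤ) * w l = zs w * u l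

theorem zs_smul (a : ℤ) (d : Fin 3 → ℤ) : zs (a • d) = a * zs d := by simp [zs]; ring
theorem zs_add (d e : Fin 3 → ℤ) : zs (d + e) = zs d + zs e := by simp [zs]; ring

/-- push along d until a new constraint becomes tight -/
theorem push (Cs : Finset (Fin 3 → ℤ)) (hCs : ∀ l, Pi.single l 1 ∈ Cs) (k : Vec) (hk : k ≠ 0)
    (hkC : ∀ c ∈ Cs, 0 ≤ zz c (zv k)) (d : Fin 3 → ℤ) (hd : d ≠ 0) (hds : zs d = 0)
    (hdC : ∀ c ∈ Cs, zz c (zv k) = 0 → zz c d = 0) :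
    ∃ (N M : ℕ) (k' : Vec), 0 < N ∧ 0 < M ∧ k' ≠ 0 ∧ zv k' = (N : ℤ) • zv k + (M : ℤ) • d ∧
      (∀ c ∈ Cs, 0 ≤ zz c (zv k')) ∧ (∀ c ∈ Cs, zz c (zv k) = 0 → zz c (zv k') = 0) ∧
      (Cs.filter (fun c => zz c (zv k') ≠ 0)).card < (Cs.filter (fun c => zz c (zv k) ≠ 0)).card := by
  have hne : (Cs.filter (fun c => zz c d < 0)).Nonempty := by
    by_contra hcon
    rw [Finset.not_nonempty_iff_eq_empty, Finset.filter_eq_empty_iff] at hcon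
    have h : ∀ l, 0 ≤ d l := by
      intro l
      have := hcon (hCs l)
      rw [zz_single] at this
      omega
    apply hd
    unfold zs at hds
    have h0 := h 0; have h1 := h 1; have h2 := h 2
    ext l; fin_cases l <;> simp <;> omega
  obtain ⟨c, hc, hmin⟩ := Finset.exists_min_image _
    (fun c => (zz c (zv k) : ℚ) / (-(zz c d : ℚ))) hne
  rw [Finset.mem_filter] at hc
  obtain ⟨hcC, hcd⟩ := hc
  have hck : 0 < zz c (zv k) := by
    rcases (hkC c hcC).lt_or_eq with h | h
    · exact h
    · have := hdC c hcC h.symm; omega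
  have hnn : ∀ c' ∈ Cs, 0 ≤ (-zz c d) * zz c' (zv k) + zz c (zv k) * zz c' d := by
    intro c' hc'
    by_cases h : 0 ≤ zz c' d
    · have := hkC c' hc'
      have : 0 ≤ (-zz c d) * zz c' (zv k) := mul_nonneg (by omega) this
      have : 0 ≤ zz c (zv k) * zz c' d := mul_nonneg hck.le h
      omega
    · push Not at h
      have := hmin c' (Finset.mem_filter.mpr ⟨hc', h⟩)
      have a1 : (0 : ℚ) < -(zz c d : ℚ) := by
        have : (zz c d : ℚ) < 0 := by exact_mod_cast hcd
        linarith
      have a2 : (0 : ℚ) < -(zz c' d : ℚ) := by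
        have : (zz c' d : ℚ) < 0 := by exact_mod_cast h
        linarith
      rw [div_le_div_iff₀ a1 a2] at this
      have h3 : (zz c (zv k)) * (-(zz c' d)) ≤ (zz c' (zv k)) * (-(zz c d)) := by
        exact_mod_cast this
      linarith
  set v : Fin 3 → ℤ := (-zz c d) • zv k + zz c (zv k) • d with hv
  have hzv : ∀ c', zz c' v = (-zz c d) * zz c' (zv k) + zz c (zv k) * zz c' d := by
    intro c'; rw [hv, zz_add, zz_smul, zz_smul]
  have hvn : ∀ l, 0 ≤ v l := by
    intro l
    rw [← zz_single l v, hzv]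
    exact hnn _ (hCs l)
  have hk' : zv (fun l => (v l).toNat) = v := by
    ext l; simp only [zv]; exact Int.toNat_of_nonneg (hvn l)
  refine ⟨(-zz c d).toNat, (zz c (zv k)).toNat, fun l => (v l).toNat, by omega, by omega, ?_, ?_,
    ?_, ?_, ?_⟩
  · intro h0
    have h1 : zs v = 0 := by rw [← hk', h0]; simp [zs, zv]
    rw [hv, zs_add, zs_smul, zs_smul, hds, zs_zv] at h1
    have := sg_pos hk
    have : 0 < (-zz c d) * (sg k : ℤ) := mul_pos (by omega) (by exact_mod_cast this)
    simp at h1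
    omega
  · rw [hk', Int.toNat_of_nonneg (by omega), Int.toNat_of_nonneg (by omega)]
  · intro c' hc'; rw [hk', hzv]; exact hnn c' hc'
  · intro c' hc' h; rw [hk', hzv, h, hdC c' hc' h]; simp
  · apply Finset.card_lt_card
    rw [Finset.ssubset_iff_of_subset]
    · refine ⟨c, Finset.mem_filter.mpr ⟨hcC, hck.ne'⟩, ?_⟩
      rw [Finset.mem_filter, hk', hzv]
      intro h; apply h.2; ring
    · intro c' hc'
      rw [Finset.mem_filter] at hc' ⊢
      refine ⟨hc'.1, fun h => hc'.2 ?_⟩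
      rw [hk', hzv, h, hdC c' hc'.1 h]; simp

theorem minkowski_weyl (Cs : Finset (Fin 3 → ℤ)) (hCs : ∀ l, Pi.single l 1 ∈ Cs) :
    ∀ (t : ℕ) (k : Vec), k ≠ 0 → (Cs.filter (fun c => zz c (zv k) ≠ 0)).card ≤ t →
    (∀ c ∈ Cs, 0 ≤ zz c (zv k)) →
    ∃ N : ℕ, 0 < N ∧ N • k ∈ AddSubmonoid.closure {u : Vec | u ≠ 0 ∧ Prim u ∧ GRay Cs u ∧
      (∀ c ∈ Cs, 0 ≤ zz c (zv u)) ∧ (∀ c ∈ Cs, zz c (zv k) = 0 → zz c (zv u) = 0)} := by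
  intro t
  induction t with
  | zero =>
    intro k hk ht _
    exfalso
    rw [Nat.le_zero, Finset.card_eq_zero, Finset.filter_eq_empty_iff] at ht
    apply hk
    ext l
    have := ht (hCs l)
    rw [zz_single] at this
    simpa [zv] using this
  | succ t ih =>
    intro k hk ht hkC
    by_cases hray : GRay Cs k
    · obtain ⟨g, u, hg, hu, rfl⟩ := exists_prim hk
      have hu0 : u ≠ 0 := by rintro rfl; simp at hk
      have hz : ∀ c, zz c (zv (g • u)) = g * zz c (zv u) := by
        intro c; rw [zv_nsmul, zz_smul]
      refine ⟨1, one_pos, ?_⟩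
      rw [one_smul]
      apply AddSubmonoid.nsmul_mem
      apply AddSubmonoid.subset_closure
      refine ⟨hu0, hu, ?_, ?_, ?_⟩
      · intro w hw l
        have := hray w (fun c hc h => hw c hc (by
          rw [hz] at h; have : (g : ℤ) ≠ 0 := by omega
          exact (mul_eq_zero.mp h).resolve_left this)) l
        have e : (sg (g • u) : ℤ) = g * sg u := by simp [sg]; ring
        rw [e] at this
        have hg' : (g : ℤ) ≠ 0 := by omega
        apply mul_left_cancel₀ hg'
        simp only [Pi.smul_apply, smul_eq_mul] at this
        push_cast at this
        linarith
      · intro c hc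
        have := hkC c hc
        rw [hz] at this
        exact nonneg_of_mul_nonneg_right this (by exact_mod_cast hg)
      · intro c hc h
        rw [hz] at h
        exact (mul_eq_zero.mp h).resolve_left (by omega)
    · unfold GRay at hray
      push Not at hray
      obtain ⟨w, hw, l, hl⟩ := hray
      set d : Fin 3 → ℤ := (sg k : ℤ) • w + (-zs w) • zv k with hd
      have hd0 : d ≠ 0 := by
        intro h
        have := congrFun h l
        apply hl
        simp [hd, zv] at this
        linarith
      have hds : zs d = 0 := by
        rw [hd, zs_add, zs_smul, zs_smul, zs_zv]; ring
      have hdC : ∀ c ∈ Cs, zz c (zv k) = 0 → zz c d = 0 := by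
        intro c hc h
        rw [hd, zz_add, zz_smul, zz_smul, h, hw c hc h]; simp
      obtain ⟨N, M, k1, hN, hM, hk1, e1, c1, z1, t1⟩ := push Cs hCs k hk hkC d hd0 hds hdC
      obtain ⟨N', M', k2, hN', hM', hk2, e2, c2, z2, t2⟩ := push Cs hCs k hk hkC (-d)
        (neg_ne_zero.mpr hd0) (by simp [zs] at hds ⊢; omega) (by
          intro c hc h
          have := hdC c hc h
          simp [zz] at this ⊢; omega)
      obtain ⟨P, hP, hPc⟩ := ih k1 hk1 (by omega) c1
      obtain ⟨Q, hQ, hQc⟩ := ih k2 hk2 (by omega) c2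
      refine ⟨P * Q * (M' * N + M * N'), by positivity, ?_⟩
      have e : (P * Q * (M' * N + M * N')) • k = (Q * M') • (P • k1) + (P * M) • (Q • k2) := by
        apply zv_inj
        simp only [zv_add, zv_nsmul, e1, e2]
        ext l
        simp
        ring
      rw [e]
      apply add_mem
      · apply AddSubmonoid.nsmul_mem
        refine AddSubmonoid.closure_mono ?_ hPc
        rintro u ⟨h1, h2, h3, h4, h5⟩
        exact ⟨h1, h2, h3, h4, fun c hc h => h5 c hc (z1 c hc h)⟩
      · apply AddSubmonoid.nsmul_mem
        refine AddSubmonoid.closure_mono ?_ hQc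
        rintro u ⟨h1, h2, h3, h4, h5⟩
        exact ⟨h1, h2, h3, h4, fun c hc h => h5 c hc (z2 c hc h)⟩

end PartB

section PartC

def dp (k ω : Vec) : ℕ := k 0 * ω 0 + k 1 * ω 1 + k 2 * ω 2

theorem dp_add (k k' ω : Vec) : dp (k + k') ω = dp k ω + dp k' ω := by
  simp [dp]; ring

theorem dp_nsmul (n : ℕ) (k ω : Vec) : dp (n • k) ω = n * dp k ω := by
  simp [dp]; ring

theorem dp_cast (k ω : Vec) : (dp k ω : ℤ) = zz (zv ω) (zv k) := by
  simp [dp, zz, zv]; ring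

theorem dp_single (l : Fin 3) (ω : Vec) : dp (Pi.single l 1) ω = ω l := by
  fin_cases l <;> simp [dp]

/-- support points minimizing `k` -/
def SS (A : Finset Vec) (k : Vec) : Finset Vec := A.filter (fun ω => ∀ ω' ∈ A, dp k ω ≤ dp k ω')

theorem mem_SS {A : Finset Vec} {k ω : Vec} : ω ∈ SS A k ↔ ω ∈ A ∧ ∀ ω' ∈ A, dp k ω ≤ dp k ω' := by
  simp [SS]

theorem SS_sub {A : Finset Vec} {k ω : Vec} (h : ω ∈ SS A k) : ω ∈ A := (mem_SS.mp h).1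

theorem SS_nonempty {A : Finset Vec} (hA : A.Nonempty) (k : Vec) : (SS A k).Nonempty := by
  obtain ⟨a, ha, h⟩ := Finset.exists_min_image A (dp k) hA
  exact ⟨a, mem_SS.mpr ⟨ha, h⟩⟩

noncomputable def mm (A : Finset Vec) (k : Vec) : ℕ := sInf (dp k '' A)

theorem mm_eq {A : Finset Vec} {k a : Vec} (h : a ∈ SS A k) : mm A k = dp k a := by
  rw [mem_SS] at h
  have ha : dp k a ∈ dp k '' (A : Set Vec) := ⟨a, h.1, rfl⟩
  apply le_antisymm
  · exact Nat.sInf_le ha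
  · apply le_csInf ⟨_, ha⟩
    rintro _ ⟨ω, hω, rfl⟩
    exact h.2 ω hω

theorem mem_SS_iff_eq {A : Finset Vec} {k a ω : Vec} (h : a ∈ SS A k) (hω : ω ∈ A) :
    ω ∈ SS A k ↔ dp k ω = dp k a := by
  constructor
  · intro h'; rw [← mm_eq h, ← mm_eq h']
  · intro h'; rw [mem_SS] at h ⊢
    exact ⟨hω, fun ω' h2 => h' ▸ h.2 ω' h2⟩

theorem SS_add {A : Finset Vec} {k k' a : Vec} (h : a ∈ SS A k) (h' : a ∈ SS A k') :
    SS A (k + k') = SS A k ∩ SS A k' := by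
  have ha : a ∈ SS A (k + k') := by
    rw [mem_SS] at h h' ⊢
    refine ⟨h.1, fun ω hω => ?_⟩
    rw [dp_add, dp_add]
    exact add_le_add (h.2 ω hω) (h'.2 ω hω)
  ext ω
  rw [Finset.mem_inter]
  constructor
  · intro hω
    have hA := SS_sub hω
    rw [mem_SS_iff_eq ha hA, dp_add, dp_add] at hω
    rw [mem_SS_iff_eq h hA, mem_SS_iff_eq h' hA]
    rw [mem_SS] at h h'
    have := h.2 ω hA
    have := h'.2 ω hA
    omega
  · rintro ⟨h1, h2⟩
    have hA := SS_sub h1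
    rw [mem_SS_iff_eq h hA] at h1
    rw [mem_SS_iff_eq h' hA] at h2
    rw [mem_SS_iff_eq ha hA, dp_add, dp_add, h1, h2]

theorem SS_nsmul {A : Finset Vec} {n : ℕ} (hn : 0 < n) (k : Vec) : SS A (n • k) = SS A k := by
  ext ω
  simp only [mem_SS, dp_nsmul]
  constructor
  · rintro ⟨h1, h2⟩; exact ⟨h1, fun ω' h => Nat.le_of_mul_le_mul_left (h2 ω' h) hn⟩
  · rintro ⟨h1, h2⟩; exact ⟨h1, fun ω' h => Nat.mul_le_mul_left _ (h2 ω' h)⟩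

def IsRay (A : Finset Vec) (u : Vec) : Prop :=
  u ≠ 0 ∧ Prim u ∧ ∀ w : Fin 3 → ℤ, (∀ l, u l = 0 → w l = 0) →
    (∀ ω ∈ SS A u, ∀ ω' ∈ SS A u, zz (zv ω) w = zz (zv ω') w) →
    ∀ l, (sg u : ℤ) * w l = zs w * u l

theorem ray_eq_of_tight {A : Finset Vec} {u u' : Vec} (hu : IsRay A u) (hu' : IsRay A u')
    (h0 : ∀ l, u l = 0 → u' l = 0) (hS : SS A u ⊆ SS A u') : u = u' := by
  have := hu.2.2 (zv u') (fun l hl => by simp [zv, h0 l hl]) (by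
    intro ω hω ω' hω'
    rw [← dp_cast, ← dp_cast, ← mm_eq (hS hω), ← mm_eq (hS hω')])
  apply prim_eq hu.2.1 hu'.2.1 (sg_pos hu.1) (s' := sg u')
  intro l
  have h := this l
  rw [zs_zv] at h
  simp only [zv] at h
  exact_mod_cast h

theorem rays_finite (A : Finset Vec) : {u | IsRay A u}.Finite := by
  classical
  apply Set.Finite.of_finite_image (f := fun u => (SS A u, (Finset.univ.filter fun l : Fin 3 => u l = 0)))
  · apply Set.Finite.subset ((A.powerset ×ˢ (Finset.univ : Finset (Fin 3)).powerset).finite_toSet)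
    rintro _ ⟨u, hu, rfl⟩
    simp only [Finset.coe_product, Set.mem_prod, Finset.mem_coe, Finset.mem_powerset]
    exact ⟨Finset.filter_subset _ _, Finset.subset_univ _⟩
  · intro u hu u' hu' h
    simp only [Prod.mk.injEq] at h
    apply ray_eq_of_tight hu hu' _ h.1.subset
    intro l hl
    have : l ∈ Finset.univ.filter fun l : Fin 3 => u l = 0 := by simpa using hl
    rw [h.2] at this
    simpa using this

noncomputable def Rays (A : Finset Vec) : Finset Vec := (rays_finite A).toFinset

theorem mem_Rays {A : Finset Vec} {u : Vec} : u ∈ Rays A ↔ IsRay A u := by simp [Rays]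

open Classical in
noncomputable def CsA (A : Finset Vec) (a : Vec) : Finset (Fin 3 → ℤ) :=
  (Finset.univ.image fun l : Fin 3 => Pi.single l 1) ∪ A.image (fun ω => zv ω - zv a)

theorem forall_CsA {A : Finset Vec} {a : Vec} {P : (Fin 3 → ℤ) → Prop} :
    (∀ c ∈ CsA A a, P c) ↔ (∀ l, P (Pi.single l 1)) ∧ ∀ ω ∈ A, P (zv ω - zv a) := by
  classical
  simp only [CsA, Finset.mem_union, Finset.mem_image, Finset.mem_univ, true_and]
  constructor
  · intro h
    exact ⟨fun l => h _ (Or.inl ⟨l, rfl⟩), fun ω hω => h _ (Or.inr ⟨ω, hω, rfl⟩)⟩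
  · rintro ⟨h1, h2⟩ c (⟨l, rfl⟩ | ⟨ω, hω, rfl⟩)
    · exact h1 l
    · exact h2 ω hω

theorem zz_sub_left (c c' d : Fin 3 → ℤ) : zz (c - c') d = zz c d - zz c' d := by
  simp [zz]; ring

theorem zz_diff (k ω a : Vec) : zz (zv ω - zv a) (zv k) = (dp k ω : ℤ) - dp k a := by
  rw [zz_sub_left, dp_cast, dp_cast]

theorem CsA_nonneg {A : Finset Vec} {a : Vec} (ha : a ∈ A) {k : Vec} :
    (∀ c ∈ CsA A a, 0 ≤ zz c (zv k)) ↔ a ∈ SS A k := by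
  rw [forall_CsA (P := fun c => 0 ≤ zz c (zv k)), mem_SS]
  simp only [zz_single, zz_diff]
  constructor
  · rintro ⟨_, h⟩
    exact ⟨ha, fun ω hω => by have := h ω hω; omega⟩
  · rintro ⟨_, h⟩
    exact ⟨fun l => by simp [zv], fun ω hω => by have := h ω hω; omega⟩

theorem GRay_isRay {A : Finset Vec} {a u : Vec} (ha : a ∈ SS A u) (h0 : u ≠ 0) (hp : Prim u)
    (h : GRay (CsA A a) u) : IsRay A u := by
  refine ⟨h0, hp, fun w hw1 hw2 => h w ?_⟩
  rw [forall_CsA (P := fun c => zz c (zv u) = 0 → zz c w = 0)]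
  constructor
  · intro l; rw [zz_single, zz_single]
    intro h; apply hw1; simpa [zv] using h
  · intro ω hω h
    rw [zz_diff] at h
    rw [zz_sub_left, hw2 ω ((mem_SS_iff_eq ha hω).mpr (by omega)) a ha, sub_self]

/-- Minkowski–Weyl for the fan of A -/
theorem mw {A : Finset Vec} {a k : Vec} (hk : k ≠ 0) (ha : a ∈ SS A k) :
    ∃ N : ℕ, 0 < N ∧ N • k ∈ AddSubmonoid.closure
      {u | IsRay A u ∧ SS A k ⊆ SS A u ∧ ∀ l, k l = 0 → u l = 0} := by
  obtain ⟨N, hN, h⟩ := minkowski_weyl (CsA A a)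
    (by
      classical
      intro l; simp [CsA]) _ k hk le_rfl ((CsA_nonneg (SS_sub ha)).mpr ha)
  refine ⟨N, hN, AddSubmonoid.closure_mono ?_ h⟩
  rintro u ⟨h0, hp, hr, hnn, ht⟩
  have hau := (CsA_nonneg (SS_sub ha)).mp hnn
  rw [forall_CsA (P := fun c => zz c (zv k) = 0 → zz c (zv u) = 0)] at ht
  refine ⟨GRay_isRay hau h0 hp hr, ?_, ?_⟩
  · intro ω hω
    have hωA := SS_sub hω
    have := ht.2 ω hωA
    rw [zz_diff, zz_diff, (mem_SS_iff_eq ha hωA).mp hω, sub_self] at this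
    rw [mem_SS_iff_eq hau hωA]
    have := this rfl
    omega
  · intro l hl
    have := ht.1 l
    rw [zz_single, zz_single] at this
    simpa [zv, hl] using this

theorem ray_of_comb {A : Finset Vec} {a u u' u'' : Vec} (hu : IsRay A u) (hu' : IsRay A u')
    (hu'' : IsRay A u'') (ha : a ∈ SS A u) (ha' : a ∈ SS A u')
    {α β γ : ℤ} (hγ : 0 < γ) (hα : 0 ≤ α) (hβ : 0 ≤ β)
    (h : ∀ l, γ * u'' l = α * u l + β * u' l) : u'' = u ∨ u'' = u' := by
  have hz : ∀ ω, γ * (dp u'' ω : ℤ) = α * dp u ω + β * dp u' ω := by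
    intro ω
    simp only [dp]
    push_cast
    have h0 := h 0; have h1 := h 1; have h2 := h 2
    linear_combination (ω 0 : ℤ) * h0 + (ω 1 : ℤ) * h1 + (ω 2 : ℤ) * h2
  have ha'' : a ∈ SS A u'' := by
    rw [mem_SS] at *
    refine ⟨ha.1, fun ω hω => ?_⟩
    have h1 : (dp u a : ℤ) ≤ dp u ω := by exact_mod_cast ha.2 ω hω
    have h2 : (dp u' a : ℤ) ≤ dp u' ω := by exact_mod_cast ha'.2 ω hω
    have h3 : γ * (dp u'' a : ℤ) ≤ γ * dp u'' ω := by
      rw [hz, hz]; exact add_le_add (mul_le_mul_of_nonneg_left h1 hα) (mul_le_mul_of_nonneg_left h2 hβ)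
    exact_mod_cast le_of_mul_le_mul_left h3 hγ
  -- tightness
  have key : ∀ ω ∈ SS A u'', α * ((dp u ω : ℤ) - dp u a) = 0 ∧ β * ((dp u' ω : ℤ) - dp u' a) = 0 := by
    intro ω hω
    have hωA := SS_sub hω
    have e := (mem_SS_iff_eq ha'' hωA).mp hω
    have h1 : (dp u a : ℤ) ≤ dp u ω := by exact_mod_cast (mem_SS.mp ha).2 ω hωA
    have h2 : (dp u' a : ℤ) ≤ dp u' ω := by exact_mod_cast (mem_SS.mp ha').2 ω hωA
    have h3 := hz ω
    rw [e, hz] at h3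
    have h4 : 0 ≤ α * ((dp u ω : ℤ) - dp u a) := mul_nonneg hα (by omega)
    have h5 : 0 ≤ β * ((dp u' ω : ℤ) - dp u' a) := mul_nonneg hβ (by omega)
    constructor <;> nlinarith
  have key2 : ∀ l, u'' l = 0 → α * u l = 0 ∧ β * u' l = 0 := by
    intro l hl
    have := h l
    rw [hl] at this
    have h4 : 0 ≤ α * (u l : ℤ) := mul_nonneg hα (by omega)
    have h5 : 0 ≤ β * (u' l : ℤ) := mul_nonneg hβ (by omega)
    simp at this
    constructor <;> omega
  rcases hα.lt_or_eq with h1 | h1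
  · left
    apply ray_eq_of_tight hu'' hu
    · intro l hl
      have := (mul_eq_zero.mp (key2 l hl).1).resolve_left h1.ne'
      exact_mod_cast this
    · intro ω hω
      rw [mem_SS_iff_eq ha (SS_sub hω)]
      have := (mul_eq_zero.mp (key ω hω).1).resolve_left h1.ne'
      omega
  · rcases hβ.lt_or_eq with h2 | h2
    · right
      apply ray_eq_of_tight hu'' hu'
      · intro l hl
        have := (mul_eq_zero.mp (key2 l hl).2).resolve_left h2.ne'
        exact_mod_cast this
      · intro ω hω
        rw [mem_SS_iff_eq ha' (SS_sub hω)]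
        have := (mul_eq_zero.mp (key ω hω).2).resolve_left h2.ne'
        omega
    · exfalso
      apply hu''.1
      ext l
      have := h l
      rw [← h1, ← h2] at this
      simp at this
      simp; omega

theorem three_rays {A : Finset Vec} {a u u' u'' : Vec} (hu : IsRay A u) (hu' : IsRay A u')
    (hu'' : IsRay A u'') (ha : a ∈ SS A u) (ha' : a ∈ SS A u') (ha'' : a ∈ SS A u'')
    {c : Fin 3 → ℤ} (hc : c ≠ 0) (h1 : zz c (zv u) = 0) (h2 : zz c (zv u') = 0)
    (h3 : zz c (zv u'') = 0) : u = u' ∨ u = u'' ∨ u' = u'' := by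
  have hdet : (Matrix.of ![zv u, zv u', zv u'']).det = 0 := by
    rw [← Matrix.exists_mulVec_eq_zero_iff]
    refine ⟨c, hc, ?_⟩
    ext i
    fin_cases i <;> simp [Matrix.mulVec, dotProduct, Fin.sum_univ_three, zz] at * <;> linarith
  rw [← Matrix.exists_vecMul_eq_zero_iff] at hdet
  obtain ⟨v, hv, hv0⟩ := hdet
  have hrel : ∀ l, v 0 * (u l : ℤ) + v 1 * u' l + v 2 * u'' l = 0 := by
    intro l
    have := congrFun hv0 l
    simp [Matrix.vecMul, dotProduct, Fin.sum_univ_three, zv] at this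
    exact this
  have hs : v 0 * (sg u : ℤ) + v 1 * sg u' + v 2 * sg u'' = 0 := by
    have h0 := hrel 0; have h1 := hrel 1; have h2 := hrel 2
    simp only [sg]; push_cast; linear_combination h0 + h1 + h2
  have p0 : (0 : ℤ) < sg u := by exact_mod_cast sg_pos hu.1
  have p1 : (0 : ℤ) < sg u' := by exact_mod_cast sg_pos hu'.1
  have p2 : (0 : ℤ) < sg u'' := by exact_mod_cast sg_pos hu''.1
  have hcases : (0 ≤ v 0 ∧ 0 ≤ v 1 ∧ 0 ≤ v 2) ∨ (v 0 ≤ 0 ∧ v 1 ≤ 0 ∧ v 2 ≤ 0) ∨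
    (0 < v 0 ∧ v 1 ≤ 0 ∧ v 2 ≤ 0) ∨ (v 0 < 0 ∧ 0 ≤ v 1 ∧ 0 ≤ v 2) ∨
    (0 < v 1 ∧ v 0 ≤ 0 ∧ v 2 ≤ 0) ∨ (v 1 < 0 ∧ 0 ≤ v 0 ∧ 0 ≤ v 2) ∨
    (0 < v 2 ∧ v 0 ≤ 0 ∧ v 1 ≤ 0) ∨ (v 2 < 0 ∧ 0 ≤ v 0 ∧ 0 ≤ v 1) := by omega
  have hno : ∀ x y z : ℤ, 0 ≤ x → 0 ≤ y → 0 ≤ z → x * (sg u : ℤ) + y * sg u' + z * sg u'' = 0 →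
      x = 0 ∧ y = 0 ∧ z = 0 := by
    intro x y z hx hy hz h
    have a1 := mul_nonneg hx p0.le
    have a2 := mul_nonneg hy p1.le
    have a3 := mul_nonneg hz p2.le
    refine ⟨(mul_eq_zero.mp (show x * (sg u : ℤ) = 0 by omega)).resolve_right p0.ne',
      (mul_eq_zero.mp (show y * (sg u' : ℤ) = 0 by omega)).resolve_right p1.ne',
      (mul_eq_zero.mp (show z * (sg u'' : ℤ) = 0 by omega)).resolve_right p2.ne'⟩
  rcases hcases with ⟨x, y, z⟩ | ⟨x, y, z⟩ | ⟨x, y, z⟩ | ⟨x, y, z⟩ | ⟨x, y, z⟩ | ⟨x, y, z⟩ |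
    ⟨x, y, z⟩ | ⟨x, y, z⟩
  · exfalso
    obtain ⟨e0, e1, e2⟩ := hno _ _ _ x y z hs
    apply hv; ext l; fin_cases l <;> simp [*]
  · exfalso
    obtain ⟨e0, e1, e2⟩ := hno (-v 0) (-v 1) (-v 2) (by omega) (by omega) (by omega) (by linarith)
    apply hv; ext l; fin_cases l <;> simp <;> omega
  · rcases ray_of_comb hu' hu'' hu ha' ha'' x (neg_nonneg.mpr y) (neg_nonneg.mpr z)
      (fun l => by have := hrel l; linarith) with h | h <;> simp [h]
  · rcases ray_of_comb hu' hu'' hu ha' ha'' (neg_pos.mpr x) y z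
      (fun l => by have := hrel l; linarith) with h | h <;> simp [h]
  · rcases ray_of_comb hu hu'' hu' ha ha'' x (neg_nonneg.mpr y) (neg_nonneg.mpr z)
      (fun l => by have := hrel l; linarith) with h | h <;> simp [h]
  · rcases ray_of_comb hu hu'' hu' ha ha'' (neg_pos.mpr x) y z
      (fun l => by have := hrel l; linarith) with h | h <;> simp [h]
  · rcases ray_of_comb hu hu' hu'' ha ha' x (neg_nonneg.mpr y) (neg_nonneg.mpr z)
      (fun l => by have := hrel l; linarith) with h | h <;> simp [h]
  · rcases ray_of_comb hu hu' hu'' ha ha' (neg_pos.mpr x) y z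
      (fun l => by have := hrel l; linarith) with h | h <;> simp [h]

end PartC

section PartD

def B1c (A : Finset Vec) (u : Vec) (i : Fin 3) : Prop :=
  0 < u i ∧ (∀ ω ∈ SS A u, ω i ≤ 1) ∧ (∃ P ∈ SS A u, P i = 0) ∧
    ∃ C ∈ SS A u, C i = 1 ∧ ∀ D ∈ SS A u, D i = 1 → C ≤ D

def Adj (A : Finset Vec) (u u' : Vec) : Prop :=
  ∃ a ∈ SS A u, a ∈ SS A u' ∧ ((∃ ω ∈ SS A u, ω ∈ SS A u' ∧ ω ≠ a) ∨ ∃ l, u l = 0 ∧ u' l = 0)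

theorem Adj.symm {A : Finset Vec} {u u' : Vec} (h : Adj A u u') : Adj A u' u := by
  obtain ⟨a, h1, h2, h3⟩ := h
  refine ⟨a, h2, h1, ?_⟩
  rcases h3 with ⟨ω, h4, h5, h6⟩ | ⟨l, h4, h5⟩
  · exact Or.inl ⟨ω, h5, h4, h6⟩
  · exact Or.inr ⟨l, h5, h4⟩

theorem dp_mono {u C D : Vec} (h : C ≤ D) : dp u C ≤ dp u D := by
  unfold dp
  gcongr <;> apply h

/-- if `C ≤ D` and both minimize `u`, they agree where `u` is positive -/
theorem eq_of_le_of_dp_eq {u C D : Vec} (h : C ≤ D) (he : dp u C = dp u D) {j : Fin 3}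
    (hj : 0 < u j) : C j = D j := by
  unfold dp at he
  have h0 := Nat.mul_le_mul_left (u 0) (h 0)
  have h1 := Nat.mul_le_mul_left (u 1) (h 1)
  have h2 := Nat.mul_le_mul_left (u 2) (h 2)
  have : u j * C j = u j * D j := by
    fin_cases j
    · show u 0 * C 0 = u 0 * D 0; omega
    · show u 1 * C 1 = u 1 * D 1; omega
    · show u 2 * C 2 = u 2 * D 2; omega
  exact Nat.eq_of_mul_eq_mul_left hj this

theorem single_isRay (A : Finset Vec) (i : Fin 3) : IsRay A (Pi.single i 1) := by
  refine ⟨?_, ?_, ?_⟩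
  · intro h; have := congrFun h i; simp at this
  · fin_cases i <;> simp [Prim]
  · intro w hw _ l
    fin_cases i
    · have h1 := hw 1 (by simp); have h2 := hw 2 (by simp)
      fin_cases l <;> simp [sg, zs, h1, h2]
    · have h1 := hw 0 (by simp); have h2 := hw 2 (by simp)
      fin_cases l <;> simp [sg, zs, h1, h2]
    · have h1 := hw 0 (by simp); have h2 := hw 1 (by simp)
      fin_cases l <;> simp [sg, zs, h1, h2]

theorem mem_SS_single {A : Finset Vec} {a : Vec} {i : Fin 3} (ha : a ∈ A) (h : a i = 0) :
    a ∈ SS A (Pi.single i 1) := by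
  rw [mem_SS]
  refine ⟨ha, fun ω _ => ?_⟩
  rw [dp_single, dp_single, h]; exact Nat.zero_le _

theorem not_single {A : Finset Vec} {a u : Vec} {i : Fin 3} (ha : a ∈ A) (h : a i = 0)
    (hm : mm A u ≠ 0) : u ≠ Pi.single i 1 := by
  rintro rfl
  rw [mm_eq (mem_SS_single ha h), dp_single] at hm
  exact hm h

theorem b1c_two {A : Finset Vec} {u : Vec} (hu : IsRay A u) {i j : Fin 3} (hij : i ≠ j)
    (hi : B1c A u i) (hj : B1c A u j) : ∀ ω ∈ SS A u, ω i = 1 → ω j = 0 := by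
  obtain ⟨ui, bi, -, C, hC, hCi, hCm⟩ := hi
  obtain ⟨uj, bj, -, D, hD, hDj, hDm⟩ := hj
  intro ω hω hωi
  by_contra hωj
  have hωj1 : ω j = 1 := by have := bj ω hω; omega
  have eqv : ∀ x ∈ SS A u, ∀ y ∈ SS A u, dp u x = dp u y := by
    intro x hx y hy; rw [← mm_eq hx, ← mm_eq hy]
  have cj : C j = 1 := by
    rw [eq_of_le_of_dp_eq (hCm ω hω hωi) (eqv _ hC _ hω) uj, hωj1]
  have di : D i = 1 := by
    rw [eq_of_le_of_dp_eq (hDm ω hω hωj1) (eqv _ hD _ hω) ui, hωi]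
  have heq : ∀ x ∈ SS A u, x i = x j := by
    intro x hx
    have h1 := bi x hx
    have h2 := bj x hx
    by_cases h3 : x i = 1
    · have := eq_of_le_of_dp_eq (hCm x hx h3) (eqv _ hC _ hx) uj
      omega
    · by_cases h4 : x j = 1
      · have := eq_of_le_of_dp_eq (hDm x hx h4) (eqv _ hD _ hx) ui
        omega
      · omega
  have hw : ∀ x : Vec, zz (zv x) (Pi.single i 1 - Pi.single j 1) = (x i : ℤ) - x j := by
    intro x
    rw [zz_comm, zz_sub_left, zz_single, zz_single]; rfl
  have := hu.2.2 (Pi.single i 1 - Pi.single j 1) (by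
    intro l hl
    have h1 : l ≠ i := by rintro rfl; omega
    have h2 : l ≠ j := by rintro rfl; omega
    simp [h1, h2]) (by
    intro x hx y hy
    rw [hw, hw, heq x hx, heq y hy]; ring) i
  have hs : zs (Pi.single i 1 - Pi.single j 1) = 0 := by
    unfold zs
    fin_cases i <;> fin_cases j <;> simp
  rw [hs] at this
  have h0 := sg_pos hu.1
  simp [hij] at this
  omega

theorem two_var_nbr {A : Finset Vec} {u : Vec} (hu : IsRay A u) {i j : Fin 3} (hij : i ≠ j)
    (hi : B1c A u i) (hj : B1c A u j) :
    ∃ Q R : Vec, Q ∈ SS A u ∧ R ∈ SS A u ∧ Q ≠ R ∧ ∀ u', IsRay A u' → mm A u ≠ 0 → mm A u' ≠ 0 →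
      u' ≠ u → Adj A u u' → Q ∈ SS A u' ∧ R ∈ SS A u' := by
  have t1 := b1c_two hu hij hi hj
  have t2 := b1c_two hu hij.symm hj hi
  obtain ⟨ui, bi, -, C, hC, hCi, hCm⟩ := hi
  obtain ⟨uj, bj, -, D, hD, hDj, hDm⟩ := hj
  have hCj := t1 C hC hCi
  refine ⟨C, D, hC, hD, by rintro rfl; omega, ?_⟩
  intro u' hu' hm hm' hne hadj
  obtain ⟨a, ha, ha', h⟩ := hadj
  have hfin : ∀ x y, x ∈ SS A u → x ∈ SS A u' → y ∈ SS A u → y ∈ SS A u' → x i = 1 → y j = 1 →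
      C ∈ SS A u' ∧ D ∈ SS A u' := by
    intro x y hx hx' hy hy' hxi hyj
    constructor
    · rw [mem_SS] at hx' ⊢
      exact ⟨SS_sub hC, fun ω hω => (dp_mono (hCm x hx hxi)).trans (hx'.2 ω hω)⟩
    · rw [mem_SS] at hy' ⊢
      exact ⟨SS_sub hD, fun ω hω => (dp_mono (hDm y hy hyj)).trans (hy'.2 ω hω)⟩
  have hexcl : ∀ (c : Fin 3 → ℤ) (l : Fin 3), c ≠ 0 → zz c (zv u) = 0 → zz c (zv u') = 0 →
      c l = 0 → a l = 0 → False := by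
    intro c l hc h1 h2 hcl hal
    have h3 : zz c (zv (Pi.single l 1)) = 0 := by
      have : zv (Pi.single l 1) = Pi.single l 1 := by
        ext t; by_cases h : t = l
        · subst h; simp [zv]
        · simp [zv, h]
      rw [zz_comm, this, zz_single, hcl]
    rcases three_rays hu hu' (single_isRay A l) ha ha' (mem_SS_single (SS_sub ha) hal) hc h1 h2 h3
      with h | h | h
    · exact hne h.symm
    · exact not_single (SS_sub ha) hal hm h
    · exact not_single (SS_sub ha) hal hm' h
  rcases h with ⟨ω, hω, hω', hωa⟩ | ⟨l, hl, hl'⟩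
  · have hc : zv ω - zv a ≠ 0 := by
      intro h; apply hωa; exact zv_inj (sub_eq_zero.mp h)
    have h1 : zz (zv ω - zv a) (zv u) = 0 := by
      rw [zz_diff, ← mm_eq ha, ← mm_eq hω, sub_self]
    have h2 : zz (zv ω - zv a) (zv u') = 0 := by
      rw [zz_diff, ← mm_eq ha', ← mm_eq hω', sub_self]
    have e : ∀ l, (zv ω - zv a) l = (ω l : ℤ) - a l := fun l => rfl
    have a1 := bi a ha
    have a2 := bj a ha
    have o1 := bi ω hω
    have o2 := bj ω hω
    by_cases hj0 : a j = 0 ∧ ω j = 0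
    · exact (hexcl _ j hc h1 h2 (by rw [e]; omega) hj0.1).elim
    by_cases hi0 : a i = 0 ∧ ω i = 0
    · exact (hexcl _ i hc h1 h2 (by rw [e]; omega) hi0.1).elim
    have t3 := t1 a ha
    have t4 := t2 a ha
    have t5 := t1 ω hω
    have t6 := t2 ω hω
    by_cases hai : a i = 1
    · exact hfin a ω ha ha' hω hω' hai (by omega)
    · exact hfin ω a hω hω' ha ha' (by omega) (by omega)
  · have li : l ≠ i := by rintro rfl; omega
    have lj : l ≠ j := by rintro rfl; omega
    have hc : (Pi.single l 1 : Fin 3 → ℤ) ≠ 0 := by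
      intro h; have := congrFun h l; simp at this
    exfalso
    by_cases hai : a i = 0
    · exact hexcl (Pi.single l 1) i hc (by rw [zz_single]; simp [zv, hl])
        (by rw [zz_single]; simp [zv, hl']) (by simp [li.symm]) hai
    · have := t1 a ha (by have := bi a ha; omega)
      exact hexcl (Pi.single l 1) j hc (by rw [zz_single]; simp [zv, hl])
        (by rw [zz_single]; simp [zv, hl']) (by simp [lj.symm]) this

theorem two_var_unique {A : Finset Vec} {u : Vec} (hu : IsRay A u) {i j : Fin 3} (hij : i ≠ j)
    (hi : B1c A u i) (hj : B1c A u j) (hm : mm A u ≠ 0) {u' u'' : Vec}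
    (hu' : IsRay A u') (hu'' : IsRay A u'') (hm' : mm A u' ≠ 0) (hm'' : mm A u'' ≠ 0)
    (hne' : u' ≠ u) (hne'' : u'' ≠ u) (ha' : Adj A u u') (ha'' : Adj A u u'') : u' = u'' := by
  obtain ⟨Q, R, hQ, hR, hQR, h⟩ := two_var_nbr hu hij hi hj
  obtain ⟨q1, r1⟩ := h u' hu' hm hm' hne' ha'
  obtain ⟨q2, r2⟩ := h u'' hu'' hm hm'' hne'' ha''
  have hc : zv R - zv Q ≠ 0 := by
    intro h; apply hQR; exact (zv_inj (sub_eq_zero.mp h)).symm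
  rcases three_rays hu hu' hu'' hQ q1 q2 hc
    (by rw [zz_diff, ← mm_eq hQ, ← mm_eq hR, sub_self])
    (by rw [zz_diff, ← mm_eq q1, ← mm_eq r1, sub_self])
    (by rw [zz_diff, ← mm_eq q2, ← mm_eq r2, sub_self]) with h | h | h
  · exact (hne' h.symm).elim
  · exact (hne'' h.symm).elim
  · exact h

theorem exists_var {A : Finset Vec} (bad : Set Vec) (hray : ∀ u ∈ bad, IsRay A u)
    (hm : ∀ u ∈ bad, mm A u ≠ 0) (hB : ∀ u ∈ bad, ∃ i, B1c A u i)
    (hpair : ∀ u ∈ bad, ∀ u' ∈ bad, Adj A u u' → ∃ i, B1c A u i ∧ B1c A u' i) :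
    ∃ var : Vec → Fin 3, (∀ u ∈ bad, B1c A u (var u)) ∧
      ∀ u ∈ bad, ∀ u' ∈ bad, Adj A u u' → var u = var u' := by
  classical
  let J : Vec → Finset (Fin 3) := fun u => Finset.univ.filter fun i =>
    B1c A u i ∧ ∀ u' ∈ bad, Adj A u u' → B1c A u' i
  have claim : ∀ u ∈ bad, ∀ u' ∈ bad, u ≠ u' → Adj A u u' → ∀ i, B1c A u i → B1c A u' i →
      i ∈ J u' := by
    intro u hu u' hu' hne hadj i hi hi'
    simp only [J, Finset.mem_filter, Finset.mem_univ, true_and]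
    refine ⟨hi', fun u'' hu'' hadj' => ?_⟩
    by_cases h1 : u'' = u'
    · subst h1; exact hi'
    by_cases h2 : u'' = u
    · subst h2; exact hi
    obtain ⟨j, hj, hj'⟩ := hpair u' hu' u'' hu'' hadj'
    by_cases hij : i = j
    · subst hij; exact hj'
    · exact (h2 (two_var_unique (hray _ hu') hij hi' hj (hm _ hu') (hray _ hu'') (hray _ hu)
        (hm _ hu'') (hm _ hu) h1 hne hadj' hadj.symm)).elim
  have hJne : ∀ u ∈ bad, (J u).Nonempty := by
    intro u hu
    by_cases h : ∃ u' ∈ bad, u' ≠ u ∧ Adj A u' u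
    · obtain ⟨u', hu', hne, hadj⟩ := h
      obtain ⟨i, hi, hi'⟩ := hpair u' hu' u hu hadj
      exact ⟨i, claim u' hu' u hu hne hadj i hi hi'⟩
    · push Not at h
      obtain ⟨i, hi⟩ := hB u hu
      refine ⟨i, ?_⟩
      simp only [J, Finset.mem_filter, Finset.mem_univ, true_and]
      refine ⟨hi, fun u' hu' hadj => ?_⟩
      by_cases h1 : u' = u
      · subst h1; exact hi
      · exact (h u' hu' h1 hadj.symm).elim
  have hsub : ∀ u ∈ bad, ∀ u' ∈ bad, Adj A u u' → J u ⊆ J u' := by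
    intro u hu u' hu' hadj i hi
    by_cases h1 : u = u'
    · subst h1; exact hi
    · have hi2 := hi
      simp only [J, Finset.mem_filter, Finset.mem_univ, true_and] at hi2
      exact claim u hu u' hu' h1 hadj i hi2.1 (hi2.2 u' hu' hadj)
  refine ⟨fun u => if h : (J u).Nonempty then (J u).min' h else 0, ?_, ?_⟩
  · intro u hu
    show B1c A u (if h : (J u).Nonempty then (J u).min' h else 0)
    rw [dif_pos (hJne u hu)]
    have := Finset.min'_mem _ (hJne u hu)
    simp only [J, Finset.mem_filter, Finset.mem_univ, true_and] at this
    exact this.1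
  · intro u hu u' hu' hadj
    have : J u = J u' := (hsub u hu u' hu' hadj).antisymm (hsub u' hu' u hu hadj.symm)
    simp only [this]

end PartD

section PartE

noncomputable def wt (A : Finset Vec) (p : ℕ) (T : ℂ) (k : Vec) : ℂ :=
  ((p : ℂ)⁻¹) ^ sg k * T ^ mm A k

def Bad (A : Finset Vec) (p : ℕ) (T : ℂ) : Set Vec := {u | IsRay A u ∧ wt A p T u = 1}

def VPos (k : Vec) : Prop := ∀ l, 0 < k l

structure IsCell (A : Finset Vec) (p : ℕ) (T : ℂ) (M : Set Vec) (S : Finset Vec) (a : Vec)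
    (W : Finset Vec) : Prop where
  hS : ∀ k ∈ M, SS A k = S
  haA : a ∈ A
  haS : ∀ k ∈ M, a ∈ SS A k
  hW0 : ∀ w ∈ W, w ≠ 0
  haW : ∀ w ∈ W, a ∈ SS A w
  hadd : ∀ k ∈ M, ∀ w ∈ W, k + w ∈ M
  hcone : ∀ k ∈ M, ∃ N : ℕ, 0 < N ∧ N • k ∈ AddSubmonoid.closure (W : Set Vec)
  hbad : ∀ w ∈ W, wt A p T w = 1 → w ∈ Bad A p T
  hadj : ∀ w ∈ W, ∀ w' ∈ W, w ∈ Bad A p T → w' ∈ Bad A p T → Adj A w w'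
  hpar : ∀ w ∈ W, ∀ v ∈ Bad A p T, (∀ l, mm A v * w l = mm A w * v l) → w = v

theorem inv_pow_ne_one {p : ℕ} (hp : 2 ≤ p) {n : ℕ} (hn : 0 < n) : ((p : ℂ)⁻¹) ^ n ≠ 1 := by
  intro h
  rw [inv_pow, inv_eq_one] at h
  have h' : p ^ n = 1 := by exact_mod_cast h
  rw [Nat.pow_eq_one] at h'
  omega

theorem Bad.mm_ne {A : Finset Vec} {p : ℕ} (hp : 2 ≤ p) {T : ℂ} {u : Vec} (h : u ∈ Bad A p T) :
    mm A u ≠ 0 := by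
  intro h0
  have := h.2
  rw [wt, h0, pow_zero, mul_one] at this
  exact inv_pow_ne_one hp (sg_pos h.1.1) this

theorem VPos.ne_zero {k : Vec} (h : VPos k) : k ≠ 0 := by
  rintro rfl; exact absurd (h 0) (by simp)

theorem VPos.add {k w : Vec} (h : VPos k) : VPos (k + w) := by
  intro l; have := h l; simp only [Pi.add_apply]; omega

theorem cell_empty {A : Finset Vec} (hA : A.Nonempty) (p : ℕ) (T : ℂ) {M : Set Vec} (hM : M = ∅)
    (S : Finset Vec) : ∃ a W, IsCell A p T M S a W := by
  obtain ⟨a, ha⟩ := hA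
  subst hM
  exact ⟨a, ∅, by simp, ha, by simp, by simp, by simp, by simp, by simp, by simp, by simp, by simp⟩

theorem ray_par {A : Finset Vec} {p : ℕ} (hp : 2 ≤ p) {T : ℂ} {w v : Vec} (hw : IsRay A w)
    (hv : v ∈ Bad A p T) (h : ∀ l, mm A v * w l = mm A w * v l) : w = v :=
  (prim_eq hv.1.2.1 hw.2.1 (Nat.pos_of_ne_zero (Bad.mm_ne hp hv)) h).symm

/-- cells of type 1 and 2 -/
theorem cell_simple {A : Finset Vec} {p : ℕ} (hp : 2 ≤ p) (T : ℂ) (S : Finset Vec)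
    {k0 : Vec} (hk0 : VPos k0 ∧ SS A k0 = S) {a : Vec} (ha : a ∈ S)
    (hS : (∃ ω ∈ S, ω ≠ a) ∨ ∀ u ∈ Bad A p T, a ∉ SS A u) :
    ∃ W, IsCell A p T {k | VPos k ∧ SS A k = S} S a W := by
  classical
  refine ⟨(Rays A).filter (fun u => S ⊆ SS A u), ?_⟩
  constructor
  · intro k hk; exact hk.2
  · exact SS_sub (hk0.2.symm ▸ ha)
  · intro k hk; rw [hk.2]; exact ha
  · intro w hw; exact (mem_Rays.mp (Finset.mem_filter.mp hw).1).1
  · intro w hw; exact (Finset.mem_filter.mp hw).2 ha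
  · intro k hk w hw
    refine ⟨hk.1.add, ?_⟩
    have h := (Finset.mem_filter.mp hw).2
    rw [SS_add (a := a) (by rw [hk.2]; exact ha) (h ha), hk.2, Finset.inter_eq_left.mpr h]
  · intro k hk
    obtain ⟨N, hN, h⟩ := mw hk.1.ne_zero (a := a) (by rw [hk.2]; exact ha)
    refine ⟨N, hN, AddSubmonoid.closure_mono ?_ h⟩
    rintro u ⟨h1, h2, -⟩
    rw [hk.2] at h2
    simp [mem_Rays, h1, h2]
  · intro w hw h
    exact ⟨mem_Rays.mp (Finset.mem_filter.mp hw).1, h⟩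
  · intro w hw w' hw' hb hb'
    have h1 := (Finset.mem_filter.mp hw).2
    have h2 := (Finset.mem_filter.mp hw').2
    rcases hS with ⟨ω, hω, hne⟩ | hS
    · exact ⟨a, h1 ha, h2 ha, Or.inl ⟨ω, h1 hω, h2 hω, hne⟩⟩
    · exact (hS w hb (h1 ha)).elim
  · intro w hw v hv h
    exact ray_par hp (mem_Rays.mp (Finset.mem_filter.mp hw).1) hv h

noncomputable def argm (A : Finset Vec) (a b k : Vec) : Finset (Fin 3 → ℤ) :=
  (CsA A a).filter (fun c => c ≠ 0 ∧ ∀ c' ∈ CsA A a, c' ≠ 0 →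
    zz c (zv k) * zz c' (zv b) ≤ zz c' (zv k) * zz c (zv b))

theorem CsA_pos {A : Finset Vec} {a b : Vec} (hb : VPos b) (hSb : SS A b = {a}) :
    ∀ c ∈ CsA A a, c ≠ 0 → 0 < zz c (zv b) := by
  rw [forall_CsA (P := fun c => c ≠ 0 → 0 < zz c (zv b))]
  constructor
  · intro l _; rw [zz_single]; simp [zv, hb l]
  · intro ω hω hne
    rw [zz_diff]
    have ha : a ∈ SS A b := by simp [hSb]
    have h1 := (mem_SS.mp ha).2 ω hω
    have h2 : dp b ω ≠ dp b a := by
      intro h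
      rw [← mem_SS_iff_eq ha hω, hSb, Finset.mem_singleton] at h
      apply hne; rw [h, sub_self]
    omega

theorem cell_star {A : Finset Vec} {p : ℕ} (hp : 2 ≤ p) (T : ℂ) {a b : Vec}
    (hb : VPos b) (hSb : SS A b = {a}) (hbg : wt A p T b ≠ 1) (𝒜 : Finset (Fin 3 → ℤ))
    (hM : ∃ k, argm A a b k = 𝒜) :
    ∃ W, IsCell A p T {k | (VPos k ∧ SS A k = {a}) ∧ argm A a b k = 𝒜} {a} a W := by
  classical
  have hab : a ∈ SS A b := by simp [hSb]
  have haA := SS_sub hab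
  have hbpos := CsA_pos hb hSb
  have hsing : ∀ l, (Pi.single l 1 : Fin 3 → ℤ) ∈ CsA A a := fun l => by simp [CsA]
  have hsing0 : ∀ l, (Pi.single l 1 : Fin 3 → ℤ) ≠ 0 := fun l h => by
    have := congrFun h l; simp at this
  have hargne : ∀ k, (argm A a b k).Nonempty := by
    intro k
    have hne : ((CsA A a).filter (fun c => c ≠ 0)).Nonempty :=
      ⟨Pi.single 0 1, Finset.mem_filter.mpr ⟨hsing 0, hsing0 0⟩⟩
    obtain ⟨c, hc, hmin⟩ := Finset.exists_min_image _
      (fun c => (zz c (zv k) : ℚ) / (zz c (zv b) : ℚ)) hne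
    rw [Finset.mem_filter] at hc
    refine ⟨c, ?_⟩
    rw [argm, Finset.mem_filter]
    refine ⟨hc.1, hc.2, fun c' h1 h2 => ?_⟩
    have := hmin c' (Finset.mem_filter.mpr ⟨h1, h2⟩)
    rw [div_le_div_iff₀ (by exact_mod_cast hbpos c hc.1 hc.2)
      (by exact_mod_cast hbpos c' h1 h2)] at this
    exact_mod_cast this
  refine ⟨insert b ((Rays A).filter (fun u => a ∈ SS A u ∧ ∀ c ∈ 𝒜, zz c (zv u) = 0)), ?_⟩
  have hmem : ∀ {w}, w ∈ insert b ((Rays A).filter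
      (fun u => a ∈ SS A u ∧ ∀ c ∈ 𝒜, zz c (zv u) = 0)) →
      w = b ∨ (IsRay A w ∧ a ∈ SS A w ∧ ∀ c ∈ 𝒜, zz c (zv w) = 0) := by
    intro w hw
    rw [Finset.mem_insert, Finset.mem_filter, mem_Rays] at hw
    exact hw
  constructor
  · intro k hk; exact hk.1.2
  · exact haA
  · intro k hk; rw [hk.1.2]; simp
  · intro w hw
    rcases hmem hw with rfl | h
    · exact hb.ne_zero
    · exact h.1.1
  · intro w hw
    rcases hmem hw with rfl | h
    · exact hab
    · exact h.2.1
  · rintro k ⟨⟨hk1, hk2⟩, hk3⟩ w hw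
    have haw : a ∈ SS A w := by
      rcases hmem hw with rfl | h
      · exact hab
      · exact h.2.1
    refine ⟨⟨hk1.add, ?_⟩, ?_⟩
    · rw [SS_add (a := a) (by simp [hk2]) haw, hk2]
      simpa using haw
    rw [← hk3]
    rcases hmem hw with rfl | ⟨h1, h2, h3⟩
    · unfold argm
      apply Finset.filter_congr
      intro c _
      simp only [zv_add, zz_add, add_mul]
      have : ∀ x y z t : ℤ, x + z * t ≤ y + t * z ↔ x ≤ y := by
        intro x y z t; rw [mul_comm t z]; omega
      simp only [this]
    · obtain ⟨c0, hc0⟩ := hargne k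
      have hwn := (CsA_nonneg haA).mpr h2
      have hc0' := hc0
      rw [argm, Finset.mem_filter] at hc0'
      obtain ⟨hc0C, hc00, hc0m⟩ := hc0'
      have hc0b := hbpos c0 hc0C hc00
      have hc0w : zz c0 (zv w) = 0 := h3 c0 (hk3 ▸ hc0)
      ext c
      constructor
      · intro hc
        rw [argm, Finset.mem_filter] at hc ⊢
        refine ⟨hc.1, hc.2.1, fun c' h4 h5 => ?_⟩
        have e1 := hc.2.2 c0 hc0C hc00
        rw [zv_add, zz_add, zz_add, hc0w, add_zero, add_mul] at e1
        have e2 := hc0m c' h4 h5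
        have e3 : 0 ≤ zz c (zv w) * zz c0 (zv b) := mul_nonneg (hwn c hc.1) hc0b.le
        have e4 := hbpos c hc.1 hc.2.1
        have e5 := hbpos c' h4 h5
        -- c·k * c0·b ≤ c0·k * c·b ; c0·k * c'·b ≤ c'·k * c0·b
        have e6 : (zz c (zv k) * zz c' (zv b)) * zz c0 (zv b)
            ≤ (zz c' (zv k) * zz c (zv b)) * zz c0 (zv b) := by
          have f1 : zz c (zv k) * zz c0 (zv b) ≤ zz c0 (zv k) * zz c (zv b) := by linarith
          have f2 := mul_le_mul_of_nonneg_right f1 e5.le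
          have f3 := mul_le_mul_of_nonneg_right e2 e4.le
          nlinarith
        exact le_of_mul_le_mul_right e6 hc0b
      · intro hc
        have hcw : zz c (zv w) = 0 := h3 c (hk3 ▸ hc)
        rw [argm, Finset.mem_filter] at hc ⊢
        refine ⟨hc.1, hc.2.1, fun c' h4 h5 => ?_⟩
        have e1 := hc.2.2 c' h4 h5
        have e2 : 0 ≤ zz c' (zv w) * zz c (zv b) :=
          mul_nonneg (hwn c' h4) (hbpos c hc.1 hc.2.1).le
        rw [zv_add, zz_add, zz_add, hcw, add_zero, add_mul]
        linarith
  · rintro k ⟨⟨hk1, hk2⟩, hk3⟩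
    obtain ⟨c0, hc0⟩ := hargne k
    have hc0' := hc0
    rw [argm, Finset.mem_filter] at hc0'
    obtain ⟨hc0C, hc00, hc0m⟩ := hc0'
    have hc0b := hbpos c0 hc0C hc00
    have hc0k := CsA_pos hk1 hk2 c0 hc0C hc00
    set v : Fin 3 → ℤ := zz c0 (zv b) • zv k + (-zz c0 (zv k)) • zv b with hv
    have hzv : ∀ c, zz c v = zz c0 (zv b) * zz c (zv k) - zz c0 (zv k) * zz c (zv b) := by
      intro c; rw [hv, zz_add, zz_smul, zz_smul]; ring
    have hvn : ∀ c ∈ CsA A a, 0 ≤ zz c v := by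
      intro c hc
      by_cases h0 : c = 0
      · subst h0; simp [zz]
      · have := hc0m c hc h0
        rw [hzv]; linarith
    have hvl : ∀ l, 0 ≤ v l := by
      intro l; rw [← zz_single l v]; exact hvn _ (hsing l)
    have hk' : zv (fun l => (v l).toNat) = v := by
      ext l; simp only [zv]; exact Int.toNat_of_nonneg (hvl l)
    set k' : Vec := fun l => (v l).toNat with hk'def
    have hak' : a ∈ SS A k' := (CsA_nonneg haA).mp (by rw [hk']; exact hvn)
    have heq : (zz c0 (zv b)).toNat • k = (zz c0 (zv k)).toNat • b + k' := by
      apply zv_inj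
      rw [zv_add, zv_nsmul, zv_nsmul, hk', Int.toNat_of_nonneg hc0b.le,
        Int.toNat_of_nonneg hc0k.le, hv]
      ext l; simp
    by_cases hk0 : k' = 0
    · refine ⟨(zz c0 (zv b)).toNat, by omega, ?_⟩
      rw [heq, hk0, add_zero]
      apply AddSubmonoid.nsmul_mem
      apply AddSubmonoid.subset_closure
      simp
    · obtain ⟨N, hN, h⟩ := mw hk0 hak'
      refine ⟨N * (zz c0 (zv b)).toNat, by have : 0 < (zz c0 (zv b)).toNat := by omega
                                           positivity, ?_⟩
      rw [mul_smul, heq, smul_add]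
      apply add_mem
      · apply AddSubmonoid.nsmul_mem
        apply AddSubmonoid.nsmul_mem
        apply AddSubmonoid.subset_closure
        simp
      · refine AddSubmonoid.closure_mono ?_ h
        rintro u ⟨h1, h2, h3⟩
        have hau := h2 hak'
        rw [Finset.mem_coe, Finset.mem_insert, Finset.mem_filter, mem_Rays]
        refine Or.inr ⟨h1, hau, fun c hc => ?_⟩
        -- c is tight at k'
        rw [← hk3, argm, Finset.mem_filter] at hc
        have e0 : zz c v = 0 := by
          have e1 := hc.2.2 c0 hc0C hc00
          have e2 := hc0m c hc.1 hc.2.1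
          rw [hzv]; linarith
        have key : ∀ c ∈ CsA A a, zz c v = 0 → zz c (zv u) = 0 := by
          rw [forall_CsA (P := fun c => zz c v = 0 → zz c (zv u) = 0)]
          constructor
          · intro l hl
            rw [zz_single] at hl ⊢
            have : k' l = 0 := by simp [hk'def, hl]
            simp [zv, h3 l this]
          · intro ω hω h0
            rw [← hk', zz_diff] at h0
            have : ω ∈ SS A k' := (mem_SS_iff_eq hak' hω).mpr (by omega)
            rw [zz_diff, ← mm_eq hau, ← mm_eq (h2 this), sub_self]
        exact key c hc.1 e0
  · intro w hw h
    rcases hmem hw with rfl | h'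
    · exact (hbg h).elim
    · exact ⟨h'.1, h⟩
  · intro w hw w' hw' hbw hbw'
    rcases hmem hw with rfl | ⟨h1, h2, h3⟩
    · exact (hbg hbw.2).elim
    rcases hmem hw' with rfl | ⟨h1', h2', h3'⟩
    · exact (hbg hbw'.2).elim
    have h𝒜 : ∃ c ∈ 𝒜, c ∈ CsA A a ∧ c ≠ 0 := by
      obtain ⟨k, rfl⟩ := hM
      obtain ⟨c, hc⟩ := hargne k
      have hc' := hc
      rw [argm, Finset.mem_filter] at hc'
      exact ⟨c, hc, hc'.1, hc'.2.1⟩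
    · obtain ⟨c, hc, hcC, hc0⟩ := h𝒜
      have key : ∀ c ∈ CsA A a, c ≠ 0 → zz c (zv w) = 0 → zz c (zv w') = 0 → Adj A w w' := by
        rw [forall_CsA (P := fun c => c ≠ 0 → zz c (zv w) = 0 → zz c (zv w') = 0 → Adj A w w')]
        constructor
        · intro l _ e1 e2
          rw [zz_single] at e1 e2
          exact ⟨a, h2, h2', Or.inr ⟨l, by simpa [zv] using e1, by simpa [zv] using e2⟩⟩
        · intro ω hω hne e1 e2
          rw [zz_diff] at e1 e2
          refine ⟨a, h2, h2', Or.inl ⟨ω, (mem_SS_iff_eq h2 hω).mpr (by omega),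
            (mem_SS_iff_eq h2' hω).mpr (by omega), ?_⟩⟩
          rintro rfl
          simp at hne
      exact key c hcC hc0 (h3 c hc) (h3' c hc)
  · intro w hw v hv h
    rcases hmem hw with rfl | h'
    · exfalso
      have hmv := Bad.mm_ne hp hv
      have hmw : mm A w ≠ 0 := by
        intro h0
        have := h 0
        rw [h0, zero_mul, mul_eq_zero] at this
        have := hb 0
        omega
      have hvec : mm A v • w = mm A w • v := by
        ext l; simpa using h l
      have hSv : SS A v = {a} := by
        rw [← SS_nsmul (Nat.pos_of_ne_zero hmw) v, ← hvec,
          SS_nsmul (Nat.pos_of_ne_zero hmv) w, hSb]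
      have hvl : ∀ l, v l ≠ 0 := by
        intro l h0
        have := h l
        rw [h0, mul_zero, mul_eq_zero] at this
        have := hb l
        omega
      have := hv.1.2.2 (Pi.single 0 1) (fun l h0 => (hvl l h0).elim) (by
        intro ω hω ω' hω'
        rw [hSv, Finset.mem_singleton] at hω hω'
        rw [hω, hω']) 1
      have h1 := hvl 1
      simp [zs] at this
      exact h1 (by omega)
    · exact ray_par hp h'.1 hv h


theorem cell_labels {A : Finset Vec} (hA : A.Nonempty) {p : ℕ} (hp : 2 ≤ p) {T : ℂ} (hT : T ≠ p)
    (hB : ∀ u ∈ Bad A p T, ∃ i, B1c A u i) (S : Finset Vec) :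
    ∃ φ : Vec → Finset (Fin 3 → ℤ), (Set.range φ).Finite ∧
      ∀ 𝒜, ∃ a W, IsCell A p T {k | (VPos k ∧ SS A k = S) ∧ φ k = 𝒜} S a W := by
  classical
  by_cases hM : ∃ k0, VPos k0 ∧ SS A k0 = S
  swap
  · refine ⟨fun _ => ∅, Set.toFinite _ |>.subset (Set.range_const_subset), fun 𝒜 => ?_⟩
    apply cell_empty hA
    ext k
    simp only [Set.mem_ofPred_eq, Set.mem_empty_iff_false, iff_false]
    rintro ⟨h, -⟩
    exact hM ⟨k, h⟩
  obtain ⟨k0, hk0⟩ := hM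
  obtain ⟨a, ha⟩ : S.Nonempty := hk0.2 ▸ SS_nonempty hA k0
  by_cases hs : (∃ ω ∈ S, ω ≠ a) ∨ ∀ u ∈ Bad A p T, a ∉ SS A u
  · refine ⟨fun _ => ∅, Set.toFinite _ |>.subset (Set.range_const_subset), fun 𝒜 => ?_⟩
    by_cases h : 𝒜 = ∅
    · subst h
      obtain ⟨W, hW⟩ := cell_simple hp T S hk0 ha hs
      refine ⟨a, W, ?_⟩
      convert hW using 1
      ext k; simp
    · apply cell_empty hA
      ext k
      simp only [Set.mem_ofPred_eq, Set.mem_empty_iff_false, iff_false]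
      rintro ⟨-, h'⟩
      exact h h'.symm
  push Not at hs
  obtain ⟨hs1, u0, hu0, hau0⟩ := hs
  have hSa : S = {a} := by
    ext ω; simp only [Finset.mem_singleton]
    exact ⟨hs1 ω, fun h => h ▸ ha⟩
  subst hSa
  obtain ⟨i, hi⟩ := hB u0 hu0
  have hak : a ∈ SS A k0 := by rw [hk0.2]; exact ha
  have hp0 : (p : ℂ) ≠ 0 := by
    have : p ≠ 0 := by omega
    exact_mod_cast this
  obtain ⟨b, hb, hSb, hbg⟩ : ∃ b, VPos b ∧ SS A b = {a} ∧ wt A p T b ≠ 1 := by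
    by_cases h1 : wt A p T k0 = 1
    swap
    · exact ⟨k0, hk0.1, hk0.2, h1⟩
    have hai : a i ≤ 1 := hi.2.1 a hau0
    have hlow : ∀ D ∈ A, D ≠ a → dp (2 • k0 + Pi.single i 1) a < dp (2 • k0 + Pi.single i 1) D := by
      intro D hD hne
      have h2 := (mem_SS.mp hak).2 D hD
      have h3 : dp k0 D ≠ dp k0 a := by
        intro h
        rw [← mem_SS_iff_eq hak hD, hk0.2, Finset.mem_singleton] at h
        exact hne h
      simp only [dp_add, dp_nsmul, dp_single]
      omega
    have hab : a ∈ SS A (2 • k0 + Pi.single i 1) := by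
      rw [mem_SS]
      refine ⟨SS_sub hak, fun D hD => ?_⟩
      by_cases h : D = a
      · rw [h]
      · exact (hlow D hD h).le
    refine ⟨2 • k0 + Pi.single i 1, ?_, ?_, ?_⟩
    · apply VPos.add
      intro l; have := hk0.1 l; simp [this]
    · ext D
      rw [Finset.mem_singleton]
      constructor
      · intro h
        by_contra hne
        have h2 := hlow D (SS_sub h) hne
        rw [(mem_SS_iff_eq hab (SS_sub h)).mp h] at h2
        exact lt_irrefl _ h2
      · rintro rfl; exact hab
    · have hsg : sg (2 • k0 + Pi.single i 1) = 2 * sg k0 + 1 := by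
        fin_cases i <;> simp [sg] <;> ring
      rw [wt, mm_eq hab, hsg, dp_add, dp_nsmul, dp_single]
      rw [wt, mm_eq hak] at h1
      have e : ((p : ℂ)⁻¹) ^ (2 * sg k0 + 1) * T ^ (2 * dp k0 a + a i)
          = (((p : ℂ)⁻¹) ^ sg k0 * T ^ dp k0 a) ^ 2 * ((p : ℂ)⁻¹ * T ^ a i) := by ring
      rw [e, h1, one_pow, one_mul]
      intro h
      have ht : T ^ a i = p := by
        field_simp at h
        exact h
      have : a i = 0 ∨ a i = 1 := by omega
      rcases this with h0 | h0
      · rw [h0, pow_zero] at ht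
        have : 1 = p := by exact_mod_cast ht
        omega
      · rw [h0, pow_one] at ht
        exact hT ht
  refine ⟨argm A a b, ?_, fun 𝒜 => ?_⟩
  · refine ((CsA A a).powerset : Finset _).finite_toSet.subset ?_
    rintro _ ⟨k, rfl⟩
    rw [Finset.mem_coe, Finset.mem_powerset]
    exact Finset.filter_subset _ _
  · by_cases h : ∃ k, argm A a b k = 𝒜
    · exact ⟨a, cell_star hp T hb hSb hbg 𝒜 h⟩
    · apply cell_empty hA
      ext k
      simp only [Set.mem_ofPred_eq, Set.mem_empty_iff_false, iff_false]
      rintro ⟨-, hkA⟩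
      exact h ⟨k, hkA⟩

/-- the finite decomposition of the open octant into cells -/
theorem cells {A : Finset Vec} (hA : A.Nonempty) {p : ℕ} (hp : 2 ≤ p) {T : ℂ} (hT : T ≠ p)
    (hB : ∀ u ∈ Bad A p T, ∃ i, B1c A u i) :
    ∃ (lab : Vec → Finset Vec × Finset (Fin 3 → ℤ)) (Λ : Finset (Finset Vec × Finset (Fin 3 → ℤ)))
      (a : Finset Vec × Finset (Fin 3 → ℤ) → Vec) (W : Finset Vec × Finset (Fin 3 → ℤ) → Finset Vec),
      (∀ k, lab k ∈ Λ) ∧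
      ∀ l, IsCell A p T {k | VPos k ∧ lab k = l} l.1 (a l) (W l) := by
  classical
  choose φ hfin hcell using cell_labels hA hp hT hB
  choose a W hcell using hcell
  have hF : (⋃ S ∈ (A.powerset : Set (Finset Vec)), (Prod.mk S) '' (Set.range (φ S))).Finite := by
    apply Set.Finite.biUnion (A.powerset.finite_toSet)
    intro S _
    exact (hfin S).image _
  refine ⟨fun k => (SS A k, φ (SS A k) k), hF.toFinset, fun l => a l.1 l.2, fun l => W l.1 l.2,
    ?_, ?_⟩
  · intro k
    rw [Set.Finite.mem_toFinset, Set.mem_iUnion₂]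
    refine ⟨SS A k, ?_, φ (SS A k) k, ⟨k, rfl⟩, rfl⟩
    rw [Finset.mem_coe, Finset.mem_powerset]
    exact fun _ h => SS_sub h
  · rintro ⟨S, 𝒜⟩
    convert hcell S 𝒜 using 1
    ext k
    simp only [Set.mem_ofPred_eq, Prod.mk.injEq]
    constructor
    · rintro ⟨h1, rfl, h3⟩; exact ⟨⟨h1, rfl⟩, h3⟩
    · rintro ⟨⟨h1, rfl⟩, h3⟩; exact ⟨h1, rfl, h3⟩

end PartE

section PartF

def Reg (T1 : ℂ) (g : ℂ → ℂ) : Prop :=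
  ∃ P Q : Polynomial ℂ, Q.eval T1 ≠ 0 ∧ ∀ T : ℂ, ‖T‖ < 1 → Q.eval T * g T = P.eval T

theorem Reg.add {T1 : ℂ} {g h : ℂ → ℂ} (hg : Reg T1 g) (hh : Reg T1 h) :
    Reg T1 (fun T => g T + h T) := by
  obtain ⟨P, Q, h1, h2⟩ := hg
  obtain ⟨P', Q', h1', h2'⟩ := hh
  refine ⟨P * Q' + P' * Q, Q * Q', by simp [h1, h1'], fun T hT => ?_⟩
  simp only [Polynomial.eval_mul, Polynomial.eval_add, ← h2 T hT, ← h2' T hT]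
  ring

theorem Reg.congr {T1 : ℂ} {g h : ℂ → ℂ} (hg : Reg T1 g) (hh : ∀ T : ℂ, ‖T‖ < 1 → h T = g T) :
    Reg T1 h := by
  obtain ⟨P, Q, h1, h2⟩ := hg
  exact ⟨P, Q, h1, fun T hT => by rw [hh T hT, h2 T hT]⟩

theorem Reg.zero (T1 : ℂ) : Reg T1 (fun _ => 0) := ⟨0, 1, by simp, by simp⟩

theorem Reg.neg {T1 : ℂ} {g : ℂ → ℂ} (hg : Reg T1 g) : Reg T1 (fun T => - g T) := by
  obtain ⟨P, Q, h1, h2⟩ := hg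
  exact ⟨-P, Q, h1, fun T hT => by simp [← h2 T hT]⟩

theorem Reg.sum {ι : Type*} {T1 : ℂ} (s : Finset ι) {g : ι → ℂ → ℂ} (hg : ∀ i ∈ s, Reg T1 (g i)) :
    Reg T1 (fun T => ∑ i ∈ s, g i T) := by
  classical
  induction s using Finset.induction_on with
  | empty => simpa using Reg.zero T1
  | insert i s hi ih =>
    simp only [Finset.sum_insert hi]
    exact (hg i (by simp)).add (ih (fun j hj => hg j (by simp [hj])))

/-- evaluation of a polynomial with continuous coefficients -/
noncomputable def ev {I : Type*} [TopologicalSpace I] (r : I) : Polynomial C(I, ℂ) →+* Polynomial ℂ :=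
  Polynomial.mapRingHom ((Pi.evalRingHom (fun _ : I => ℂ) r).comp
    (ContinuousMap.coeFnRingHom : C(I, ℂ) →+* (I → ℂ)))

def PolyC {I : Type*} [TopologicalSpace I] (g : I → ℂ → ℂ) : Prop :=
  ∃ P : Polynomial C(I, ℂ), ∀ r T, (ev r P).eval T = g r T

theorem PolyC.const {I : Type*} [TopologicalSpace I] (c : C(I, ℂ)) : PolyC (fun r _ => c r) :=
  ⟨Polynomial.C c, fun r T => by simp [ev]⟩

theorem PolyC.X {I : Type*} [TopologicalSpace I] : PolyC (fun (_ : I) T => T) :=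
  ⟨Polynomial.X, fun r T => by simp [ev]⟩

theorem PolyC.add {I : Type*} [TopologicalSpace I] {g h : I → ℂ → ℂ} (hg : PolyC g) (hh : PolyC h) :
    PolyC (fun r T => g r T + h r T) := by
  obtain ⟨P, hP⟩ := hg
  obtain ⟨Q, hQ⟩ := hh
  exact ⟨P + Q, fun r T => by simp [hP, hQ]⟩

theorem PolyC.mul {I : Type*} [TopologicalSpace I] {g h : I → ℂ → ℂ} (hg : PolyC g) (hh : PolyC h) :
    PolyC (fun r T => g r T * h r T) := by
  obtain ⟨P, hP⟩ := hg
  obtain ⟨Q, hQ⟩ := hh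
  exact ⟨P * Q, fun r T => by simp [hP, hQ]⟩

theorem PolyC.cst {I : Type*} [TopologicalSpace I] (c : ℂ) : PolyC (fun (_ : I) _ => c) :=
  PolyC.const (ContinuousMap.const I c)

theorem PolyC.neg {I : Type*} [TopologicalSpace I] {g : I → ℂ → ℂ} (hg : PolyC g) :
    PolyC (fun r T => - g r T) := by
  simpa using (PolyC.cst (-1)).mul hg

theorem PolyC.pow {I : Type*} [TopologicalSpace I] {g : I → ℂ → ℂ} (hg : PolyC g) (n : ℕ) :
    PolyC (fun r T => g r T ^ n) := by
  obtain ⟨P, hP⟩ := hg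
  exact ⟨P ^ n, fun r T => by simp [hP]⟩

theorem PolyC.poly {I : Type*} [TopologicalSpace I] (q : Polynomial ℂ) :
    PolyC (fun (_ : I) T => q.eval T) := by
  refine ⟨q.map (algebraMap ℂ C(I, ℂ)), fun r T => ?_⟩
  simp only [ev, Polynomial.coe_mapRingHom, Polynomial.map_map]
  congr 1
  convert Polynomial.map_id
  ext; simp

theorem PolyC.prod {I ι : Type*} [TopologicalSpace I] (s : Finset ι) {g : ι → I → ℂ → ℂ}
    (hg : ∀ i ∈ s, PolyC (g i)) : PolyC (fun r T => ∏ i ∈ s, g i r T) := by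
  classical
  induction s using Finset.induction_on with
  | empty => simpa using PolyC.cst 1
  | insert i s hi ih =>
    simp only [Finset.prod_insert hi]
    exact (hg i (by simp)).mul (ih (fun j hj => hg j (by simp [hj])))

theorem PolyC.sum {I ι : Type*} [TopologicalSpace I] (s : Finset ι) {g : ι → I → ℂ → ℂ}
    (hg : ∀ i ∈ s, PolyC (g i)) : PolyC (fun r T => ∑ i ∈ s, g i r T) := by
  classical
  induction s using Finset.induction_on with
  | empty => simpa using PolyC.cst 0
  | insert i s hi ih =>
    simp only [Finset.sum_insert hi]
    exact (hg i (by simp)).add (ih (fun j hj => hg j (by simp [hj])))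

theorem PolyC.mv {I σ : Type*} [TopologicalSpace I] (c : MvPolynomial σ ℂ) {x : σ → I → ℂ → ℂ}
    (hx : ∀ l, PolyC (x l)) : PolyC (fun r T => MvPolynomial.eval (fun l => x l r T) c) := by
  induction c using MvPolynomial.induction_on with
  | C a => simpa using PolyC.cst a
  | add p q hp hq => simpa using hp.add hq
  | mul_X p n hp => simpa using hp.mul (hx n)

theorem PolyC.at {I : Type*} [TopologicalSpace I] {g : I → ℂ → ℂ} (hg : PolyC g) (r : I) :
    ∃ P : Polynomial ℂ, ∀ T, P.eval T = g r T := by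
  obtain ⟨P, hP⟩ := hg
  exact ⟨ev r P, hP r⟩

theorem poly_eq_of_disc {P Q : Polynomial ℂ} (h : ∀ T : ℂ, ‖T‖ < 1 → P.eval T = Q.eval T) :
    P = Q := by
  apply Polynomial.eq_of_infinite_eval_eq
  have : (Metric.ball (0 : ℂ) 1).Infinite :=
    infinite_of_mem_nhds 0 (Metric.ball_mem_nhds _ one_pos)
  refine this.mono ?_
  intro T hT
  exact h T (by simpa using hT)

theorem dvd_of_reg {D N G : Polynomial ℂ} (hD0 : D ≠ 0) {g : ℂ → ℂ}
    (h : ∀ T : ℂ, ‖T‖ < 1 → G.eval T * D.eval T * g T = N.eval T)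
    (hreg : ∀ T1, D.eval T1 = 0 → Reg T1 g) : D ∣ N := by
  classical
  obtain ⟨D', hD'⟩ := EuclideanDomain.gcd_dvd_left D N
  obtain ⟨N', hN'⟩ := EuclideanDomain.gcd_dvd_right D N
  set e := EuclideanDomain.gcd D N with he
  have he0 : e ≠ 0 := by
    rintro h0; rw [h0, zero_mul] at hD'; exact hD0 hD'
  have hcop : IsCoprime D' N' := by
    obtain ⟨x, y, hxy⟩ : ∃ x y, e = D * x + N * y := ⟨_, _, EuclideanDomain.gcd_eq_gcd_ab D N⟩
    refine ⟨x, y, ?_⟩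
    apply mul_left_cancel₀ he0
    rw [mul_one]
    conv_rhs => rw [hxy, hD', hN']
    ring
  have hunit : IsUnit D' := by
    by_contra hnu
    have hdeg : D'.degree ≠ 0 := by
      intro hd
      exact hnu (Polynomial.isUnit_iff_degree_eq_zero.mpr hd)
    obtain ⟨T1, hT1⟩ := IsAlgClosed.exists_root D' hdeg
    have hroot : D.eval T1 = 0 := by
      rw [hD', Polynomial.eval_mul, hT1.eq_zero, mul_zero]
    obtain ⟨P, Q, hQ, hPQ⟩ := hreg T1 hroot
    have e1 : Q * N = G * D * P := by
      apply poly_eq_of_disc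
      intro T hT
      simp only [Polynomial.eval_mul, ← h T hT, ← hPQ T hT]
      ring
    have e2 : D' ∣ Q * N' := by
      refine ⟨G * P, ?_⟩
      apply mul_left_cancel₀ he0
      calc e * (Q * N') = Q * N := by rw [hN']; ring
        _ = G * D * P := e1
        _ = e * (D' * (G * P)) := by rw [hD']; ring
    obtain ⟨q, hq⟩ := hcop.dvd_of_dvd_mul_right e2
    apply hQ
    rw [hq, Polynomial.eval_mul, hT1.eq_zero, zero_mul]
  have : D ∣ e := by
    obtain ⟨y, hy⟩ := hunit.exists_right_inv
    exact ⟨y, by conv_rhs => rw [hD', mul_assoc, hy, mul_one]⟩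
  exact this.trans ⟨N', hN'⟩

theorem deform {I : Type*} [TopologicalSpace I] {r1 : I} {good : Set I} (hgood : r1 ∈ closure good)
    {D : Polynomial C(I, ℂ)} (hD : D.Monic) {G N : I → ℂ → ℂ} (hG : PolyC G) (hN : PolyC N)
    {g : I → ℂ → ℂ}
    (h : ∀ r T, ‖T‖ < 1 → G r T * (ev r D).eval T * g r T = N r T)
    (hreg : ∀ r ∈ good, ∀ T1, (ev r D).eval T1 = 0 → Reg T1 (g r))
    {T0 : ℂ} (hG0 : G r1 T0 ≠ 0) (hD1 : ∀ T : ℂ, ‖T‖ < 1 → (ev r1 D).eval T ≠ 0) :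
    Reg T0 (g r1) := by
  obtain ⟨G, hG⟩ := hG
  obtain ⟨N, hN⟩ := hN
  have hmon : ∀ r, (ev r D).Monic := fun r => hD.map _
  have hmod : ∀ r, ev r (N %ₘ D) = ev r N %ₘ ev r D := fun r => Polynomial.map_modByMonic _ hD
  have hz : ∀ r ∈ good, ev r (N %ₘ D) = 0 := by
    intro r hr
    rw [hmod, Polynomial.modByMonic_eq_zero_iff_dvd (hmon r)]
    apply dvd_of_reg (hmon r).ne_zero (G := ev r G) _ (hreg r hr)
    intro T hT
    rw [hG, hN, h r T hT]
  have hz1 : ev r1 (N %ₘ D) = 0 := by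
    ext n
    have hc : IsClosed {r : I | (N %ₘ D).coeff n r = 0} :=
      isClosed_eq ((N %ₘ D).coeff n).continuous continuous_const
    have hsub : good ⊆ {r : I | (N %ₘ D).coeff n r = 0} := by
      intro r hr
      have := congrArg (fun P => Polynomial.coeff P n) (hz r hr)
      simpa [ev] using this
    have := hc.closure_subset_iff.mpr hsub hgood
    simpa [ev] using this
  rw [hmod, Polynomial.modByMonic_eq_zero_iff_dvd (hmon r1)] at hz1
  obtain ⟨q, hq⟩ := hz1
  refine ⟨q, ev r1 G, by rw [hG]; exact hG0, fun T hT => ?_⟩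
  have h1 := h r1 T hT
  rw [← hN, hq, Polynomial.eval_mul, ← hG] at h1
  apply mul_left_cancel₀ (hD1 T hT)
  rw [← h1]; ring

end PartF

section PartG

/-- deformed weight -/
noncomputable def wr (A : Finset Vec) (p : ℕ) (α : Vec) (r T : ℂ) (k : Vec) : ℂ :=
  ((p : ℂ)⁻¹) ^ sg k * T ^ mm A k * r ^ dp k α

noncomputable def xr (p : ℕ) (α : Vec) (a : Vec) (r T : ℂ) : Fin 3 → ℂ :=
  fun l => (p : ℂ)⁻¹ * T ^ a l * r ^ α l

theorem mon_xr (p : ℕ) (α a : Vec) (r T : ℂ) (k : Vec) :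
    mon (xr p α a r T) k = ((p : ℂ)⁻¹) ^ sg k * T ^ dp k a * r ^ dp k α := by
  simp only [mon, xr, Fin.prod_univ_three, sg, dp, mul_pow, ← pow_mul, pow_add]
  simp only [mul_comm (a _), mul_comm (α _)]
  ring

theorem wr_eq {A : Finset Vec} {p : ℕ} {α a : Vec} {r T : ℂ} {k : Vec} (h : a ∈ SS A k) :
    wr A p α r T k = mon (xr p α a r T) k := by
  rw [mon_xr, wr, mm_eq h]

theorem wr_one {A : Finset Vec} {p : ℕ} {α : Vec} {T : ℂ} {k : Vec} :
    wr A p α 1 T k = wt A p T k := by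
  simp [wr, wt]

theorem pinv_lt {p : ℕ} (hp : 2 ≤ p) : ‖(p : ℂ)⁻¹‖ < 1 := by
  rw [norm_inv, Complex.norm_natCast]
  apply inv_lt_one_of_one_lt₀
  exact_mod_cast hp

theorem xr_lt {p : ℕ} (hp : 2 ≤ p) {α a : Vec} {r T : ℂ} (hr : ‖r‖ ≤ 1) (hT : ‖T‖ < 1) (l : Fin 3) :
    ‖xr p α a r T l‖ < 1 := by
  rw [xr, norm_mul, norm_mul, norm_pow, norm_pow]
  have h1 : ‖T‖ ^ a l ≤ 1 := pow_le_one₀ (norm_nonneg _) hT.le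
  have h2 : ‖r‖ ^ α l ≤ 1 := pow_le_one₀ (norm_nonneg _) hr
  have h3 := pinv_lt hp
  calc ‖(p : ℂ)⁻¹‖ * ‖T‖ ^ a l * ‖r‖ ^ α l ≤ ‖(p : ℂ)⁻¹‖ * 1 * 1 := by gcongr
    _ < 1 := by simpa using h3

theorem summable_wr {A : Finset Vec} {p : ℕ} (hp : 2 ≤ p) {α : Vec} {r T : ℂ} (hr : ‖r‖ ≤ 1)
    (hT : ‖T‖ < 1) {φ : Vec → ℂ} {B : ℝ} (hφ : ∀ k, ‖φ k‖ ≤ B) :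
    Summable (fun k => φ k * wr A p α r T k) := by
  have h := (hasSum_mon 3 (fun _ => (p : ℂ)⁻¹) (fun _ => pinv_lt hp)).1
  apply Summable.of_norm_bounded (h.mul_left B)
  intro k
  have e : mon (fun _ => (p : ℂ)⁻¹) k = ((p : ℂ)⁻¹) ^ sg k := by
    simp [mon, Fin.prod_univ_three, sg, pow_add]
    try ring
  rw [norm_mul]
  have hB : 0 ≤ B := (norm_nonneg _).trans (hφ k)
  apply mul_le_mul (hφ k) _ (norm_nonneg _) hB
  rw [e, wr, norm_mul, norm_mul]
  have h1 : ‖T ^ mm A k‖ ≤ 1 := by rw [norm_pow]; exact pow_le_one₀ (norm_nonneg _) hT.le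
  have h2 : ‖r ^ dp k α‖ ≤ 1 := by rw [norm_pow]; exact pow_le_one₀ (norm_nonneg _) hr
  calc _ ≤ ‖((p : ℂ)⁻¹) ^ sg k‖ * 1 * 1 := by gcongr
    _ = _ := by ring

theorem bdd_SS (A : Finset Vec) (φ : Finset Vec → ℂ) (k : Vec) :
    ‖φ (SS A k)‖ ≤ ∑ S ∈ A.powerset, ‖φ S‖ :=
  Finset.single_le_sum (f := fun S => ‖φ S‖) (fun _ _ => norm_nonneg _)
    (Finset.mem_powerset.mpr (fun _ h => SS_sub h))

/-- sign patterns -/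
noncomputable def pat (Cf : Finset ((Fin 3 → ℤ) × ℤ)) (k : Vec) : Finset ((Fin 3 → ℤ) × ℤ) :=
  Cf.filter (fun c => c.2 ≤ zdp c.1 k)

theorem pat_gf (Cf P : Finset ((Fin 3 → ℤ) × ℤ)) (hP : P ⊆ Cf) :
    ∃ W : Finset Vec, (∀ w ∈ W, w ≠ 0 ∧ (∀ c ∈ P, 0 ≤ zdp c.1 w) ∧
        ∀ c ∈ Cf, c ∉ P → zdp c.1 w ≤ 0) ∧
      ∃ q : MvPolynomial (Fin 3) ℂ, ∀ x : Fin 3 → ℂ, (∀ l, ‖x l‖ < 1) →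
        (∏ w ∈ W, (1 - mon x w)) * (∑' k, {k | pat Cf k = P}.indicator (mon x) k)
          = MvPolynomial.eval x q := by
  classical
  have hneg : ∀ (c : Fin 3 → ℤ) (k : Vec), zdp (-c) k = - zdp c k := by
    intro c k; rw [zdp_eq, zdp_eq]; simp [zz]; ring
  obtain ⟨W, h1, q, h2⟩ := gf_poly (P ∪ (Cf \ P).image (fun c => (-c.1, 1 - c.2)))
  have hset : {k | ∀ c ∈ P ∪ (Cf \ P).image (fun c => (-c.1, 1 - c.2)), c.2 ≤ zdp c.1 k}
      = {k | pat Cf k = P} := by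
    ext k
    simp only [Set.mem_ofPred_eq]
    constructor
    · intro h
      ext c
      rw [pat, Finset.mem_filter]
      constructor
      · rintro ⟨h3, h4⟩
        by_contra h5
        have := h (-c.1, 1 - c.2) (Finset.mem_union_right _ (Finset.mem_image.mpr
          ⟨c, Finset.mem_sdiff.mpr ⟨h3, h5⟩, rfl⟩))
        simp only [hneg] at this
        omega
      · intro hc
        exact ⟨hP hc, h c (Finset.mem_union_left _ hc)⟩
    · rintro rfl c hc
      rw [Finset.mem_union, Finset.mem_image] at hc
      rcases hc with hc | ⟨c', hc', rfl⟩
      · exact (Finset.mem_filter.mp hc).2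
      · rw [Finset.mem_sdiff, pat, Finset.mem_filter] at hc'
        simp only [hneg]
        by_contra hh
        exact hc'.2 ⟨hc'.1, by omega⟩
  refine ⟨W, fun w hw => ⟨(h1 w hw).1, fun c hc => (h1 w hw).2 c (Finset.mem_union_left _ hc),
    fun c hc hcP => ?_⟩, q, ?_⟩
  · have := (h1 w hw).2 (-c.1, 1 - c.2) (Finset.mem_union_right _ (Finset.mem_image.mpr
          ⟨c, Finset.mem_sdiff.mpr ⟨hc, hcP⟩, rfl⟩))
    simp only [hneg] at this
    omega
  · rw [hset] at h2; exact h2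

end PartG

section PartH

theorem polyC_xr {I : Type*} [TopologicalSpace I] (p : ℕ) (α a : Vec) (ρ : C(I, ℂ)) (l : Fin 3) :
    PolyC (fun r T => xr p α a (ρ r) T l) := by
  unfold xr
  exact ((PolyC.cst _).mul (PolyC.X.pow _)).mul ((PolyC.const ρ).pow _)

theorem polyC_mon {I : Type*} [TopologicalSpace I] (p : ℕ) (α a : Vec) (ρ : C(I, ℂ)) (w : Vec) :
    PolyC (fun r T => mon (xr p α a (ρ r) T) w) := by
  unfold mon
  exact PolyC.prod _ (fun l _ => (polyC_xr p α a ρ l).pow _)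

theorem polyC_one_sub_mon {I : Type*} [TopologicalSpace I] (p : ℕ) (α a : Vec) (ρ : C(I, ℂ))
    (w : Vec) : PolyC (fun r T => 1 - mon (xr p α a (ρ r) T) w) := by
  simpa [sub_eq_add_neg] using (PolyC.cst 1).add (polyC_mon p α a ρ w).neg

/-- regularity of a set sum from its generating function -/
theorem reg_of_gf {p : ℕ} (hp : 2 ≤ p) {W : Finset Vec} {M : Set Vec} {q : MvPolynomial (Fin 3) ℂ}
    (hq : ∀ x : Fin 3 → ℂ, (∀ l, ‖x l‖ < 1) →
        (∏ w ∈ W, (1 - mon x w)) * (∑' k, M.indicator (mon x) k) = MvPolynomial.eval x q)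
    (α a : Vec) {r : ℂ} (hr : ‖r‖ ≤ 1) (κ : Polynomial ℂ) {T1 : ℂ}
    (hT1 : ∀ w ∈ W, mon (xr p α a r T1) w ≠ 1) :
    Reg T1 (fun T => κ.eval T * ∑' k, M.indicator (mon (xr p α a r T)) k) := by
  obtain ⟨P, hP⟩ := ((PolyC.poly κ).mul (PolyC.mv q (fun l => polyC_xr (I := Unit) p α a
    (ContinuousMap.const _ r) l))).at ()
  obtain ⟨Q, hQ⟩ := (PolyC.prod W (fun w _ => polyC_one_sub_mon (I := Unit) p α a
    (ContinuousMap.const _ r) w)).at ()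
  simp only [ContinuousMap.const_apply] at hP hQ
  refine ⟨P, Q, ?_, fun T hT => ?_⟩
  · rw [hQ, Finset.prod_ne_zero_iff]
    intro w hw h
    exact hT1 w hw (sub_eq_zero.mp h).symm
  · rw [hQ, hP, ← hq _ (xr_lt hp hr hT)]
    ring

theorem reg_pattern {A : Finset Vec} (hA : A.Nonempty) {p : ℕ} (hp : 2 ≤ p)
    (Cf : Finset ((Fin 3 → ℤ) × ℤ))
    (hCf : ∀ ω ∈ A, ∀ ω' ∈ A, (zv ω' - zv ω, (0 : ℤ)) ∈ Cf)
    (κ : Vec → Polynomial ℂ) (hκ : ∀ k k', pat Cf k = pat Cf k' → κ k = κ k') :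
    ∃ H : Finset Vec, (∀ h ∈ H, h ≠ 0 ∧ ∃ k0, κ k0 ≠ 0 ∧ (∀ c ∈ pat Cf k0, 0 ≤ zdp c.1 h) ∧
        ∀ c ∈ Cf, c ∉ pat Cf k0 → zdp c.1 h ≤ 0) ∧
      ∀ (α : Vec) (r T1 : ℂ), ‖r‖ ≤ 1 → (∀ h ∈ H, wr A p α r T1 h ≠ 1) →
        Reg T1 (fun T => ∑' k, (κ k).eval T * wr A p α r T k) := by
  classical
  have hSS : ∀ k k' a, (∀ c ∈ pat Cf k, 0 ≤ zdp c.1 k') → a ∈ SS A k → a ∈ SS A k' := by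
    intro k k' a h ha
    rw [mem_SS] at ha ⊢
    refine ⟨ha.1, fun ω' hω' => ?_⟩
    have h1 := hCf a ha.1 ω' hω'
    have h2 := h _ (Finset.mem_filter.mpr ⟨h1, by
      simp only [zdp_eq, zz_diff]; have := ha.2 ω' hω'; omega⟩)
    simp only [zdp_eq, zz_diff] at h2
    omega
  have hSSp : ∀ k k' a, pat Cf k = pat Cf k' → a ∈ SS A k → a ∈ SS A k' := by
    intro k k' a h ha
    rw [mem_SS] at ha ⊢
    refine ⟨ha.1, fun ω' hω' => ?_⟩
    have h1 := hCf a ha.1 ω' hω'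
    have h2 : (zv ω' - zv a, (0 : ℤ)) ∈ pat Cf k := (Finset.mem_filter.mpr ⟨h1, by
      simp only [zdp_eq, zz_diff]; have := ha.2 ω' hω'; omega⟩)
    rw [h, pat, Finset.mem_filter] at h2
    simp only [zdp_eq, zz_diff] at h2
    omega
  have hW : ∀ P, P ⊆ Cf → ∃ W : Finset Vec, (∀ w ∈ W, w ≠ 0 ∧ (∀ c ∈ P, 0 ≤ zdp c.1 w) ∧
        ∀ c ∈ Cf, c ∉ P → zdp c.1 w ≤ 0) ∧
      ∃ q : MvPolynomial (Fin 3) ℂ, ∀ x : Fin 3 → ℂ, (∀ l, ‖x l‖ < 1) →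
        (∏ w ∈ W, (1 - mon x w)) * (∑' k, {k | pat Cf k = P}.indicator (mon x) k)
          = MvPolynomial.eval x q := pat_gf Cf
  choose! W hW1 hW2 using hW
  choose! q hq using hW2
  have hpatsub : ∀ k, pat Cf k ⊆ Cf := fun k => Finset.filter_subset _ _
  let Pn := Cf.powerset.filter (fun P => ∃ k0, pat Cf k0 = P ∧ κ k0 ≠ 0)
  have hPn : ∀ P ∈ Pn, P ⊆ Cf ∧ ∃ k0, pat Cf k0 = P ∧ κ k0 ≠ 0 := by
    intro P hP
    simpa [Pn] using hP
  refine ⟨Pn.biUnion W, ?_, ?_⟩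
  · intro h hh
    rw [Finset.mem_biUnion] at hh
    obtain ⟨P, hP, hh⟩ := hh
    obtain ⟨h1, k0, rfl, h3⟩ := hPn P hP
    have := hW1 _ h1 h hh
    exact ⟨this.1, k0, h3, this.2.1, this.2.2⟩
  · intro α r T1 hr hT1
    have hreg : ∀ P ∈ Pn, Reg T1 (fun T => ∑' k, {k | pat Cf k = P}.indicator
        (fun k => (κ k).eval T * wr A p α r T k) k) := by
      intro P hP
      obtain ⟨h1, k0, rfl, h3⟩ := hPn P hP
      obtain ⟨a, ha⟩ := SS_nonempty hA k0
      refine (reg_of_gf hp (hq _ h1) α a hr (κ k0) (T1 := T1) ?_).congr ?_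
      · intro w hw
        rw [← wr_eq (A := A) (hSS k0 w a (hW1 _ h1 w hw).2.1 ha)]
        exact hT1 w (Finset.mem_biUnion.mpr ⟨_, hP, hw⟩)
      · intro T hT
        rw [← tsum_mul_left]
        apply tsum_congr
        intro k
        by_cases hk : pat Cf k = pat Cf k0
        · rw [Set.indicator_of_mem (by exact hk), Set.indicator_of_mem (by exact hk), hκ k k0 hk,
            wr_eq (hSSp k0 k a hk.symm ha)]
        · rw [Set.indicator_of_notMem (by exact hk), Set.indicator_of_notMem (by exact hk), mul_zero]
    refine (Reg.sum Pn hreg).congr ?_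
    intro T hT
    -- boundedness
    obtain ⟨B, hB⟩ : ∃ B : ℝ, ∀ k, ‖(κ k).eval T‖ ≤ B := by
      have hfin : (Set.range (fun k => ‖(κ k).eval T‖)).Finite := by
        have : Set.range (fun k => ‖(κ k).eval T‖) ⊆
            ⋃ P ∈ (Cf.powerset : Set _), (fun k => ‖(κ k).eval T‖) '' {k | pat Cf k = P} := by
          rintro _ ⟨k, rfl⟩
          rw [Set.mem_iUnion₂]
          exact ⟨pat Cf k, by simpa using hpatsub k, k, rfl, rfl⟩
        refine Set.Finite.subset (Set.Finite.biUnion (Cf.powerset.finite_toSet) ?_) this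
        intro P _
        apply Set.Subsingleton.finite
        rintro _ ⟨k, hk, rfl⟩ _ ⟨k', hk', rfl⟩
        simp only
        rw [hκ k k' (hk.trans hk'.symm)]
      obtain ⟨B, hB⟩ := hfin.bddAbove
      exact ⟨B, fun k => hB ⟨k, rfl⟩⟩
    have hsum := summable_wr (A := A) hp (α := α) hr hT hB
    rw [← Summable.tsum_finsetSum (fun P _ => hsum.indicator _)]
    apply tsum_congr
    intro k
    by_cases hk : κ k = 0
    · rw [hk]
      simp only [Polynomial.eval_zero, zero_mul]
      symm
      apply Finset.sum_eq_zero
      intro P _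
      by_cases h : pat Cf k = P
      · rw [Set.indicator_of_mem (by exact h), hk]; simp
      · rw [Set.indicator_of_notMem (by exact h)]
    · rw [Finset.sum_eq_single (pat Cf k)]
      · rw [Set.indicator_of_mem (by rfl)]
      · intro P _ h
        rw [Set.indicator_of_notMem (by exact h.symm)]
      · intro h
        exact (h (by simp only [Pn, Finset.mem_filter, Finset.mem_powerset]
                     exact ⟨hpatsub k, k, rfl, hk⟩)).elim

end PartH

section PartI

def InR (A : Finset Vec) (i : Fin 3) (C : Vec) (k : Vec) : Prop :=
  VPos k ∧ ∀ D ∈ A, 1 ≤ D i → ¬ C ≤ D → dp k C < dp k D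

theorem InR.step {A : Finset Vec} {i : Fin 3} {C k : Vec} (hC : C i = 1) (h : InR A i C k) :
    InR A i C (k + Pi.single i 1) := by
  refine ⟨h.1.add, fun D hD h1 h2 => ?_⟩
  have := h.2 D hD h1 h2
  rw [dp_add, dp_add, dp_single, dp_single, hC]
  omega

theorem InR.eq {A : Finset Vec} {i : Fin 3} {C k : Vec} (hCA : C ∈ A) (h : InR A i C k)
    {D : Vec} (hD : D ∈ SS A k) (h1 : 1 ≤ D i) : D = C := by
  rw [mem_SS] at hD
  have h2 : C ≤ D := by
    by_contra h2
    have := h.2 D hD.1 h1 h2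
    have := hD.2 C hCA
    omega
  have h3 := dp_mono (u := k) h2
  have h4 := hD.2 C hCA
  ext j
  exact (eq_of_le_of_dp_eq h2 (le_antisymm h3 h4) (h.1 j)).symm

/-- the primitive coefficient -/
noncomputable def jc (p : ℕ) (C : Vec) (ℓ : Finset Vec → Polynomial ℂ) (S : Finset Vec) : Polynomial ℂ :=
  open Classical in
  if C ∈ S then Polynomial.C (((p : ℂ)⁻¹) ^ 2 * ((p : ℂ) - 1) ^ 3)
  else Polynomial.C ((p : ℂ) * ((p : ℂ) - 1)⁻¹) * ℓ S

theorem sg_add_single (k : Vec) (i : Fin 3) : sg (k + Pi.single i 1) = sg k + 1 := by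
  fin_cases i <;> simp [sg] <;> ring

theorem dp_add_single_alpha (k α : Vec) {i : Fin 3} (h : α i = 0) :
    dp (k + Pi.single i 1) α = dp k α := by
  rw [dp_add, dp_single, h, add_zero]

theorem column_step {A : Finset Vec} {p : ℕ} (hp : 2 ≤ p) {i : Fin 3} {C : Vec}
    (hCA : C ∈ A) (hC : C i = 1) {ℓ : Finset Vec → Polynomial ℂ}
    (hℓ1 : ∀ k, VPos k → SS A k = {C} → ∀ T, (ℓ {C}).eval T =
      ((p : ℂ)⁻¹) ^ 2 * ((p : ℂ) - 1) ^ 3 * (1 - (p : ℂ)⁻¹ * T))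
    (hℓ2 : ∀ k, VPos k → C ∈ SS A k → (∀ ω ∈ SS A k, ω ≠ C → ω i = 0) → SS A k ≠ {C} →
      ∀ T, (ℓ (SS A k)).eval T + ((p : ℂ) - 1)⁻¹ * (ℓ ((SS A k).erase C)).eval T =
        ((p : ℂ)⁻¹) ^ 2 * ((p : ℂ) - 1) ^ 3)
    {α : Vec} (hα : α i = 0) (r T : ℂ) {k : Vec} (hk : InR A i C k) :
    (ℓ (SS A k)).eval T * wr A p α r T k = (jc p C ℓ (SS A k)).eval T * wr A p α r T k
      - (jc p C ℓ (SS A (k + Pi.single i 1))).eval T * wr A p α r T (k + Pi.single i 1) := by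
  classical
  have hp0 : (p : ℂ) ≠ 0 := by
    have : p ≠ 0 := by omega
    exact_mod_cast this
  have hp1 : (p : ℂ) - 1 ≠ 0 := by
    intro h
    have h' : (p : ℂ) = 1 := by linear_combination h
    have : p = 1 := by exact_mod_cast h'
    omega
  have hz : ∀ ω ∈ SS A k, ω ≠ C → ω i = 0 := by
    intro ω hω hne
    by_contra h
    exact hne (hk.eq hCA hω (by omega))
  set k' := k + Pi.single i 1 with hk'
  have hdp : ∀ ω, dp k' ω = dp k ω + ω i := fun ω => by rw [hk', dp_add, dp_single]
  by_cases hCS : C ∈ SS A k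
  · by_cases hS : SS A k = {C}
    · have hlow : ∀ D ∈ A, dp k' C ≤ dp k' D := by
        intro D hD
        rw [hdp, hdp, hC]
        have h1 := (mem_SS.mp hCS).2 D hD
        by_cases h0 : D i = 0
        · have : dp k D ≠ dp k C := by
            intro h
            rw [← mem_SS_iff_eq hCS hD, hS, Finset.mem_singleton] at h
            rw [h] at h0; omega
          omega
        · omega
      have hC' : C ∈ SS A k' := mem_SS.mpr ⟨hCA, hlow⟩
      rw [jc, jc, if_pos hCS, if_pos hC', Polynomial.eval_C, hS, hℓ1 k hk.1 hS, wr, wr, mm_eq hCS,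
        mm_eq hC', hdp, hC, hk', sg_add_single, dp_add_single_alpha k α hα]
      ring
    · have hE : SS A k' = (SS A k).erase C := by
        obtain ⟨B, hB, hBC⟩ : ∃ B ∈ SS A k, B ≠ C := by
          by_contra h
          push Not at h
          apply hS
          ext ω
          rw [Finset.mem_singleton]
          exact ⟨h ω, fun h => h ▸ hCS⟩
        have hB0 := hz B hB hBC
        have hB' : B ∈ SS A k' := by
          rw [mem_SS] at hB ⊢
          refine ⟨hB.1, fun D hD => ?_⟩
          have := hB.2 D hD
          rw [hdp, hdp]; omega
        ext ω
        rw [Finset.mem_erase]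
        constructor
        · intro h
          have h1 := (mem_SS_iff_eq hB' (SS_sub h)).mp h
          rw [hdp, hdp, hB0] at h1
          have h2 := (mem_SS.mp hB).2 ω (SS_sub h)
          refine ⟨?_, (mem_SS_iff_eq hB (SS_sub h)).mpr (by omega)⟩
          rintro rfl
          omega
        · rintro ⟨h1, h2⟩
          have := hz ω h2 h1
          rw [mem_SS_iff_eq hB' (SS_sub h2), hdp, hdp, hB0, this,
            (mem_SS_iff_eq hB (SS_sub h2)).mp h2]
      have hmm : mm A k' = mm A k := by
        obtain ⟨B, hB⟩ := SS_nonempty ⟨C, hCA⟩ k'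
        have hB2 : B ∈ SS A k := Finset.mem_of_mem_erase (hE ▸ hB)
        have hB3 : B ≠ C := Finset.ne_of_mem_erase (hE ▸ hB)
        rw [mm_eq hB, mm_eq hB2, hdp, hz B hB2 hB3, add_zero]
      have e := hℓ2 k hk.1 hCS hz hS T
      have hC' : C ∉ SS A k' := by rw [hE]; simp
      rw [jc, jc, if_pos hCS, if_neg hC', hE, Polynomial.eval_C, Polynomial.eval_mul,
        Polynomial.eval_C, wr, wr, hmm, hk', sg_add_single, dp_add_single_alpha k α hα, ← e, pow_succ]
      field_simp
      ring
  · have hE : SS A k' = SS A k := by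
      obtain ⟨B, hB⟩ := SS_nonempty ⟨C, hCA⟩ k
      have hz' : ∀ ω ∈ SS A k, ω i = 0 := by
        intro ω h
        exact hz ω h (by rintro rfl; exact hCS h)
      have hB0 := hz' B hB
      have hB' : B ∈ SS A k' := by
        rw [mem_SS] at hB ⊢
        refine ⟨hB.1, fun D hD => ?_⟩
        have := hB.2 D hD
        rw [hdp, hdp]; omega
      ext ω
      constructor
      · intro h
        have h1 := (mem_SS_iff_eq hB' (SS_sub h)).mp h
        rw [hdp, hdp, hB0] at h1
        have h2 := (mem_SS.mp hB).2 ω (SS_sub h)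
        exact (mem_SS_iff_eq hB (SS_sub h)).mpr (by omega)
      · intro h2
        have := hz' ω h2
        rw [mem_SS_iff_eq hB' (SS_sub h2), hdp, hdp, hB0, this,
          (mem_SS_iff_eq hB (SS_sub h2)).mp h2]
    have hmm : mm A k' = mm A k := by
      obtain ⟨B, hB⟩ := SS_nonempty ⟨C, hCA⟩ k'
      have hB2 : B ∈ SS A k := hE ▸ hB
      rw [mm_eq hB, mm_eq hB2, hdp, hz B hB2 (by rintro rfl; exact hCS hB2), add_zero]
    have hC' : C ∉ SS A k' := by rw [hE]; exact hCS
    rw [jc, jc, if_neg hCS, if_neg hC', hE, Polynomial.eval_mul,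
        Polynomial.eval_C, wr, wr, hmm, hk', sg_add_single, dp_add_single_alpha k α hα, pow_succ]
    field_simp

/-- coefficient after telescoping -/
noncomputable def kap (A : Finset Vec) (p : ℕ) (i : Fin 3) (C : Vec) (ℓ : Finset Vec → Polynomial ℂ)
    (k : Vec) : Polynomial ℂ :=
  open Classical in
  if VPos k ∧ ¬ InR A i C k then ℓ (SS A k)
  else if InR A i C k ∧ ¬ ∃ k', InR A i C k' ∧ k = k' + Pi.single i 1 then jc p C ℓ (SS A k) else 0

theorem column_sum {A : Finset Vec} {p : ℕ} (hp : 2 ≤ p) {i : Fin 3} {C : Vec}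
    (hCA : C ∈ A) (hC : C i = 1) {ℓ : Finset Vec → Polynomial ℂ}
    (hℓ1 : ∀ k, VPos k → SS A k = {C} → ∀ T, (ℓ {C}).eval T =
      ((p : ℂ)⁻¹) ^ 2 * ((p : ℂ) - 1) ^ 3 * (1 - (p : ℂ)⁻¹ * T))
    (hℓ2 : ∀ k, VPos k → C ∈ SS A k → (∀ ω ∈ SS A k, ω ≠ C → ω i = 0) → SS A k ≠ {C} →
      ∀ T, (ℓ (SS A k)).eval T + ((p : ℂ) - 1)⁻¹ * (ℓ ((SS A k).erase C)).eval T =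
        ((p : ℂ)⁻¹) ^ 2 * ((p : ℂ) - 1) ^ 3)
    {α : Vec} (hα : α i = 0) {r T : ℂ} (hr : ‖r‖ ≤ 1) (hT : ‖T‖ < 1) :
    ∑' k, Set.indicator {k | VPos k} (fun k => (ℓ (SS A k)).eval T * wr A p α r T k) k
      = ∑' k, (kap A p i C ℓ k).eval T * wr A p α r T k := by
  classical
  set I : Vec → ℂ := fun k => (ℓ (SS A k)).eval T * wr A p α r T k with hI
  set J : Vec → ℂ := fun k => (jc p C ℓ (SS A k)).eval T * wr A p α r T k with hJ
  have sI : Summable I := summable_wr hp hr hT (bdd_SS A (fun S => (ℓ S).eval T))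
  have sJ : Summable J := summable_wr hp hr hT (bdd_SS A (fun S => (jc p C ℓ S).eval T))
  set R : Set Vec := {k | InR A i C k} with hR
  set R' : Set Vec := {k | ∃ k', InR A i C k' ∧ k = k' + Pi.single i 1} with hR'
  have hinj : Function.Injective (fun k : Vec => k + Pi.single i 1) := add_left_injective _
  have hstep : ∀ k ∈ R, k + Pi.single i 1 ∈ R := fun k hk => InR.step hC hk
  have hRR : R' ⊆ R := by rintro _ ⟨k', h, rfl⟩; exact hstep k' h
  have e1 : ∀ k, Set.indicator {k | VPos k} I k = Set.indicator ({k | VPos k} \ R) I k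
      + (R.indicator J k - R'.indicator J (k + Pi.single i 1)) := by
    intro k
    by_cases hk : k ∈ R
    · have h1 : k ∉ ({k | VPos k} \ R) := fun h => h.2 hk
      have h2 : k + Pi.single i 1 ∈ R' := ⟨k, hk, rfl⟩
      rw [Set.indicator_of_mem (by exact hk.1), Set.indicator_of_notMem h1, Set.indicator_of_mem hk,
        Set.indicator_of_mem h2, zero_add]
      exact column_step hp hCA hC hℓ1 hℓ2 hα r T hk
    · have h2 : k + Pi.single i 1 ∉ R' := by
        rintro ⟨k', h, h'⟩
        have : k = k' := hinj h'
        exact hk (this ▸ h)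
      rw [Set.indicator_of_notMem hk, Set.indicator_of_notMem h2, sub_zero, add_zero]
      by_cases hv : VPos k
      · rw [Set.indicator_of_mem (by exact hv), Set.indicator_of_mem (by exact ⟨hv, hk⟩)]
      · rw [Set.indicator_of_notMem (by exact hv), Set.indicator_of_notMem (by exact fun h => hv h.1)]
  have e2 : ∑' k : Vec, R'.indicator J (k + Pi.single i 1) = ∑' k, R'.indicator J k := by
    apply hinj.tsum_eq (f := R'.indicator J)
    intro k hk
    have : k ∈ R' := by
      by_contra h
      exact hk (Set.indicator_of_notMem h _)
    obtain ⟨k', -, rfl⟩ := this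
    exact ⟨k', rfl⟩
  have sJ' : Summable (fun k => R'.indicator J (k + Pi.single i 1)) :=
    (sJ.indicator R').comp_injective hinj
  rw [tsum_congr e1, (sI.indicator _).tsum_add ((sJ.indicator R).sub sJ'),
    (sJ.indicator R).tsum_sub sJ', e2, ← (sJ.indicator R).tsum_sub (sJ.indicator R'),
    ← (sI.indicator _).tsum_add ((sJ.indicator R).sub (sJ.indicator R'))]
  apply tsum_congr
  intro k
  rw [kap]
  by_cases hk : k ∈ R
  · have h1 : k ∉ ({k | VPos k} \ R) := fun h => h.2 hk
    rw [Set.indicator_of_notMem h1, Set.indicator_of_mem hk, if_neg (by exact fun h => h.2 hk), zero_add]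
    by_cases hk' : k ∈ R'
    · rw [Set.indicator_of_mem hk', if_neg (by exact fun h => h.2 hk')]
      simp
    · rw [Set.indicator_of_notMem hk', if_pos (by exact ⟨hk, hk'⟩), sub_zero]
  · have hk' : k ∉ R' := fun h => hk (hRR h)
    rw [Set.indicator_of_notMem hk, Set.indicator_of_notMem hk', sub_zero, add_zero]
    by_cases hv : VPos k
    · rw [Set.indicator_of_mem (by exact ⟨hv, hk⟩), if_pos (by exact ⟨hv, hk⟩)]
    · rw [Set.indicator_of_notMem (by exact fun h => hv h.1), if_neg (by exact fun h => hv h.1),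
        if_neg (by exact fun h => hk h.1)]
      simp

theorem shift_iff {A : Finset Vec} {i : Fin 3} {C : Vec} (hC : C i = 1) (k : Vec) :
    (∃ k', InR A i C k' ∧ k = k' + Pi.single i 1) ↔
      VPos k ∧ 2 ≤ k i ∧ ∀ D ∈ A, 1 ≤ D i → ¬ C ≤ D → dp k C + D i ≤ dp k D := by
  constructor
  · rintro ⟨k', ⟨h1, h2⟩, rfl⟩
    refine ⟨h1.add, ?_, fun D hD h3 h4 => ?_⟩
    · have := h1 i; simp only [Pi.add_apply, Pi.single_eq_same]; omega
    · have := h2 D hD h3 h4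
      simp only [dp_add, dp_single, hC]; omega
  · rintro ⟨h1, h2, h3⟩
    have hk : k = (k - Pi.single i 1) + Pi.single i 1 := by
      ext l
      by_cases h : l = i
      · subst h; simp only [Pi.add_apply, Pi.sub_apply, Pi.single_eq_same]; omega
      · simp [h]
    have hdp : ∀ ω, dp k ω = dp (k - Pi.single i 1) ω + ω i := by
      intro ω; conv_lhs => rw [hk, dp_add, dp_single]
    refine ⟨k - Pi.single i 1, ⟨?_, fun D hD h4 h5 => ?_⟩, hk⟩
    · intro l
      by_cases h : l = i
      · subst h; simp only [Pi.sub_apply, Pi.single_eq_same]; omega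
      · simpa [h] using h1 l
    · have h6 := h3 D hD h4 h5
      rw [hdp, hdp D, hC] at h6
      omega

theorem column {A : Finset Vec} {p : ℕ} (hp : 2 ≤ p) {i : Fin 3} {C : Vec}
    (hCA : C ∈ A) (hC : C i = 1) {ℓ : Finset Vec → Polynomial ℂ}
    (hℓ1 : ∀ k, VPos k → SS A k = {C} → ∀ T, (ℓ {C}).eval T =
      ((p : ℂ)⁻¹) ^ 2 * ((p : ℂ) - 1) ^ 3 * (1 - (p : ℂ)⁻¹ * T))
    (hℓ2 : ∀ k, VPos k → C ∈ SS A k → (∀ ω ∈ SS A k, ω ≠ C → ω i = 0) → SS A k ≠ {C} →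
      ∀ T, (ℓ (SS A k)).eval T + ((p : ℂ) - 1)⁻¹ * (ℓ ((SS A k).erase C)).eval T =
        ((p : ℂ)⁻¹) ^ 2 * ((p : ℂ) - 1) ^ 3) :
    ∃ H : Finset Vec, (∀ h ∈ H, h ≠ 0 ∧
        (h i = 0 ∨ ∃ D ∈ A, 1 ≤ D i ∧ ¬ C ≤ D ∧ dp h D ≤ dp h C)) ∧
      ∀ (α : Vec) (r T1 : ℂ), α i = 0 → ‖r‖ ≤ 1 → (∀ h ∈ H, wr A p α r T1 h ≠ 1) →
        Reg T1 (fun T => ∑' k, Set.indicator {k | VPos k}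
          (fun k => (ℓ (SS A k)).eval T * wr A p α r T k) k) := by
  classical
  let Cf : Finset ((Fin 3 → ℤ) × ℤ) :=
    (A ×ˢ A).image (fun z => (zv z.2 - zv z.1, (0 : ℤ))) ∪
    (Finset.univ.image (fun l : Fin 3 => ((Pi.single l 1 : Fin 3 → ℤ), (1 : ℤ)))) ∪
    {((Pi.single i 1 : Fin 3 → ℤ), (2 : ℤ))} ∪
    A.image (fun D => (zv D - zv C, (1 : ℤ))) ∪ A.image (fun D => (zv D - zv C, (D i : ℤ)))
  have c1 : ∀ ω ∈ A, ∀ ω' ∈ A, (zv ω' - zv ω, (0 : ℤ)) ∈ Cf := by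
    intro ω hω ω' hω'
    simp only [Cf, Finset.mem_union, Finset.mem_image, Finset.mem_product]
    exact Or.inl (Or.inl (Or.inl (Or.inl ⟨(ω, ω'), ⟨hω, hω'⟩, rfl⟩)))
  have c2 : ∀ l, ((Pi.single l 1 : Fin 3 → ℤ), (1 : ℤ)) ∈ Cf := by
    intro l
    simp only [Cf, Finset.mem_union, Finset.mem_image]
    exact Or.inl (Or.inl (Or.inl (Or.inr ⟨l, Finset.mem_univ _, rfl⟩)))
  have c3 : ((Pi.single i 1 : Fin 3 → ℤ), (2 : ℤ)) ∈ Cf := by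
    simp only [Cf, Finset.mem_union, Finset.mem_singleton]
    exact Or.inl (Or.inl (Or.inr trivial))
  have c4 : ∀ D ∈ A, (zv D - zv C, (1 : ℤ)) ∈ Cf := by
    intro D hD
    simp only [Cf, Finset.mem_union, Finset.mem_image]
    exact Or.inl (Or.inr ⟨D, hD, rfl⟩)
  have c5 : ∀ D ∈ A, (zv D - zv C, (D i : ℤ)) ∈ Cf := by
    intro D hD
    simp only [Cf, Finset.mem_union, Finset.mem_image]
    exact Or.inr ⟨D, hD, rfl⟩
  clear_value Cf
  have hmem : ∀ {k c}, c ∈ Cf → (c ∈ pat Cf k ↔ c.2 ≤ zdp c.1 k) := by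
    intro k c hc
    simp [pat, hc]
  have hpat : ∀ {k k'}, pat Cf k = pat Cf k' → ∀ c ∈ Cf, (c.2 ≤ zdp c.1 k ↔ c.2 ≤ zdp c.1 k') := by
    intro k k' h c hc
    rw [← hmem hc, ← hmem hc, h]
  have d2 : ∀ (k : Vec) l, (1 : ℤ) ≤ zdp (Pi.single l 1) k ↔ 0 < k l := by
    intro k l; rw [zdp_eq, zz_single, zv]; omega
  have d3 : ∀ (k : Vec), (2 : ℤ) ≤ zdp (Pi.single i 1) k ↔ 2 ≤ k i := by
    intro k; rw [zdp_eq, zz_single, zv]; omega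
  have d4 : ∀ (k D : Vec), (1 : ℤ) ≤ zdp (zv D - zv C) k ↔ dp k C < dp k D := by
    intro k D; rw [zdp_eq, zz_diff]; omega
  have d5 : ∀ (k D : Vec), (D i : ℤ) ≤ zdp (zv D - zv C) k ↔ dp k C + D i ≤ dp k D := by
    intro k D; rw [zdp_eq, zz_diff]; omega
  have d1 : ∀ (k ω ω' : Vec), (0 : ℤ) ≤ zdp (zv ω' - zv ω) k ↔ dp k ω ≤ dp k ω' := by
    intro k ω ω'; rw [zdp_eq, zz_diff]; omega
  have pV : ∀ {k k'}, pat Cf k = pat Cf k' → (VPos k ↔ VPos k') := by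
    intro k k' h
    apply forall_congr'
    intro l
    rw [← d2, ← d2]
    exact hpat h _ (c2 l)
  have pR : ∀ {k k'}, pat Cf k = pat Cf k' → (InR A i C k ↔ InR A i C k') := by
    intro k k' h
    refine and_congr (pV h) (forall₂_congr fun D hD => ?_)
    rw [← d4, ← d4, hpat h _ (c4 D hD)]
  have pS : ∀ {k k'}, pat Cf k = pat Cf k' → SS A k = SS A k' := by
    intro k k' h
    ext ω
    rw [mem_SS, mem_SS]
    refine and_congr_right fun hω => (forall₂_congr fun D hD => ?_)
    rw [← d1, ← d1]
    exact hpat h _ (c1 _ hω _ hD)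
  have pR' : ∀ {k k'}, pat Cf k = pat Cf k' → ((∃ q, InR A i C q ∧ k = q + Pi.single i 1) ↔
      (∃ q, InR A i C q ∧ k' = q + Pi.single i 1)) := by
    intro k k' h
    rw [shift_iff hC, shift_iff hC]
    refine and_congr (pV h) (and_congr ?_ (forall₂_congr fun D hD => ?_))
    · rw [← d3, ← d3]; exact hpat h _ c3
    · rw [← d5, ← d5, hpat h _ (c5 D hD)]
  obtain ⟨H, hH1, hH2⟩ := reg_pattern ⟨C, hCA⟩ hp Cf c1 (kap A p i C ℓ) (by
    intro k k' h
    unfold kap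
    simp only [pV h, pR h, pS h, pR' h])
  refine ⟨H, fun h hh => ?_, ?_⟩
  · obtain ⟨h0, k0, hk0, hp1, hp2⟩ := hH1 h hh
    refine ⟨h0, ?_⟩
    have key : ∀ D, zdp (zv D - zv C) h ≤ 0 → dp h D ≤ dp h C := by
      intro D hD; rw [zdp_eq, zz_diff] at hD; omega
    unfold kap at hk0
    split_ifs at hk0 with g1 g2
    · right
      have g3 := g1.2
      unfold InR at g3
      push Not at g3
      obtain ⟨D, hD, h1, h2, h3⟩ := g3 g1.1
      refine ⟨D, hD, h1, h2, key D (hp2 _ (c4 D hD) ?_)⟩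
      rw [hmem (c4 D hD), d4]; omega
    · have g3 := g2.2
      rw [shift_iff hC] at g3
      push Not at g3
      by_cases h2 : 2 ≤ k0 i
      · right
        obtain ⟨D, hD, h1, h2, h3⟩ := g3 g2.1.1 h2
        refine ⟨D, hD, h1, h2, key D (hp2 _ (c5 D hD) ?_)⟩
        rw [hmem (c5 D hD), d5]; omega
      · left
        have := hp2 _ c3 (by rw [hmem c3, d3]; exact h2)
        simp only [zdp_eq, zz_single, zv] at this
        omega
    · exact (hk0 rfl).elim
  · intro α r T1 hα hr hT1
    refine (hH2 α r T1 hr hT1).congr fun T hT => ?_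
    exact column_sum hp hCA hC hℓ1 hℓ2 hα hr hT

end PartI

section PartJ

theorem exists_alpha (i : Fin 3) (Ds : Finset (Fin 3 → ℤ)) :
    ∃ α : Vec, α i = 0 ∧ ∀ d ∈ Ds, zs d = 0 → d ≠ 0 → zz (zv α) d ≠ 0 := by
  obtain ⟨M, hM⟩ : ∃ M : ℕ, ∀ d ∈ Ds, ∀ l, |d l| < M := by
    refine ⟨∑ d ∈ Ds, ∑ l, (d l).natAbs + 1, fun d hd l => ?_⟩
    have h1 : (d l).natAbs ≤ ∑ l, (d l).natAbs :=
      Finset.single_le_sum (f := fun l => (d l).natAbs) (fun _ _ => Nat.zero_le _) (Finset.mem_univ l)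
    have h2 : ∑ l, (d l).natAbs ≤ ∑ d ∈ Ds, ∑ l, (d l).natAbs :=
      Finset.single_le_sum (f := fun d => ∑ l, (d l).natAbs) (fun _ _ => Nat.zero_le _) hd
    have h3 : |d l| = (d l).natAbs := Int.abs_eq_natAbs _
    have h4 := Nat.lt_succ_of_le (h1.trans h2)
    rw [h3]
    exact Int.ofNat_lt.mpr h4
  have key : ∀ x y : ℤ, |x| < M → x + M * y = 0 → x = 0 ∧ y = 0 := by
    intro x y hx h
    have hy : y = 0 := by
      by_contra hy
      have h1 : 1 ≤ |y| := Int.one_le_abs hy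
      have h2 : |x| = M * |y| := by
        have : x = -(M * y) := by linarith
        rw [this, abs_neg, abs_mul]; simp
      nlinarith [abs_nonneg x]
    subst hy; simp at h; exact ⟨h, rfl⟩
  fin_cases i
  · refine ⟨![0, 1, M], rfl, fun d hd h0 hne h => hne ?_⟩
    simp [zz, zv, zs] at h h0
    obtain ⟨h1, h2⟩ := key _ _ (hM d hd 1) h
    ext l; fin_cases l <;> simp <;> omega
  · refine ⟨![1, 0, M], rfl, fun d hd h0 hne h => hne ?_⟩
    simp [zz, zv, zs] at h h0
    obtain ⟨h1, h2⟩ := key _ _ (hM d hd 0) h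
    ext l; fin_cases l <;> simp <;> omega
  · refine ⟨![1, M, 0], rfl, fun d hd h0 hne h => hne ?_⟩
    simp [zz, zv, zs] at h h0
    obtain ⟨h1, h2⟩ := key _ _ (hM d hd 0) h
    ext l; fin_cases l <;> simp <;> omega

noncomputable def rho : C(ℝ, ℂ) := ⟨fun t => ((Real.exp (-|t|) : ℝ) : ℂ), by fun_prop⟩

theorem rho_apply (t : ℝ) : rho t = ((Real.exp (-|t|) : ℝ) : ℂ) := rfl

theorem rho_zero : rho 0 = 1 := by simp [rho_apply]

theorem rho_ne (t : ℝ) : rho t ≠ 0 := by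
  rw [rho_apply]; exact_mod_cast (Real.exp_pos _).ne'

theorem rho_le (t : ℝ) : ‖rho t‖ ≤ 1 := by
  rw [rho_apply, Complex.norm_real, Real.norm_of_nonneg (Real.exp_pos _).le, Real.exp_le_one_iff]
  simp

/-- difference vector -/
noncomputable def dvec (A : Finset Vec) (v h : Vec) : Fin 3 → ℤ := fun l => mm A v * h l - mm A h * v l

/-- generic parameters -/
def GoodT (A : Finset Vec) (p : ℕ) (α : Vec) (E : Finset (Vec × Vec)) (t : ℝ) : Prop :=
  ∀ e ∈ E, dvec A e.1 e.2 ≠ 0 →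
    ((p : ℂ)⁻¹) ^ (sg e.2 * mm A e.1) * rho t ^ (dp e.2 α * mm A e.1) ≠
      ((p : ℂ)⁻¹) ^ (sg e.1 * mm A e.2) * rho t ^ (dp e.1 α * mm A e.2)

theorem GoodT.ne {A : Finset Vec} {p : ℕ} {α : Vec} {E : Finset (Vec × Vec)} {t : ℝ}
    (ht : GoodT A p α E t) {v h : Vec} (hE : (v, h) ∈ E) (hd : dvec A v h ≠ 0) {T1 : ℂ}
    (hmv : mm A v ≠ 0) (hv : wr A p α (rho t) T1 v = 1) : wr A p α (rho t) T1 h ≠ 1 := by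
  intro hh
  apply ht _ hE hd
  have hT1 : T1 ≠ 0 := by
    rintro rfl
    rw [wr, zero_pow hmv] at hv
    simp at hv
  have e1 : wr A p α (rho t) T1 h ^ mm A v = wr A p α (rho t) T1 v ^ mm A h := by
    rw [hv, hh, one_pow, one_pow]
  rw [wr, wr, mul_pow, mul_pow, mul_pow, mul_pow] at e1
  simp only [← pow_mul] at e1
  rw [mul_comm (mm A v) (mm A h)] at e1
  have h3 : T1 ^ (mm A h * mm A v) ≠ 0 := pow_ne_zero _ hT1
  apply mul_right_cancel₀ h3
  linear_combination e1

theorem good_dense {A : Finset Vec} {p : ℕ} (hp : 2 ≤ p) {α : Vec} {E : Finset (Vec × Vec)}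
    (hα : ∀ e ∈ E, zs (dvec A e.1 e.2) = 0 → dvec A e.1 e.2 ≠ 0 → zz (zv α) (dvec A e.1 e.2) ≠ 0) :
    (0 : ℝ) ∈ closure {t | GoodT A p α E t} := by
  have hfin : {t | GoodT A p α E t}ᶜ.Finite := by
    have hsub : {t | GoodT A p α E t}ᶜ ⊆ ⋃ e ∈ (E : Set (Vec × Vec)),
        ({-(zs (dvec A e.1 e.2) * Real.log p) / zz (zv α) (dvec A e.1 e.2),
          -(-(zs (dvec A e.1 e.2) * Real.log p) / zz (zv α) (dvec A e.1 e.2))} : Set ℝ) := by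
      intro t ht
      rw [Set.mem_compl_iff, Set.mem_ofPred_eq, GoodT] at ht
      push Not at ht
      obtain ⟨⟨v, h⟩, he, hd, heq⟩ := ht
      rw [Set.mem_iUnion₂]
      refine ⟨(v, h), he, ?_⟩
      simp only at heq hd ⊢
      have hα' := hα _ he
      simp only at hα'
      have hp0 : (0 : ℝ) < p := by exact_mod_cast (by omega : 0 < p)
      have hlog : 0 < Real.log p := Real.log_pos (by exact_mod_cast hp)
      have heq' : ((p : ℝ)⁻¹) ^ (sg h * mm A v) * Real.exp (-|t|) ^ (dp h α * mm A v) =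
          ((p : ℝ)⁻¹) ^ (sg v * mm A h) * Real.exp (-|t|) ^ (dp v α * mm A h) := by
        rw [rho_apply] at heq
        apply Complex.ofReal_injective
        push_cast at heq ⊢
        exact heq
      have hl := congrArg Real.log heq'
      rw [Real.log_mul (by positivity) (by positivity), Real.log_mul (by positivity) (by positivity)] at hl
      simp only [Real.log_pow, Real.log_inv, Real.log_exp] at hl
      have e1 : (zs (dvec A v h) : ℝ) = sg h * mm A v - sg v * mm A h := by
        simp [zs, dvec, sg]; ring
      have e2 : (zz (zv α) (dvec A v h) : ℝ) = dp h α * mm A v - dp v α * mm A h := by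
        simp [zz, zv, dvec, dp]; ring
      have hl2 : (zs (dvec A v h) : ℝ) * Real.log p + |t| * zz (zv α) (dvec A v h) = 0 := by
        rw [e1, e2]; push_cast at hl; linarith
      have hne : zz (zv α) (dvec A v h) ≠ 0 := by
        intro h0
        rw [h0] at hl2
        simp at hl2
        rcases hl2 with h1 | h1 | h1
        · exact hα' h1 hd h0
        · omega
        · rcases h1 with h1 | h1
          · omega
          · have : (p : ℝ) = -1 := by exact_mod_cast h1
            linarith
      have hne' : (zz (zv α) (dvec A v h) : ℝ) ≠ 0 := by exact_mod_cast hne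
      have habs : |t| = -(zs (dvec A v h) * Real.log p) / zz (zv α) (dvec A v h) := by
        rw [eq_div_iff hne']; linarith
      rw [← habs]
      rcases abs_choice t with h | h
      · left; exact h.symm
      · right; rw [h]; simp
    refine Set.Finite.subset (Set.Finite.biUnion E.finite_toSet ?_) hsub
    intro e _
    exact Set.toFinite _
  have := hfin.countable.dense_compl ℝ
  rw [compl_compl] at this
  exact this 0

end PartJ

section PartK

abbrev Lab := Finset Vec × Finset (Fin 3 → ℤ)

noncomputable def FF (A : Finset Vec) (p : ℕ) (ℓ : Finset Vec → Polynomial ℂ) (lab : Vec → Lab)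
    (α : Vec) (r T : ℂ) (l : Lab) : ℂ :=
  ∑' k, Set.indicator {k | VPos k ∧ lab k = l} (fun k => (ℓ (SS A k)).eval T * wr A p α r T k) k

noncomputable def FT (A : Finset Vec) (p : ℕ) (ℓ : Finset Vec → Polynomial ℂ)
    (α : Vec) (r T : ℂ) : ℂ :=
  ∑' k, Set.indicator {k | VPos k} (fun k => (ℓ (SS A k)).eval T * wr A p α r T k) k

theorem FF_eq {A : Finset Vec} {p : ℕ} {T0 : ℂ} {lab : Vec → Lab} {l : Lab} {a : Vec}
    {W : Finset Vec} (hc : IsCell A p T0 {k | VPos k ∧ lab k = l} l.1 a W)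
    (ℓ : Finset Vec → Polynomial ℂ) (α : Vec) (r T : ℂ) :
    FF A p ℓ lab α r T l = (ℓ l.1).eval T *
      ∑' k, Set.indicator {k | VPos k ∧ lab k = l} (mon (xr p α a r T)) k := by
  rw [FF, ← tsum_mul_left]
  apply tsum_congr
  intro k
  by_cases hk : k ∈ {k | VPos k ∧ lab k = l}
  · rw [Set.indicator_of_mem hk, Set.indicator_of_mem hk, hc.hS k hk, wr_eq (hc.haS k hk)]
  · rw [Set.indicator_of_notMem hk, Set.indicator_of_notMem hk, mul_zero]

theorem FT_sum {A : Finset Vec} {p : ℕ} (hp : 2 ≤ p) {lab : Vec → Lab} {Λ : Finset Lab}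
    (hlab : ∀ k, lab k ∈ Λ) (ℓ : Finset Vec → Polynomial ℂ) (α : Vec) {r T : ℂ} (hr : ‖r‖ ≤ 1)
    (hT : ‖T‖ < 1) : FT A p ℓ α r T = ∑ l ∈ Λ, FF A p ℓ lab α r T l := by
  have sI := summable_wr (A := A) hp (α := α) hr hT (bdd_SS A (fun S => (ℓ S).eval T))
  unfold FT FF
  rw [← Summable.tsum_finsetSum (fun l _ => sI.indicator _)]
  apply tsum_congr
  intro k
  rw [Finset.sum_eq_single (lab k)]
  · by_cases hk : VPos k
    · rw [Set.indicator_of_mem (by exact hk), Set.indicator_of_mem (by exact ⟨hk, rfl⟩)]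
    · rw [Set.indicator_of_notMem (by exact hk), Set.indicator_of_notMem (by exact fun h => hk h.1)]
  · intro l _ hl
    rw [Set.indicator_of_notMem (by exact fun h => hl h.2.symm)]
  · intro h; exact (h (hlab k)).elim

theorem cell_gf {A : Finset Vec} {p : ℕ} {T0 : ℂ} {M : Set Vec} {S : Finset Vec} {a : Vec}
    {W : Finset Vec} (hc : IsCell A p T0 M S a W) :
    ∃ c : MvPolynomial (Fin 3) ℂ, ∀ x : Fin 3 → ℂ, (∀ l, ‖x l‖ < 1) →
      (∏ w ∈ W, (1 - mon x w)) * (∑' k, M.indicator (mon x) k) = MvPolynomial.eval x c :=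
  gf_cell W (fun h => hc.hW0 0 h rfl) M hc.hadd hc.hcone

theorem FF_reg {A : Finset Vec} {p : ℕ} (hp : 2 ≤ p) {T0 : ℂ} {lab : Vec → Lab} {l : Lab} {a : Vec}
    {W : Finset Vec} (hc : IsCell A p T0 {k | VPos k ∧ lab k = l} l.1 a W)
    (ℓ : Finset Vec → Polynomial ℂ) (α : Vec) {r : ℂ} (hr : ‖r‖ ≤ 1) {T1 : ℂ}
    (hT1 : ∀ w ∈ W, wr A p α r T1 w ≠ 1) : Reg T1 (fun T => FF A p ℓ lab α r T l) := by
  obtain ⟨c, hcc⟩ := cell_gf hc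
  refine (reg_of_gf hp hcc α a hr (ℓ l.1) (T1 := T1) ?_).congr ?_
  · intro w hw
    rw [← wr_eq (hc.haW w hw)]
    exact hT1 w hw
  · intro T _
    exact FF_eq hc ℓ α r T

theorem Reg.sub {T1 : ℂ} {g h : ℂ → ℂ} (hg : Reg T1 g) (hh : Reg T1 h) :
    Reg T1 (fun T => g T - h T) := by
  simpa [sub_eq_add_neg] using hg.add hh.neg

/-- constant coefficient of the monic factor attached to a bad ray -/
noncomputable def kc (p : ℕ) (α : Vec) (w : Vec) : C(ℝ, ℂ) :=
  ⟨fun t => (p : ℂ) ^ sg w * (rho t)⁻¹ ^ dp w α, by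
    have h : Continuous fun t => (rho t)⁻¹ := rho.continuous.inv₀ rho_ne
    fun_prop⟩

theorem kc_apply (p : ℕ) (α : Vec) (w : Vec) (t : ℝ) :
    kc p α w t = (p : ℂ) ^ sg w * (rho t)⁻¹ ^ dp w α := rfl

/-- the unit with `1 - wr = unit * monic` -/
noncomputable def uc (p : ℕ) (α : Vec) (w : Vec) : C(ℝ, ℂ) :=
  ⟨fun t => -(((p : ℂ)⁻¹) ^ sg w * (rho t) ^ dp w α), by fun_prop⟩

theorem uc_apply (p : ℕ) (α : Vec) (w : Vec) (t : ℝ) :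
    uc p α w t = -(((p : ℂ)⁻¹) ^ sg w * (rho t) ^ dp w α) := rfl

theorem one_sub_wr {A : Finset Vec} {p : ℕ} (hp : 2 ≤ p) (α : Vec) (w : Vec) (t : ℝ) (T : ℂ) :
    1 - wr A p α (rho t) T w = uc p α w t * (T ^ mm A w - kc p α w t) := by
  have hp0 : (p : ℂ) ≠ 0 := by
    have : p ≠ 0 := by omega
    exact_mod_cast this
  have h := rho_ne t
  rw [kc_apply, uc_apply, wr]
  have e1 : ((p : ℂ)⁻¹) ^ sg w * (p : ℂ) ^ sg w = 1 := by
    rw [← mul_pow, inv_mul_cancel₀ hp0, one_pow]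
  have e2 : (rho t) ^ dp w α * (rho t)⁻¹ ^ dp w α = 1 := by
    rw [← mul_pow, mul_inv_cancel₀ h, one_pow]
  linear_combination (-1 : ℂ) * (rho t ^ dp w α * (rho t)⁻¹ ^ dp w α) * e1 - e2

theorem uc_ne {p : ℕ} (hp : 2 ≤ p) (α : Vec) (w : Vec) (t : ℝ) : uc p α w t ≠ 0 := by
  have hp0 : (p : ℂ) ≠ 0 := by
    have : p ≠ 0 := by omega
    exact_mod_cast this
  rw [uc_apply]
  exact neg_ne_zero.mpr (mul_ne_zero (pow_ne_zero _ (inv_ne_zero hp0)) (pow_ne_zero _ (rho_ne t)))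

theorem dvec_ne {A : Finset Vec} {p : ℕ} (hp : 2 ≤ p) {T0 : ℂ} {v C h : Vec} {i : Fin 3}
    (hv : v ∈ Bad A p T0) (hvi : 0 < v i) (hle : ∀ ω ∈ SS A v, ω i ≤ 1) (hC : C ∈ SS A v)
    (hmin : ∀ D ∈ SS A v, D i = 1 → C ≤ D) (h0 : h ≠ 0)
    (hh : h i = 0 ∨ ∃ D ∈ A, 1 ≤ D i ∧ ¬ C ≤ D ∧ dp h D ≤ dp h C) : dvec A v h ≠ 0 := by
  intro hd
  have hmv := Bad.mm_ne hp hv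
  have hvec : mm A v • h = mm A h • v := by
    ext l
    have := congrFun hd l
    simp only [dvec, Pi.zero_apply] at this
    simp only [Pi.smul_apply, smul_eq_mul]
    exact_mod_cast (sub_eq_zero.mp this)
  have hmh : mm A h ≠ 0 := by
    intro h1
    rw [h1, zero_smul] at hvec
    apply h0
    ext l
    have := congrFun hvec l
    simp only [Pi.smul_apply, smul_eq_mul, Pi.zero_apply, mul_eq_zero] at this
    exact this.resolve_left hmv
  rcases hh with hh | ⟨D, hD, h1, h2, h3⟩
  · have := congrFun hvec i
    simp only [Pi.smul_apply, smul_eq_mul, hh, mul_zero] at this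
    have := mul_pos (Nat.pos_of_ne_zero hmh) hvi
    omega
  · have h4 : dp v C < dp v D := by
      refine lt_of_le_of_ne ((mem_SS.mp hC).2 D hD) ?_
      intro h5
      have h6 : D ∈ SS A v := (mem_SS_iff_eq hC hD).mpr h5.symm
      have := hle D h6
      exact h2 (hmin D h6 (by omega))
    have e1 : mm A v * dp h D = mm A h * dp v D := by rw [← dp_nsmul, hvec, dp_nsmul]
    have e2 : mm A v * dp h C = mm A h * dp v C := by rw [← dp_nsmul, hvec, dp_nsmul]
    have h5 : mm A h * dp v C < mm A h * dp v D :=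
      Nat.mul_lt_mul_of_pos_left h4 (Nat.pos_of_ne_zero hmh)
    have h6 : mm A v * dp h D ≤ mm A v * dp h C := Nat.mul_le_mul_left _ h3
    omega

theorem abs_step {A : Finset Vec} {p : ℕ} (hp : 2 ≤ p) {T0 : ℂ}
    {ℓ : Finset Vec → Polynomial ℂ}
    (hℓ1 : ∀ C k, VPos k → SS A k = {C} → ∀ T, (ℓ {C}).eval T =
      ((p : ℂ)⁻¹) ^ 2 * ((p : ℂ) - 1) ^ 3 * (1 - (p : ℂ)⁻¹ * T))
    (hℓ2 : ∀ (i : Fin 3) (C k : Vec), VPos k → C ∈ SS A k → C i = 1 →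
      (∀ ω ∈ SS A k, ω ≠ C → ω i = 0) → SS A k ≠ {C} →
      ∀ T, (ℓ (SS A k)).eval T + ((p : ℂ) - 1)⁻¹ * (ℓ ((SS A k).erase C)).eval T =
        ((p : ℂ)⁻¹) ^ 2 * ((p : ℂ) - 1) ^ 3)
    {lab : Vec → Lab} {Λ Λi : Finset Lab} (hlab : ∀ k, lab k ∈ Λ) {a : Lab → Vec}
    {W : Lab → Finset Vec} (hcell : ∀ l, IsCell A p T0 {k | VPos k ∧ lab k = l} l.1 (a l) (W l))
    (hsub : Λi ⊆ Λ) {i : Fin 3} {bad : Set Vec} (hbad : bad ⊆ Bad A p T0)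
    (hB : ∀ v ∈ bad, B1c A v i)
    (h1 : ∀ l ∈ Λi, ∀ w ∈ W l, w ∈ Bad A p T0 → w ∈ bad)
    (h2 : ∀ l ∈ Λ, l ∉ Λi → ∀ w ∈ W l, w ∉ bad) (α0 : Vec) :
    Reg T0 (fun T => ∑ l ∈ Λi, FF A p ℓ lab α0 1 T l) := by
  classical
  -- column data
  have hcol : ∀ v ∈ bad, ∃ H : Finset Vec, (∀ h ∈ H, dvec A v h ≠ 0) ∧
      ∀ (α : Vec) (r T1 : ℂ), α i = 0 → ‖r‖ ≤ 1 → (∀ h ∈ H, wr A p α r T1 h ≠ 1) →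
        Reg T1 (fun T => FT A p ℓ α r T) := by
    intro v hv
    obtain ⟨hvi, hle, -, C, hCS, hC1, hmin⟩ := hB v hv
    obtain ⟨H, hH1, hH2⟩ := column hp (SS_sub hCS) hC1 (hℓ1 C)
      (fun k g1 g2 g3 g4 => hℓ2 i C k g1 g2 hC1 g3 g4)
    exact ⟨H, fun h hh => dvec_ne hp (hbad hv) hvi hle hCS hmin (hH1 h hh).1 (hH1 h hh).2, hH2⟩
  choose! H hH1 hH2 using hcol
  have hfin : bad.Finite := (Rays A).finite_toSet.subset (fun v hv => by
    rw [Finset.mem_coe, mem_Rays]; exact (hbad hv).1)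
  set BF := hfin.toFinset with hBF
  set E : Finset (Vec × Vec) := BF.biUnion (fun v => (H v ∪ Λ.biUnion W).image (fun h => (v, h)))
    with hE
  have hEmem : ∀ {v h}, v ∈ bad → (h ∈ H v ∨ ∃ l ∈ Λ, h ∈ W l) → (v, h) ∈ E := by
    intro v h hv hh
    rw [hE, Finset.mem_biUnion]
    refine ⟨v, by simpa [hBF] using hv, ?_⟩
    rw [Finset.mem_image]
    refine ⟨h, ?_, rfl⟩
    rw [Finset.mem_union, Finset.mem_biUnion]
    exact hh
  obtain ⟨α, hα0, hα⟩ := exists_alpha i (E.image (fun e => dvec A e.1 e.2))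
  have hdense := good_dense (A := A) hp (α := α) (E := E) (fun e he h3 h4 =>
    hα _ (Finset.mem_image_of_mem _ he) h3 h4)
  -- polynomials
  have hcg := fun l => cell_gf (hcell l)
  choose c hcc using hcg
  let Wb : Lab → Finset Vec := fun l => (W l).filter (fun w => w ∈ Bad A p T0)
  let Wg : Lab → Finset Vec := fun l => (W l).filter (fun w => w ∉ Bad A p T0)
  let D : Polynomial C(ℝ, ℂ) := ∏ l ∈ Λi, ∏ w ∈ Wb l,
    (Polynomial.X ^ mm A w - Polynomial.C (kc p α w))
  have hWb : ∀ {l w}, w ∈ Wb l → w ∈ W l ∧ w ∈ Bad A p T0 := fun h => Finset.mem_filter.mp h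
  have hWg : ∀ {l w}, w ∈ Wg l → w ∈ W l ∧ w ∉ Bad A p T0 := fun h => Finset.mem_filter.mp h
  have hDm : D.Monic := by
    apply Polynomial.monic_prod_of_monic
    intro l _
    apply Polynomial.monic_prod_of_monic
    intro w hw
    exact Polynomial.monic_X_pow_sub_C _ (Bad.mm_ne hp (hWb hw).2)
  have hDev : ∀ t T, (ev t D).eval T = ∏ l ∈ Λi, ∏ w ∈ Wb l, (T ^ mm A w - kc p α w t) := by
    intro t T
    simp only [D, map_prod, Polynomial.eval_prod]
    refine Finset.prod_congr rfl fun l _ => Finset.prod_congr rfl fun w _ => ?_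
    simp [ev, Polynomial.map_sub]
  let Ef : Lab → ℝ → ℂ → ℂ := fun l t T => ∏ w ∈ W l, (1 - mon (xr p α (a l) (rho t) T) w)
  let G : ℝ → ℂ → ℂ := fun t T => ∏ l ∈ Λi, ((∏ w ∈ Wg l, (1 - mon (xr p α (a l) (rho t) T) w)) *
    ∏ w ∈ Wb l, uc p α w t)
  have hmon : ∀ l, ∀ w ∈ W l, ∀ r T, mon (xr p α (a l) r T) w = wr A p α r T w :=
    fun l w hw r T => (wr_eq ((hcell l).haW w hw)).symm
  have hGD : ∀ t T, G t T * (ev t D).eval T = ∏ l ∈ Λi, Ef l t T := by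
    intro t T
    rw [hDev, ← Finset.prod_mul_distrib]
    refine Finset.prod_congr rfl fun l _ => ?_
    simp only [Ef]
    rw [← Finset.prod_filter_mul_prod_filter_not (W l) (fun w => w ∈ Bad A p T0),
      mul_assoc, ← Finset.prod_mul_distrib, mul_comm]
    congr 1
    refine Finset.prod_congr rfl fun w hw => ?_
    rw [hmon l w (hWb hw).1, one_sub_wr hp]
  let N : ℝ → ℂ → ℂ := fun t T => ∑ l ∈ Λi, (∏ l' ∈ Λi.erase l, Ef l' t T) *
    ((ℓ l.1).eval T * MvPolynomial.eval (xr p α (a l) (rho t) T) (c l))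
  have hEfP : ∀ l, PolyC (Ef l) := fun l => PolyC.prod _ (fun w _ => polyC_one_sub_mon p α (a l) rho w)
  have hGP : PolyC G := PolyC.prod _ (fun l _ =>
    (PolyC.prod _ (fun w _ => polyC_one_sub_mon p α (a l) rho w)).mul
      (PolyC.prod _ (fun w _ => PolyC.const (uc p α w))))
  have hNP : PolyC N := PolyC.sum _ (fun l _ =>
    (PolyC.prod _ (fun l' _ => hEfP l')).mul ((PolyC.poly _).mul
      (PolyC.mv (c l) (fun j => polyC_xr p α (a l) rho j))))
  have key := deform (r1 := (0 : ℝ)) hdense hDm hGP hNP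
    (g := fun t T => ∑ l ∈ Λi, FF A p ℓ lab α (rho t) T l) (T0 := T0) ?_ ?_ ?_ ?_
  · refine key.congr fun T _ => Finset.sum_congr rfl fun l _ => ?_
    simp only [FF, rho_zero, wr_one]
  · intro t T hT
    rw [hGD, Finset.mul_sum]
    refine Finset.sum_congr rfl fun l hl => ?_
    rw [FF_eq (hcell l), ← hcc l _ (xr_lt hp (rho_le t) hT), ← Finset.mul_prod_erase _ _ hl]
    simp only [Ef]
    ring
  · intro t ht T1 hT1
    rw [hDev, Finset.prod_eq_zero_iff] at hT1
    obtain ⟨l0, hl0, hT1⟩ := hT1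
    rw [Finset.prod_eq_zero_iff] at hT1
    obtain ⟨v, hv, hT1⟩ := hT1
    have hvb := h1 l0 hl0 v (hWb hv).1 (hWb hv).2
    have hmv := Bad.mm_ne hp (hWb hv).2
    have hv1 : wr A p α (rho t) T1 v = 1 := by
      have := one_sub_wr (A := A) hp α v t T1
      rw [hT1, mul_zero] at this
      exact (sub_eq_zero.mp this).symm
    have r1 : Reg T1 (fun T => FT A p ℓ α (rho t) T) :=
      hH2 v hvb α _ T1 hα0 (rho_le t) (fun h hh =>
        GoodT.ne ht (hEmem hvb (Or.inl hh)) (hH1 v hvb h hh) hmv hv1)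
    have r2 : Reg T1 (fun T => ∑ l ∈ Λ \ Λi, FF A p ℓ lab α (rho t) T l) := by
      apply Reg.sum
      intro l hl
      rw [Finset.mem_sdiff] at hl
      apply FF_reg hp (hcell l) ℓ α (rho_le t)
      intro w hw
      refine GoodT.ne ht (hEmem hvb (Or.inr ⟨l, hl.1, hw⟩)) ?_ hmv hv1
      intro hd
      have : w = v := (hcell l).hpar w hw v (hbad hvb) (fun j => by
        have := congrFun hd j
        simp only [dvec, Pi.zero_apply] at this
        exact_mod_cast (sub_eq_zero.mp this))
      exact h2 l hl.1 hl.2 w hw (this ▸ hvb)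
    refine (r1.sub r2).congr fun T hT => ?_
    rw [FT_sum hp hlab ℓ α (rho_le t) hT, ← Finset.sum_sdiff hsub]
    ring
  · rw [Finset.prod_ne_zero_iff]
    intro l hl
    refine mul_ne_zero ?_ ?_
    · rw [Finset.prod_ne_zero_iff]
      intro w hw h
      rw [hmon l w (hWg hw).1, rho_zero, wr_one] at h
      exact (hWg hw).2 ((hcell l).hbad w (hWg hw).1 (sub_eq_zero.mp h).symm)
    · rw [Finset.prod_ne_zero_iff]
      intro w _
      exact uc_ne hp α w 0
  · intro T hT
    rw [hDev, Finset.prod_ne_zero_iff]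
    intro l hl
    rw [Finset.prod_ne_zero_iff]
    intro w hw h
    have h3 : T ^ mm A w = (p : ℂ) ^ sg w := by
      rw [kc_apply, rho_zero] at h
      simpa using sub_eq_zero.mp h
    have h4 : ‖T‖ ^ mm A w = (p : ℝ) ^ sg w := by
      rw [← norm_pow, h3, norm_pow]; simp
    have h5 : ‖T‖ ^ mm A w < 1 := pow_lt_one₀ (norm_nonneg _) hT (Bad.mm_ne hp (hWb hw).2)
    have h6 : (1 : ℝ) ≤ (p : ℝ) ^ sg w := one_le_pow₀ (by exact_mod_cast (by omega : 1 ≤ p))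
    linarith

theorem abs_main {A : Finset Vec} (hA : A.Nonempty) {p : ℕ} (hp : 2 ≤ p) {T0 : ℂ} (hT0 : T0 ≠ p)
    {ℓ : Finset Vec → Polynomial ℂ}
    (hℓ1 : ∀ C k, VPos k → SS A k = {C} → ∀ T, (ℓ {C}).eval T =
      ((p : ℂ)⁻¹) ^ 2 * ((p : ℂ) - 1) ^ 3 * (1 - (p : ℂ)⁻¹ * T))
    (hℓ2 : ∀ (i : Fin 3) (C k : Vec), VPos k → C ∈ SS A k → C i = 1 →
      (∀ ω ∈ SS A k, ω ≠ C → ω i = 0) → SS A k ≠ {C} →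
      ∀ T, (ℓ (SS A k)).eval T + ((p : ℂ) - 1)⁻¹ * (ℓ ((SS A k).erase C)).eval T =
        ((p : ℂ)⁻¹) ^ 2 * ((p : ℂ) - 1) ^ 3)
    {var : Vec → Fin 3} (hvar : ∀ u ∈ Bad A p T0, B1c A u (var u))
    (hadj : ∀ u ∈ Bad A p T0, ∀ u' ∈ Bad A p T0, Adj A u u' → var u = var u') :
    Reg T0 (fun T => ∑' k, Set.indicator {k | VPos k}
      (fun k => (ℓ (SS A k)).eval T * wt A p T k) k) := by
  classical
  obtain ⟨lab, Λ, a, W, hlab, hcell⟩ := cells hA hp hT0 (fun u hu => ⟨_, hvar u hu⟩)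
  let Λc : Fin 3 → Finset Lab := fun i =>
    Λ.filter (fun l => ∃ w ∈ W l, w ∈ Bad A p T0 ∧ var w = i)
  let Λ0 : Finset Lab := Λ.filter (fun l => ∀ w ∈ W l, w ∉ Bad A p T0)
  have hstep : ∀ i, Reg T0 (fun T => ∑ l ∈ Λc i, FF A p ℓ lab 0 1 T l) := by
    intro i
    refine abs_step hp hℓ1 hℓ2 hlab hcell (Finset.filter_subset _ _)
      (bad := {v | v ∈ Bad A p T0 ∧ var v = i}) (i := i) (fun v hv => hv.1) ?_ ?_ ?_ 0
    · rintro v ⟨hv, rfl⟩; exact hvar v hv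
    · intro l hl w hw hwb
      obtain ⟨-, w', hw', hwb', rfl⟩ := Finset.mem_filter.mp hl
      exact ⟨hwb, hadj w hwb w' hwb' ((hcell l).hadj w hw w' hw' hwb hwb')⟩
    · rintro l hl hli w hw ⟨hwb, hwi⟩
      exact hli (Finset.mem_filter.mpr ⟨hl, w, hw, hwb, hwi⟩)
  have h0 : Reg T0 (fun T => ∑ l ∈ Λ0, FF A p ℓ lab 0 1 T l) := by
    apply Reg.sum
    intro l hl
    apply FF_reg hp (hcell l) ℓ 0 (by simp)
    intro w hw h
    rw [wr_one] at h
    exact (Finset.mem_filter.mp hl).2 w hw ((hcell l).hbad w hw h)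
  have hall := h0.add (Reg.sum Finset.univ (fun i _ => hstep i))
  refine hall.congr fun T hT => ?_
  have e1 : FT A p ℓ 0 1 T = ∑ l ∈ Λ, FF A p ℓ lab 0 1 T l := FT_sum hp hlab ℓ 0 (by simp) hT
  have e2 : ∑' k, Set.indicator {k | VPos k} (fun k => (ℓ (SS A k)).eval T * wt A p T k) k
      = FT A p ℓ 0 1 T := by
    simp only [FT, wr_one]
  rw [e2, e1]
  have hdisj : Set.PairwiseDisjoint ((Finset.univ : Finset (Fin 3)) : Set (Fin 3)) Λc := by
    intro i _ j _ hij
    rw [Function.onFun, Finset.disjoint_left]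
    intro l hl hl'
    obtain ⟨-, w, hw, hwb, rfl⟩ := Finset.mem_filter.mp hl
    obtain ⟨-, w', hw', hwb', rfl⟩ := Finset.mem_filter.mp hl'
    exact hij (hadj w hwb w' hwb' ((hcell l).hadj w hw w' hw' hwb hwb'))
  rw [← Finset.sum_biUnion hdisj, ← Finset.sum_union]
  · apply Finset.sum_congr _ (fun _ _ => rfl)
    ext l
    rw [Finset.mem_union, Finset.mem_biUnion]
    constructor
    · intro hl
      by_cases h : ∀ w ∈ W l, w ∉ Bad A p T0
      · left; exact Finset.mem_filter.mpr ⟨hl, h⟩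
      · right
        push Not at h
        obtain ⟨w, hw, hwb⟩ := h
        exact ⟨var w, Finset.mem_univ _, Finset.mem_filter.mpr ⟨hl, w, hw, hwb, rfl⟩⟩
    · rintro (h | ⟨i, -, h⟩)
      · exact (Finset.mem_filter.mp h).1
      · exact (Finset.mem_filter.mp h).1
  · rw [Finset.disjoint_left]
    intro l hl hl'
    rw [Finset.mem_biUnion] at hl'
    obtain ⟨i, -, hl'⟩ := hl'
    obtain ⟨-, w, hw, hwb, -⟩ := Finset.mem_filter.mp hl'
    exact (Finset.mem_filter.mp hl).2 w hw hwb

end PartK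

open MeasureTheory MvPolynomial

section PartL

variable {p : ℕ} [Fact p.Prime]

open Classical in
/-- the support of `f` as a set of vectors -/
noncomputable def supp (f : MvPolynomial (Fin 3) ℤ_[p]) : Finset Vec := f.support.image (fun a : Fin 3 →₀ ℕ => (⇑a : Vec))

theorem mem_supp {f : MvPolynomial (Fin 3) ℤ_[p]} {ω : Vec} :
    ω ∈ supp f ↔ ∃ a ∈ f.support, ⇑a = ω := by
  simp [supp]

theorem supp_nonempty {f : MvPolynomial (Fin 3) ℤ_[p]} (hf : f ≠ 0) : (supp f).Nonempty := by
  obtain ⟨a, ha⟩ := MvPolynomial.support_nonempty.mpr hf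
  exact ⟨⇑a, mem_supp.mpr ⟨a, ha, rfl⟩⟩

/-- real point of a vector -/
noncomputable def vr (k : Vec) : Fin 3 → ℝ := intR (zv k)

theorem vr_apply (k : Vec) (i : Fin 3) : vr k i = (k i : ℝ) := by simp [vr, intR, zv]

theorem vr_coe (a : Fin 3 →₀ ℕ) : vr (⇑a) = expR a := by
  ext i; simp [vr_apply, expR]

theorem dot3_vr (k ω : Vec) : dot3 (vr k) (vr ω) = (dp k ω : ℝ) := by
  simp [dot3, vr_apply, Fin.sum_univ_three, dp]

theorem dot3_vr_le (k : Vec) {x y : Fin 3 → ℝ} (h : ∀ i, x i ≤ y i) : dot3 (vr k) x ≤ dot3 (vr k) y := by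
  unfold dot3
  apply Finset.sum_le_sum
  intro i _
  rw [vr_apply]
  exact mul_le_mul_of_nonneg_left (h i) (Nat.cast_nonneg _)

theorem dot3_add (k x y : Fin 3 → ℝ) : dot3 k (x + y) = dot3 k x + dot3 k y := by
  simp [dot3, mul_add, Finset.sum_add_distrib]

theorem dot3_smul (k x : Fin 3 → ℝ) (c : ℝ) : dot3 k (c • x) = c * dot3 k x := by
  simp only [dot3, Finset.mul_sum, Pi.smul_apply, smul_eq_mul]
  exact Finset.sum_congr rfl fun i _ => by ring

theorem dot3_vr_eq {k : Vec} {x y : Fin 3 → ℝ} (h : ∀ i, x i ≤ y i)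
    (he : dot3 (vr k) y = dot3 (vr k) x) {l : Fin 3} (hl : 0 < k l) : y l = x l := by
  by_contra hne
  have hlt : x l < y l := lt_of_le_of_ne (h l) (Ne.symm hne)
  have : dot3 (vr k) x < dot3 (vr k) y := by
    unfold dot3
    apply Finset.sum_lt_sum
    · intro i _
      rw [vr_apply]
      exact mul_le_mul_of_nonneg_left (h i) (Nat.cast_nonneg _)
    · refine ⟨l, Finset.mem_univ _, ?_⟩
      rw [vr_apply]
      exact mul_lt_mul_of_pos_left hlt (Nat.cast_pos.mpr hl)
  linarith

theorem newton_eq (f : MvPolynomial (Fin 3) ℤ_[p]) :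
    newtonPolyhedron f = convexHull ℝ (⋃ ω ∈ supp f, {x : Fin 3 → ℝ | ∀ i, vr ω i ≤ x i}) := by
  unfold newtonPolyhedron
  congr 1
  ext x
  simp only [Set.mem_iUnion, mem_supp, vr_apply]
  constructor
  · rintro ⟨a, ha, h⟩
    exact ⟨⇑a, ⟨a, ha, rfl⟩, h⟩
  · rintro ⟨_, ⟨a, ha, rfl⟩, h⟩
    exact ⟨a, ha, h⟩

theorem mem_newton {f : MvPolynomial (Fin 3) ℤ_[p]} {ω : Vec} (h : ω ∈ supp f) {x : Fin 3 → ℝ}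
    (hx : ∀ i, vr ω i ≤ x i) : x ∈ newtonPolyhedron f := by
  rw [newton_eq]
  apply subset_convexHull
  simp only [Set.mem_iUnion]
  exact ⟨ω, h, hx⟩

/-- candidate for the first meet locus -/
noncomputable def GG (A : Finset Vec) (k : Vec) : Set (Fin 3 → ℝ) :=
  convexHull ℝ (⋃ ω ∈ SS A k, {x : Fin 3 → ℝ | ∀ i, vr ω i ≤ x i ∧ (0 < k i → x i = vr ω i)})

theorem newton_key {f : MvPolynomial (Fin 3) ℤ_[p]} (hf : f ≠ 0) (k : Vec) {x : Fin 3 → ℝ}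
    (hx : x ∈ newtonPolyhedron f) :
    (mm (supp f) k : ℝ) ≤ dot3 (vr k) x ∧ (dot3 (vr k) x = mm (supp f) k → x ∈ GG (supp f) k) := by
  obtain ⟨a, ha⟩ := SS_nonempty (supp_nonempty hf) k
  let Y : Set (Fin 3 → ℝ) := {x | (mm (supp f) k : ℝ) ≤ dot3 (vr k) x ∧
    (dot3 (vr k) x = mm (supp f) k → x ∈ GG (supp f) k)}
  suffices h : newtonPolyhedron f ⊆ Y from h hx
  rw [newton_eq]
  apply convexHull_min
  · intro z hz
    simp only [Set.mem_iUnion] at hz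
    obtain ⟨ω, hω, hz⟩ := hz
    have hz' : ∀ i, vr ω i ≤ z i := hz
    have h1 := dot3_vr_le k hz'
    rw [dot3_vr] at h1
    have h2 : mm (supp f) k ≤ dp k ω := by
      rw [mm_eq ha]; exact (mem_SS.mp ha).2 ω hω
    have h2' : (mm (supp f) k : ℝ) ≤ dp k ω := by exact_mod_cast h2
    refine ⟨h2'.trans h1, fun he => ?_⟩
    have h3 : (dp k ω : ℝ) = mm (supp f) k := by linarith
    have h4 : dp k ω = mm (supp f) k := by exact_mod_cast h3
    apply subset_convexHull
    simp only [Set.mem_iUnion]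
    refine ⟨ω, (mem_SS_iff_eq ha hω).mpr (by rw [h4, mm_eq ha]), fun i => ⟨hz' i, fun hi => ?_⟩⟩
    exact dot3_vr_eq hz' (by rw [he, dot3_vr, h3]) hi
  · intro x hx y hy s t hs ht hst
    have e : dot3 (vr k) (s • x + t • y) = s * dot3 (vr k) x + t * dot3 (vr k) y := by
      rw [dot3_add, dot3_smul, dot3_smul]
    have hx1 := mul_le_mul_of_nonneg_left hx.1 hs
    have hy1 := mul_le_mul_of_nonneg_left hy.1 ht
    have es : s * (mm (supp f) k : ℝ) + t * mm (supp f) k = mm (supp f) k := by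
      rw [← add_mul, hst, one_mul]
    refine ⟨by rw [e]; linarith, fun he => ?_⟩
    rw [e] at he
    rcases hs.eq_or_lt with h0 | h0
    · have ht1 : t = 1 := by linarith
      subst h0; subst ht1
      simp only [zero_smul, zero_add, one_smul]
      apply hy.2; simpa using he
    rcases ht.eq_or_lt with h0' | h0'
    · have ht1 : s = 1 := by linarith
      subst h0'; subst ht1
      simp only [zero_smul, add_zero, one_smul]
      apply hx.2; simpa using he
    have hx2 : dot3 (vr k) x = mm (supp f) k := by
      have : s * dot3 (vr k) x = s * mm (supp f) k := by linarith
      exact mul_left_cancel₀ h0.ne' this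
    have hy2 : dot3 (vr k) y = mm (supp f) k := by
      have : t * dot3 (vr k) y = t * mm (supp f) k := by linarith
      exact mul_left_cancel₀ h0'.ne' this
    exact (convex_convexHull ℝ _) (hx.2 hx2) (hy.2 hy2) hs ht hst

theorem GG_sub {f : MvPolynomial (Fin 3) ℤ_[p]} {k : Vec} {x : Fin 3 → ℝ} (hx : x ∈ GG (supp f) k) :
    x ∈ newtonPolyhedron f ∧ dot3 (vr k) x = mm (supp f) k := by
  constructor
  · rw [newton_eq]
    refine convexHull_mono ?_ hx
    intro z hz
    simp only [Set.mem_iUnion] at hz ⊢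
    obtain ⟨ω, hω, hz⟩ := hz
    exact ⟨ω, SS_sub hω, fun i => (hz i).1⟩
  · suffices h : GG (supp f) k ⊆ {x | dot3 (vr k) x = mm (supp f) k} from h hx
    apply convexHull_min
    · intro z hz
      simp only [Set.mem_iUnion] at hz
      obtain ⟨ω, hω, hz⟩ := hz
      have : dot3 (vr k) z = dot3 (vr k) (vr ω) := by
        unfold dot3
        apply Finset.sum_congr rfl
        intro i _
        rcases Nat.eq_zero_or_pos (k i) with h | h
        · simp [vr_apply k, h]
        · rw [(hz i).2 h]
      show dot3 (vr k) z = mm (supp f) k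
      rw [this, dot3_vr, mm_eq hω]
    · intro x hx y hy s t hs ht hst
      have hx : dot3 (vr k) x = mm (supp f) k := hx
      have hy : dot3 (vr k) y = mm (supp f) k := hy
      show dot3 (vr k) (s • x + t • y) = mm (supp f) k
      rw [dot3_add, dot3_smul, dot3_smul, hx, hy, ← add_mul, hst, one_mul]

theorem vr_mem_GG {A : Finset Vec} {k ω : Vec} (h : ω ∈ SS A k) : vr ω ∈ GG A k := by
  apply subset_convexHull
  simp only [Set.mem_iUnion]
  exact ⟨ω, h, fun i => ⟨le_rfl, fun _ => rfl⟩⟩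

theorem mval_eq {f : MvPolynomial (Fin 3) ℤ_[p]} (hf : f ≠ 0) (k : Vec) :
    mval f (vr k) = mm (supp f) k := by
  obtain ⟨a, ha⟩ := SS_nonempty (supp_nonempty hf) k
  have h := GG_sub (vr_mem_GG ha)
  unfold mval
  apply IsLeast.csInf_eq
  refine ⟨⟨_, h.1, h.2⟩, ?_⟩
  rintro _ ⟨x, hx, rfl⟩
  exact (newton_key hf k hx).1

/-- first meet locus -/
noncomputable def FLoc (f : MvPolynomial (Fin 3) ℤ_[p]) (k : Vec) : Set (Fin 3 → ℝ) :=
  {x ∈ newtonPolyhedron f | dot3 (intR (zv k)) x = mval f (intR (zv k))}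

theorem FLoc_eq {f : MvPolynomial (Fin 3) ℤ_[p]} (hf : f ≠ 0) (k : Vec) : FLoc f k = GG (supp f) k := by
  ext x
  constructor
  · rintro ⟨h1, h2⟩
    refine (newton_key hf k h1).2 ?_
    rw [← mval_eq hf]; exact h2
  · intro hx
    have h := GG_sub hx
    refine ⟨h.1, ?_⟩
    have := h.2
    rw [← mval_eq hf] at this
    exact this

theorem FLoc_face {f : MvPolynomial (Fin 3) ℤ_[p]} {k : Vec} (hk : k ≠ 0) : IsFaceOf f (FLoc f k) := by
  refine Or.inr ⟨vr k, fun i => by rw [vr_apply]; exact Nat.cast_nonneg _, fun h => hk ?_, rfl⟩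
  ext i
  have := congrFun h i
  rw [vr_apply] at this
  simpa using this

theorem vr_mem_GG_iff {f : MvPolynomial (Fin 3) ℤ_[p]} {k ω : Vec} (hω : ω ∈ supp f) :
    vr ω ∈ GG (supp f) k ↔ ω ∈ SS (supp f) k := by
  refine ⟨fun h => ?_, vr_mem_GG⟩
  have h2 := (GG_sub h).2
  rw [dot3_vr] at h2
  have h3 : dp k ω = mm (supp f) k := by exact_mod_cast h2
  obtain ⟨a, ha⟩ := SS_nonempty ⟨ω, hω⟩ k
  rw [mem_SS_iff_eq ha hω, h3, mm_eq ha]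

theorem FLoc_compact {f : MvPolynomial (Fin 3) ℤ_[p]} (hf : f ≠ 0) {k : Vec} (hk : ∀ l, 0 < k l) :
    IsCompact (FLoc f k) := by
  rw [FLoc_eq hf]
  have : GG (supp f) k = convexHull ℝ (vr '' (SS (supp f) k : Set Vec)) := by
    unfold GG
    congr 1
    ext x
    simp only [Set.mem_iUnion, Set.mem_image, Finset.mem_coe]
    constructor
    · rintro ⟨ω, hω, h⟩
      exact ⟨ω, hω, (funext fun i => (h i).2 (hk i)).symm⟩
    · rintro ⟨ω, hω, rfl⟩
      exact ⟨ω, hω, fun i => ⟨le_rfl, fun _ => rfl⟩⟩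
  rw [this]
  exact Set.Finite.isCompact_convexHull ℝ (Set.Finite.image _ (Finset.finite_toSet _))

open Classical in
theorem facePoly_FLoc {f : MvPolynomial (Fin 3) ℤ_[p]} (hf : f ≠ 0) (k : Vec) :
    facePoly f (FLoc f k) = ∑ a ∈ f.support.filter (fun a : Fin 3 →₀ ℕ => (⇑a : Vec) ∈ SS (supp f) k),
      monomial a (coeff a f) := by
  unfold facePoly
  apply Finset.sum_congr _ (fun _ _ => rfl)
  apply Finset.filter_congr
  intro a ha
  rw [FLoc_eq hf, ← vr_coe, vr_mem_GG_iff (mem_supp.mpr ⟨a, ha, rfl⟩)]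

end PartL

open MeasureTheory MvPolynomial

section PartM

variable {p : ℕ} [Fact p.Prime]

theorem FLoc_add_single {f : MvPolynomial (Fin 3) ℤ_[p]} (hf : f ≠ 0) {u : Vec} {l : Fin 3}
    (hl : u l = 0) {x : Fin 3 → ℝ} (hx : x ∈ FLoc f u) : x + Pi.single l (1:ℝ) ∈ FLoc f u := by
  have hx' := hx
  obtain ⟨h1, h2⟩ := hx
  have h3 : x + Pi.single l (1:ℝ) ∈ newtonPolyhedron f := by
    let Y : Set (Fin 3 → ℝ) := {x | x + Pi.single l (1:ℝ) ∈ newtonPolyhedron f}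
    suffices h : newtonPolyhedron f ⊆ Y from h h1
    conv_lhs => rw [newton_eq]
    apply convexHull_min
    · intro z hz
      simp only [Set.mem_iUnion] at hz
      obtain ⟨ω, hω, hz⟩ := hz
      refine mem_newton hω (fun i => ?_)
      have hi : vr ω i ≤ z i := hz i
      have : (0:ℝ) ≤ (Pi.single l (1:ℝ) : Fin 3 → ℝ) i := by
        rw [Pi.single_apply]; split_ifs <;> norm_num
      show vr ω i ≤ z i + _
      linarith
    · intro x hx y hy s t hs ht hst
      show s • x + t • y + Pi.single l (1:ℝ) ∈ newtonPolyhedron f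
      have hc : Convex ℝ (newtonPolyhedron f) := convex_convexHull ℝ _
      have := hc hx hy hs ht hst
      convert this using 1
      rw [smul_add, smul_add]
      have : (Pi.single l (1:ℝ) : Fin 3 → ℝ) = s • (Pi.single l (1:ℝ) : Fin 3 → ℝ) + t • (Pi.single l (1:ℝ) : Fin 3 → ℝ) := by
        rw [← add_smul, hst, one_smul]
      nth_rw 1 [this]
      abel
  refine ⟨h3, ?_⟩
  rw [dot3_add, h2]
  have : dot3 (intR (zv u)) (Pi.single l (1:ℝ)) = 0 := by
    simp [dot3, Pi.single_apply, intR, zv, hl]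
  rw [this, add_zero]

theorem ray_cross {A : Finset Vec} {u : Vec} (h : IsRay A u) (D : Set (Fin 3 → ℤ))
    (hD1 : ∀ l, u l = 0 → Pi.single l 1 ∈ D)
    (hD2 : ∀ ω ∈ SS A u, ∀ ω' ∈ SS A u, zv ω - zv ω' ∈ D) :
    ∃ d ∈ D, ∃ d' ∈ D, ¬ (d 1 * d' 2 = d 2 * d' 1 ∧ d 2 * d' 0 = d 0 * d' 2 ∧ d 0 * d' 1 = d 1 * d' 0) := by
  by_contra hcon
  push Not at hcon
  have hsg := sg_pos h.1
  have key : ∀ w : Fin 3 → ℤ, (∀ d ∈ D, zz d w = 0) → ∀ l, (sg u : ℤ) * w l = zs w * u l := by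
    intro w hw
    refine h.2.2 w (fun l hl => ?_) (fun ω hω ω' hω' => ?_)
    · have := hw _ (hD1 l hl); rwa [zz_single] at this
    · have := hw _ (hD2 ω hω ω' hω'); rw [zz_sub_left] at this; linarith
  have hsgz : (sg u : ℤ) ≠ 0 := by exact_mod_cast hsg.ne'
  by_cases hz : ∀ d ∈ D, d = 0
  · have k0 := key ![1,0,0] (fun d hd => by rw [hz d hd]; simp [zz])
    have k1 := key ![0,1,0] (fun d hd => by rw [hz d hd]; simp [zz])
    have a1 := k0 1
    have a2 := k0 2
    have b0 := k1 0
    simp [zs] at a1 a2 b0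
    apply h.1
    ext l
    fin_cases l
    · show u 0 = 0
      exact_mod_cast b0.symm
    · show u 1 = 0
      exact_mod_cast a1.symm
    · show u 2 = 0
      exact_mod_cast a2.symm
  · push Not at hz
    obtain ⟨d, hd, hd0⟩ := hz
    have hc := fun d' hd' => hcon d hd d' hd'
    have k0 := key ![0, d 2, - d 1] (fun d' hd' => by
      have := hc d' hd'; simp [zz]; linarith [this.1])
    have k1 := key ![- d 2, 0, d 0] (fun d' hd' => by
      have := hc d' hd'; simp [zz]; linarith [this.2.1])
    have k2 := key ![d 1, - d 0, 0] (fun d' hd' => by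
      have := hc d' hd'; simp [zz]; linarith [this.2.2])
    have k01 : (sg u : ℤ) * d 2 = (0 + d 2 + - d 1) * u 1 := k0 1
    have k10 : (sg u : ℤ) * (- d 2) = (- d 2 + 0 + d 0) * u 0 := k1 0
    have k11 : (sg u : ℤ) * 0 = (- d 2 + 0 + d 0) * u 1 := k1 1
    have k12 : (sg u : ℤ) * d 0 = (- d 2 + 0 + d 0) * u 2 := k1 2
    have k02 : (sg u : ℤ) * (- d 1) = (0 + d 2 + - d 1) * u 2 := k0 2
    have k21 : (sg u : ℤ) * (- d 0) = (d 1 + - d 0 + 0) * u 1 := k2 1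
    have k22 : (sg u : ℤ) * 0 = (d 1 + - d 0 + 0) * u 2 := k2 2
    have cz : ∀ x : ℤ, (sg u : ℤ) * x = 0 → x = 0 := fun x hx => (mul_eq_zero.mp hx).resolve_left hsgz
    rw [mul_zero, eq_comm, mul_eq_zero] at k11
    apply hd0
    rcases k11 with e | e
    · rw [e, zero_mul] at k10 k12
      have q0 := cz _ k12
      have q2 := cz _ k10
      have q2' : d 2 = 0 := by linarith
      rw [q2'] at k02
      rw [q0] at k22
      have q1 := cz (d 1) (by linarith)
      ext l; fin_cases l
      · exact q0
      · exact q1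
      · exact q2'
    · rw [e, mul_zero] at k01 k21
      have q2 := cz _ k01
      have q0' := cz _ k21
      have q0 : d 0 = 0 := by linarith
      rw [q0] at k22
      rw [q2] at k02
      have q1 := cz (d 1) (by linarith)
      ext l; fin_cases l
      · exact q0
      · exact q1
      · exact q2

noncomputable def dotL (k : Fin 3 → ℝ) : (Fin 3 → ℝ) →ₗ[ℝ] ℝ where
  toFun := dot3 k
  map_add' := dot3_add k
  map_smul' c x := dot3_smul k x c

theorem FLoc_facet {f : MvPolynomial (Fin 3) ℤ_[p]} (hf : f ≠ 0) {u : Vec}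
    (h : IsRay (supp f) u) : IsFacetOf f (FLoc f u) := by
  refine ⟨FLoc_face h.1, le_antisymm ?_ ?_⟩
  · have h1 : vectorSpan ℝ (FLoc f u) ≤ LinearMap.ker (dotL (vr u)) := by
      unfold vectorSpan
      rw [Submodule.span_le]
      rintro _ ⟨x, hx, y, hy, rfl⟩
      show dotL (vr u) (x - y) = 0
      rw [map_sub]
      show dot3 (intR (zv u)) x - dot3 (intR (zv u)) y = 0
      rw [hx.2, hy.2, sub_self]
    have h2 := Submodule.finrank_mono h1
    have h3 := LinearMap.finrank_range_add_finrank_ker (dotL (vr u))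
    have h4 : LinearMap.range (dotL (vr u)) ≠ ⊥ := by
      rw [Ne, LinearMap.range_eq_bot]
      intro h0
      apply h.1
      ext l
      have := LinearMap.congr_fun h0 (Pi.single l 1)
      have e : dot3 (vr u) (Pi.single l (1:ℝ)) = 0 := this
      simp [dot3, Pi.single_apply, vr_apply] at e
      exact e
    have h5 : 0 < Module.finrank ℝ (LinearMap.range (dotL (vr u))) := by
      rw [Module.finrank_pos_iff]
      exact (Submodule.nontrivial_iff_ne_bot).mpr h4
    have h6 : Module.finrank ℝ (Fin 3 → ℝ) = 3 := by simp
    omega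
  · let V := vectorSpan ℝ (FLoc f u)
    obtain ⟨a, ha⟩ := SS_nonempty (supp_nonempty hf) u
    have hmem : ∀ {ω}, ω ∈ SS (supp f) u → vr ω ∈ FLoc f u := fun hω => by
      rw [FLoc_eq hf]; exact vr_mem_GG hω
    obtain ⟨d, hd, d', hd', hne⟩ := ray_cross h {d | intR d ∈ V}
      (by
        intro l hl
        have h1 := vsub_mem_vectorSpan ℝ (FLoc_add_single hf hl (hmem ha)) (hmem ha)
        have e : intR (Pi.single l 1) = (vr a + Pi.single l (1:ℝ)) -ᵥ vr a := by
          ext i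
          simp [intR, Pi.single_apply]
        show intR _ ∈ V
        rw [e]; exact h1)
      (by
        intro ω hω ω' hω'
        have h1 := vsub_mem_vectorSpan ℝ (hmem hω) (hmem hω')
        have e : intR (zv ω - zv ω') = vr ω -ᵥ vr ω' := by
          ext i
          simp [intR, vr]
        show intR _ ∈ V
        rw [e]; exact h1)
    have hli : LinearIndependent ℝ ![(⟨intR d, hd⟩ : V), ⟨intR d', hd'⟩] := by
      rw [LinearIndependent.pair_iff]
      intro s t hst
      have hst' : s • intR d + t • intR d' = 0 := congrArg Subtype.val hst
      have e : ∀ i, s * (d i : ℝ) + t * (d' i : ℝ) = 0 := fun i => by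
        have := congrFun hst' i
        simpa [intR] using this
      by_contra hc
      apply hne
      have g : ∀ i j, d i * d' j = d j * d' i := by
        intro i j
        have hi := e i
        have hj := e j
        by_cases hs : s = 0
        · have ht : t ≠ 0 := fun ht => hc ⟨hs, ht⟩
          simp [hs, ht] at hi hj
          simp [hi, hj]
        · have : s * ((d i : ℝ) * d' j - d j * d' i) = 0 := by linear_combination (d' j : ℝ) * hi - (d' i : ℝ) * hj
          have h0 := (mul_eq_zero.mp this).resolve_left hs
          have h1 : (d i : ℝ) * d' j = d j * d' i := by linarith
          exact_mod_cast h1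
      exact ⟨g _ _, g _ _, g _ _⟩
    have := hli.fintype_card_le_finrank
    simpa using this

theorem FLoc_normal {f : MvPolynomial (Fin 3) ℤ_[p]} {u : Vec} (h : Prim u) :
    IsPrimNormal f (FLoc f u) (zv u) := by
  refine ⟨fun i => by simp [zv], ?_, rfl⟩
  have : Nat.gcd (u 0) (Nat.gcd (u 1) (u 2)) = 1 := h
  simpa [zv, Int.gcd] using this

theorem FLoc_contributes {f : MvPolynomial (Fin 3) ℤ_[p]} (hf : f ≠ 0) {u : Vec} {s₀ : ℂ}
    (h : u ∈ Bad (supp f) p ((p:ℂ)^(-s₀))) : Contributes p f (FLoc f u) s₀ := by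
  refine ⟨zv u, FLoc_normal h.1.2.1, ?_⟩
  have hp : (p:ℂ) ≠ 0 := by exact_mod_cast (Fact.out : p.Prime).ne_zero
  have hw : ((p:ℂ)⁻¹)^sg u * ((p:ℂ)^(-s₀))^mm (supp f) u = 1 := h.2
  have e1 : mval f (intR (zv u)) = mm (supp f) u := mval_eq hf u
  have e2 : sigma3 (zv u) = sg u := by simp [sigma3, zv, sg]
  rw [e1, e2]
  have : (p:ℂ) ^ (((sg u : ℤ) : ℂ) + (((mm (supp f) u : ℕ) : ℝ) : ℂ) * s₀) =
      (((p:ℂ)⁻¹)^sg u * ((p:ℂ)^(-s₀))^mm (supp f) u)⁻¹ := by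
    rw [Complex.cpow_add _ _ hp, mul_inv]
    congr 1
    · simp
    · push_cast
      rw [Complex.cpow_nat_mul, Complex.cpow_neg, inv_pow, inv_inv]
  rw [this, hw, inv_one]

theorem FLoc_bound {f : MvPolynomial (Fin 3) ℤ_[p]} (hf : f ≠ 0) {u : Vec} {i : Fin 3} (hi : 0 < u i)
    {Y : Set ℝ} (hY : Convex ℝ Y) (h : ∀ ω ∈ SS (supp f) u, ((ω i : ℕ) : ℝ) ∈ Y) {x : Fin 3 → ℝ}
    (hx : x ∈ FLoc f u) : x i ∈ Y := by
  rw [FLoc_eq hf] at hx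
  suffices hh : GG (supp f) u ⊆ {x | x i ∈ Y} from hh hx
  apply convexHull_min
  · intro z hz
    simp only [Set.mem_iUnion] at hz
    obtain ⟨ω, hω, hz⟩ := hz
    show z i ∈ Y
    rw [(hz i).2 hi, vr_apply]
    exact h ω hω
  · intro x hx y hy s t hs ht hst
    exact hY hx hy hs ht hst

theorem B1c_of_simplex {f : MvPolynomial (Fin 3) ℤ_[p]} (hf : f ≠ 0) {u : Vec} {i : Fin 3}
    (h : IsB1SimplexFor (FLoc f u) i) : B1c (supp f) u i := by
  obtain ⟨A, B, C, -, hτ, hA, hB, hC⟩ := h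
  have hmem : ∀ {ω}, ω ∈ SS (supp f) u → vr ω ∈ FLoc f u := fun hω => by
    rw [FLoc_eq hf]; exact vr_mem_GG hω
  have hbd : Bornology.IsBounded (FLoc f u) := by
    rw [hτ]
    exact ((Set.toFinite {A, B, C}).isCompact_convexHull ℝ).isBounded
  obtain ⟨a, ha⟩ := SS_nonempty (supp_nonempty hf) u
  have hu : ∀ l, 0 < u l := by
    intro l
    rw [Nat.pos_iff_ne_zero]
    intro hl
    obtain ⟨R, hR⟩ := hbd.exists_norm_le
    have hn : ∀ n : ℕ, vr a + Pi.single l (n:ℝ) ∈ FLoc f u := by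
      intro n
      induction n with
      | zero => simpa using hmem ha
      | succ n ih =>
        have := FLoc_add_single hf hl ih
        rw [add_assoc, ← Pi.single_add] at this
        exact_mod_cast this
    obtain ⟨n, hn'⟩ := exists_nat_gt R
    have h1 := hR _ (hn n)
    have h2 := norm_le_pi_norm (vr a + Pi.single l (n:ℝ)) l
    have h3 : (vr a + Pi.single l (n:ℝ) : Fin 3 → ℝ) l = a l + n := by simp [vr_apply]
    rw [h3] at h2
    have h4 : (a l + n : ℝ) ≤ ‖(a l + n : ℝ)‖ := le_abs_self _
    have h5 : (0:ℝ) ≤ a l := Nat.cast_nonneg _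
    linarith
  have hw : ∀ x ∈ FLoc f u, x i ≤ 1 ∧ (x i = 1 → x = C) := by
    intro x hx
    rw [hτ, convexHull_insert (by simp)] at hx
    simp only [convexJoin, Set.mem_iUnion, Set.mem_singleton_iff] at hx
    obtain ⟨_, rfl, y, hy, hxy⟩ := hx
    rw [convexHull_pair] at hy
    obtain ⟨s, t, hs, ht, hst, rfl⟩ := hy
    obtain ⟨s', t', hs', ht', hst', rfl⟩ := hxy
    simp only [Pi.add_apply, Pi.smul_apply, smul_eq_mul, hA, hB, hC]
    have e : s' * 0 + t' * (s * 0 + t * 1) = t' * t := by ring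
    rw [e]
    refine ⟨by nlinarith, fun he => ?_⟩
    have t1 : t' = 1 := by nlinarith
    have t2 : t = 1 := by nlinarith
    have t3 : s = 0 := by linarith
    have t4 : s' = 0 := by linarith
    simp [t1, t2, t3, t4]
  have hAm : A ∈ FLoc f u := by rw [hτ]; exact subset_convexHull ℝ _ (by simp)
  have hCm : C ∈ FLoc f u := by rw [hτ]; exact subset_convexHull ℝ _ (by simp)
  have hle : ∀ ω ∈ SS (supp f) u, ω i ≤ 1 := by
    intro ω hω
    have := (hw _ (hmem hω)).1
    rw [vr_apply] at this
    exact_mod_cast this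
  refine ⟨hu i, hle, ?_, ?_⟩
  · by_contra hcon
    push Not at hcon
    have := FLoc_bound hf (hu i) (convex_Ici (1:ℝ)) (fun ω hω => by
      have := hcon ω hω
      show (1:ℝ) ≤ _
      exact_mod_cast Nat.one_le_iff_ne_zero.mpr this) hAm
    rw [hA] at this
    have : (1:ℝ) ≤ 0 := this
    linarith
  · have : ∃ ω ∈ SS (supp f) u, ω i = 1 := by
      by_contra hcon
      push Not at hcon
      have := FLoc_bound hf (hu i) (convex_Iic (0:ℝ)) (fun ω hω => by
        have h1 := hcon ω hω
        have h2 := hle ω hω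
        have h3 : ω i ≤ 0 := by omega
        show _ ≤ (0:ℝ)
        exact_mod_cast h3) hCm
      rw [hC] at this
      have : (1:ℝ) ≤ 0 := this
      linarith
    obtain ⟨ω, hω, h1⟩ := this
    refine ⟨ω, hω, h1, fun D hD hD1 => ?_⟩
    have e1 := (hw _ (hmem hω)).2 (by rw [vr_apply, h1]; simp)
    have e2 := (hw _ (hmem hD)).2 (by rw [vr_apply, hD1]; simp)
    intro l
    have := congrFun (e1.trans e2.symm) l
    rw [vr_apply, vr_apply] at this
    have : ω l = D l := by exact_mod_cast this
    exact this.le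

theorem B1c_of_noncompact {f : MvPolynomial (Fin 3) ℤ_[p]} (hf : f ≠ 0) {u : Vec} {i : Fin 3}
    (h : IsNoncompactB1For (FLoc f u) i) : B1c (supp f) u i := by
  obtain ⟨j, hji, hnj, huniq, A, B, -, -, -, hA, hB, himg⟩ := h
  have hmem : ∀ {ω}, ω ∈ SS (supp f) u → vr ω ∈ FLoc f u := fun hω => by
    rw [FLoc_eq hf]; exact vr_mem_GG hω
  have hui : 0 < u i := by
    rw [Nat.pos_iff_ne_zero]
    intro hl
    exact hji (huniq i (fun x hx => FLoc_add_single hf hl hx)).symm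
  have hw : ∀ x ∈ FLoc f u, x i ≤ 1 ∧ (x i = 1 → Function.update x j 0 = B) := by
    intro x hx
    have hx1 : Function.update x j 0 ∈ convexHull ℝ {A, B} := by
      rw [← himg]; exact ⟨x, hx, rfl⟩
    have hxi : x i = Function.update x j (0:ℝ) i := by
      rw [Function.update_of_ne hji.symm]
    rw [convexHull_pair] at hx1
    obtain ⟨s, t, hs, ht, hst, hx2⟩ := hx1
    rw [hxi, ← hx2]
    simp only [Pi.add_apply, Pi.smul_apply, smul_eq_mul, hA, hB]
    refine ⟨by linarith, fun he => ?_⟩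
    have t2 : t = 1 := by linarith
    have t3 : s = 0 := by linarith
    simp [t2, t3]
  have hAm : ∃ x ∈ FLoc f u, x i = 0 := by
    have : A ∈ convexHull ℝ {A, B} := subset_convexHull ℝ _ (by simp)
    rw [← himg] at this
    obtain ⟨x, hx, e⟩ := this
    refine ⟨x, hx, ?_⟩
    have := congrFun e i
    simp only [Function.update_of_ne hji.symm] at this
    rw [this, hA]
  have hCm : ∃ x ∈ FLoc f u, x i = 1 := by
    have : B ∈ convexHull ℝ {A, B} := subset_convexHull ℝ _ (by simp)
    rw [← himg] at this
    obtain ⟨x, hx, e⟩ := this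
    refine ⟨x, hx, ?_⟩
    have := congrFun e i
    simp only [Function.update_of_ne hji.symm] at this
    rw [this, hB]
  have hle : ∀ ω ∈ SS (supp f) u, ω i ≤ 1 := by
    intro ω hω
    have := (hw _ (hmem hω)).1
    rw [vr_apply] at this
    exact_mod_cast this
  refine ⟨hui, hle, ?_, ?_⟩
  · by_contra hcon
    push Not at hcon
    obtain ⟨x, hx, hx0⟩ := hAm
    have := FLoc_bound hf hui (convex_Ici (1:ℝ)) (fun ω hω => by
      have := hcon ω hω
      show (1:ℝ) ≤ _
      exact_mod_cast Nat.one_le_iff_ne_zero.mpr this) hx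
    rw [hx0] at this
    have : (1:ℝ) ≤ 0 := this
    linarith
  · have : ((SS (supp f) u).filter (fun ω => ω i = 1)).Nonempty := by
      by_contra hcon
      obtain ⟨x, hx, hx0⟩ := hCm
      have := FLoc_bound hf hui (convex_Iic (0:ℝ)) (fun ω hω => by
        have h1 : ω i ≠ 1 := fun h => hcon ⟨ω, Finset.mem_filter.mpr ⟨hω, h⟩⟩
        have h2 := hle ω hω
        have h3 : ω i ≤ 0 := by omega
        show _ ≤ (0:ℝ)
        exact_mod_cast h3) hx
      rw [hx0] at this
      have : (1:ℝ) ≤ 0 := this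
      linarith
    obtain ⟨ω, hω, hmin⟩ := Finset.exists_min_image _ (fun ω : Vec => ω j) this
    rw [Finset.mem_filter] at hω
    refine ⟨ω, hω.1, hω.2, fun D hD hD1 => ?_⟩
    have e1 := (hw _ (hmem hω.1)).2 (by rw [vr_apply, hω.2]; simp)
    have e2 := (hw _ (hmem hD)).2 (by rw [vr_apply, hD1]; simp)
    intro l
    by_cases hl : l = j
    · subst hl
      exact hmin D (Finset.mem_filter.mpr ⟨hD, hD1⟩)
    · have := congrFun (e1.trans e2.symm) l
      rw [Function.update_of_ne hl, Function.update_of_ne hl, vr_apply, vr_apply] at this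
      have : ω l = D l := by exact_mod_cast this
      exact this.le

theorem B1c_of_B1 {f : MvPolynomial (Fin 3) ℤ_[p]} (hf : f ≠ 0) {u : Vec} {i : Fin 3}
    (h : IsB1For (FLoc f u) i) : B1c (supp f) u i :=
  h.elim (B1c_of_simplex hf) (B1c_of_noncompact hf)

theorem adj_two {f : MvPolynomial (Fin 3) ℤ_[p]} (hf : f ≠ 0) {u u' : Vec}
    (h : Adj (supp f) u u') : ¬ (FLoc f u ∩ FLoc f u').Subsingleton := by
  have hmem : ∀ {u ω}, ω ∈ SS (supp f) u → vr ω ∈ FLoc f u := fun hω => by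
    rw [FLoc_eq hf]; exact vr_mem_GG hω
  intro hs
  obtain ⟨a, ha, ha', h⟩ := h
  rcases h with ⟨ω, hω, hω', hne⟩ | ⟨l, hl, hl'⟩
  · have := hs ⟨hmem ha, hmem ha'⟩ ⟨hmem hω, hmem hω'⟩
    apply hne
    ext l
    have := congrFun this l
    rw [vr_apply, vr_apply] at this
    exact_mod_cast this.symm
  · have := hs ⟨hmem ha, hmem ha'⟩ ⟨FLoc_add_single hf hl (hmem ha), FLoc_add_single hf hl' (hmem ha')⟩
    have := congrFun this l
    simp at this

theorem geom_var {f : MvPolynomial (Fin 3) ℤ_[p]} (hf : f ≠ 0) {s₀ : ℂ}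
    (hB1 : ∀ τ : Set (Fin 3 → ℝ), IsFacetOf f τ → Contributes p f τ s₀ → IsB1Facet τ)
    (hpairs : ∀ τ τ' : Set (Fin 3 → ℝ), IsFacetOf f τ → IsFacetOf f τ' →
      Contributes p f τ s₀ → Contributes p f τ' s₀ →
      (∃ i, IsB1For τ i ∧ IsB1For τ' i) ∨ (τ ∩ τ').Subsingleton) :
    ∃ var : Vec → Fin 3, (∀ u ∈ Bad (supp f) p ((p:ℂ)^(-s₀)), B1c (supp f) u (var u)) ∧
      ∀ u ∈ Bad (supp f) p ((p:ℂ)^(-s₀)), ∀ u' ∈ Bad (supp f) p ((p:ℂ)^(-s₀)),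
        Adj (supp f) u u' → var u = var u' := by
  have hp : 2 ≤ p := (Fact.out : p.Prime).two_le
  refine exists_var _ (fun u hu => hu.1) (fun u hu => Bad.mm_ne hp hu) (fun u hu => ?_)
    (fun u hu u' hu' hadj => ?_)
  · obtain ⟨i, hi⟩ := hB1 _ (FLoc_facet hf hu.1) (FLoc_contributes hf hu)
    exact ⟨i, B1c_of_B1 hf hi⟩
  · rcases hpairs _ _ (FLoc_facet hf hu.1) (FLoc_facet hf hu'.1) (FLoc_contributes hf hu)
      (FLoc_contributes hf hu') with ⟨i, h1, h2⟩ | h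
    · exact ⟨i, B1c_of_B1 hf h1, B1c_of_B1 hf h2⟩
    · exact absurd h (adj_two hf hadj)

end PartM

open MeasureTheory MvPolynomial

section PartN

variable {p : ℕ} [Fact p.Prime]

theorem norm_lt_one_iff_toZMod (x : ℤ_[p]) : ‖x‖ < 1 ↔ PadicInt.toZMod x = 0 := by
  rw [← RingHom.mem_ker, PadicInt.ker_toZMod, IsLocalRing.mem_maximalIdeal, mem_nonunits_iff,
    PadicInt.not_isUnit_iff]

open Classical in
/-- the part of `f` with exponents in `S` -/
noncomputable def fpoly (f : MvPolynomial (Fin 3) ℤ_[p]) (S : Finset Vec) : MvPolynomial (Fin 3) ℤ_[p] :=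
  ∑ a ∈ f.support.filter (fun a : Fin 3 →₀ ℕ => (⇑a : Vec) ∈ S), monomial a (coeff a f)

theorem facePoly_fpoly {f : MvPolynomial (Fin 3) ℤ_[p]} (hf : f ≠ 0) (k : Vec) :
    facePoly f (FLoc f k) = fpoly f (SS (supp f) k) := facePoly_FLoc hf k

/-- reduction mod p of `f_S` evaluated at units -/
noncomputable def rS (f : MvPolynomial (Fin 3) ℤ_[p]) (S : Finset Vec) (x : Fin 3 → ZMod p) : ZMod p :=
  eval x (map PadicInt.toZMod (fpoly f S))

open Classical in
noncomputable def NS (f : MvPolynomial (Fin 3) ℤ_[p]) (S : Finset Vec) : ℕ :=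
  (Finset.univ.filter (fun x : Fin 3 → (ZMod p)ˣ => rS f S (fun i => (x i : ZMod p)) = 0)).card

noncomputable def ellS (f : MvPolynomial (Fin 3) ℤ_[p]) (S : Finset Vec) : Polynomial ℂ :=
  Polynomial.C (((p:ℂ)⁻¹)^3) * (Polynomial.C (((p:ℂ)-1)^3) * (Polynomial.C (p:ℂ) - Polynomial.X)
    - Polynomial.C ((NS f S : ℂ) * p) * (1 - Polynomial.X))

theorem ellS_eval (f : MvPolynomial (Fin 3) ℤ_[p]) (S : Finset Vec) (T : ℂ) :
    (ellS f S).eval T = ((p:ℂ)⁻¹)^3 * (((p:ℂ)-1)^3 * (p - T) - NS f S * p * (1 - T)) := by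
  simp [ellS]

theorem rS_eq (f : MvPolynomial (Fin 3) ℤ_[p]) (S : Finset Vec) (hS : S ⊆ supp f) (x : Fin 3 → ZMod p) :
    rS f S x = ∑ ω ∈ S, PadicInt.toZMod (coeff (Finsupp.equivFunOnFinite.symm ω) f) * ∏ i, x i ^ ω i := by
  classical
  unfold rS fpoly
  rw [map_sum, map_sum]
  refine Finset.sum_bij (fun a _ => (⇑a : Vec)) ?_ ?_ ?_ ?_
  · intro a ha; exact (Finset.mem_filter.mp ha).2
  · intro a _ b _ h; exact DFunLike.coe_injective h
  · intro ω hω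
    obtain ⟨a, ha, rfl⟩ := mem_supp.mp (hS hω)
    exact ⟨a, Finset.mem_filter.mpr ⟨ha, hω⟩, rfl⟩
  · intro a _
    have : Finsupp.equivFunOnFinite.symm (⇑a : Vec) = a := by ext i; simp
    rw [this, map_monomial, eval_monomial, Finsupp.prod_fintype _ _ (by simp)]

theorem unit_coeff {f : MvPolynomial (Fin 3) ℤ_[p]} (hf : f ≠ 0) (hnd : IsNonDegenerateModP f)
    {k C : Vec} (hk : VPos k) (h : SS (supp f) k = {C}) :
    PadicInt.toZMod (coeff (Finsupp.equivFunOnFinite.symm C) f) ≠ 0 := by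
  classical
  intro h0
  have hk0 : k ≠ 0 := fun h => by have := hk 0; simp [h] at this
  refine hnd (FLoc f k) (FLoc_face hk0) (FLoc_compact hf hk) ⟨fun _ => 1, fun i => by simp, ?_, ?_⟩
  · rw [norm_lt_one_iff_toZMod, facePoly_fpoly hf, h, fpoly, map_sum, map_sum]
    apply Finset.sum_eq_zero
    intro a ha
    have hC : (⇑a : Vec) = C := by simpa using (Finset.mem_filter.mp ha).2
    have : Finsupp.equivFunOnFinite.symm (⇑a : Vec) = a := by ext i; simp
    rw [← hC, this] at h0
    rw [eval_monomial, map_mul, h0, zero_mul]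
  · intro i
    rw [norm_lt_one_iff_toZMod, facePoly_fpoly hf, h, fpoly, map_sum, map_sum, map_sum]
    apply Finset.sum_eq_zero
    intro a ha
    have hC : (⇑a : Vec) = C := by simpa using (Finset.mem_filter.mp ha).2
    have : Finsupp.equivFunOnFinite.symm (⇑a : Vec) = a := by ext i; simp
    rw [← hC, this] at h0
    rw [pderiv_monomial, eval_monomial, map_mul, map_mul, h0, zero_mul, zero_mul]

theorem card_units3 : Fintype.card (Fin 3 → (ZMod p)ˣ) = (p-1)^3 := by
  rw [Fintype.card_fun, Fintype.card_fin, ZMod.card_units_eq_totient, Nat.totient_prime Fact.out]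

theorem ellS_one {f : MvPolynomial (Fin 3) ℤ_[p]} (hf : f ≠ 0) (hnd : IsNonDegenerateModP f)
    (C k : Vec) (hk : VPos k) (h : SS (supp f) k = {C}) (T : ℂ) :
    (ellS f {C}).eval T = ((p:ℂ)⁻¹)^2*((p:ℂ)-1)^3*(1 - (p:ℂ)⁻¹*T) := by
  have hp : (p:ℂ) ≠ 0 := by exact_mod_cast (Fact.out : p.Prime).ne_zero
  have hu := unit_coeff hf hnd hk h
  have hN : NS f {C} = 0 := by
    classical
    unfold NS
    rw [Finset.card_eq_zero, Finset.filter_eq_empty_iff]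
    intro x _
    have hC : C ∈ supp f := SS_sub (k := k) (by rw [h]; simp)
    rw [rS_eq f _ (by simpa using hC), Finset.sum_singleton]
    refine mul_ne_zero hu (Finset.prod_ne_zero_iff.mpr fun i _ => pow_ne_zero _ (Units.ne_zero _))
  rw [ellS_eval, hN]
  field_simp
  simp

theorem exists_isolating {A : Finset Vec} {i : Fin 3} {C k : Vec} (hk : VPos k) (hC : C ∈ SS A k)
    (hCi : C i = 1) (ho : ∀ ω ∈ SS A k, ω ≠ C → ω i = 0) : ∃ k', VPos k' ∧ SS A k' = {C} := by
  let N := A.sup (fun ω => ω i) + 2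
  let k' : Vec := fun l => N * k l - (Pi.single i 1 : Vec) l
  have hk' : ∀ l, k' l + (Pi.single i 1 : Vec) l = N * k l ∧ 0 < k' l := by
    intro l
    have h1 : (Pi.single i 1 : Vec) l ≤ 1 := by rw [Pi.single_apply]; split_ifs <;> omega
    have h2 : 2 ≤ N * k l := by
      have h3 : 2 ≤ N := by simp only [N]; omega
      have h4 : 1 ≤ k l := hk l
      nlinarith
    simp only [k']
    omega
  have hd : ∀ ω, dp k' ω + ω i = N * dp k ω := by
    intro ω
    rw [← dp_nsmul, ← dp_single i ω, ← dp_add]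
    congr 1
    ext l
    simpa using (hk' l).1
  refine ⟨k', fun l => (hk' l).2, ?_⟩
  have hlt : ∀ ω ∈ A, ω ≠ C → dp k' C < dp k' ω := by
    intro ω hω hne
    have h1 := hd ω
    have h2 := hd C
    rw [hCi] at h2
    have h3 : ω i ≤ A.sup (fun ω => ω i) := Finset.le_sup (f := fun ω : Vec => ω i) hω
    by_cases hS : ω ∈ SS A k
    · have h4 := ho ω hS hne
      have h5 := (mem_SS_iff_eq hC hω).mp hS
      rw [h5] at h1
      omega
    · have h4 := (mem_SS.mp hC).2 ω hω
      have h5 : dp k ω ≠ dp k C := fun h => hS ((mem_SS_iff_eq hC hω).mpr h)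
      have h6 : dp k C + 1 ≤ dp k ω := by omega
      have h7 : N * (dp k C + 1) ≤ N * dp k ω := Nat.mul_le_mul_left _ h6
      have h8 : N = A.sup (fun ω => ω i) + 2 := rfl
      rw [mul_add, mul_one] at h7
      omega
  ext ω
  rw [Finset.mem_singleton]
  constructor
  · intro h
    by_contra hne
    have := hlt ω (SS_sub h) hne
    have := (mem_SS.mp h).2 C (SS_sub hC)
    omega
  · rintro rfl
    refine mem_SS.mpr ⟨SS_sub hC, fun ω' hω' => ?_⟩
    by_cases h : ω' = ω
    · rw [h]
    · exact (hlt ω' hω' h).le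

theorem sum_mul_shift {G : Type*} [Group G] [Fintype G] (g : G) (Q : G → ℕ) :
    ∑ x, Q (g * x) = ∑ x, Q x :=
  Fintype.sum_equiv (Equiv.mulLeft g) _ _ (fun _ => rfl)

open Classical in
theorem NS_count (f : MvPolynomial (Fin 3) ℤ_[p]) (S : Finset Vec) (hS : S ⊆ supp f) (i : Fin 3)
    (C : Vec) (hC : C ∈ S) (hCi : C i = 1) (ho : ∀ ω ∈ S, ω ≠ C → ω i = 0)
    (hu : PadicInt.toZMod (coeff (Finsupp.equivFunOnFinite.symm C) f) ≠ 0) :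
    (p - 1) * NS f S + NS f (S.erase C) = (p-1)^3 := by
  set c := PadicInt.toZMod (coeff (Finsupp.equivFunOnFinite.symm C) f) with hc
  let sc : (ZMod p)ˣ → (Fin 3 → (ZMod p)ˣ) → (Fin 3 → (ZMod p)ˣ) := fun t x =>
    Pi.mulSingle i t * x
  have hsplit : ∀ t x, rS f S (fun l => (sc t x l : ZMod p)) =
      rS f (S.erase C) (fun l => (x l : ZMod p)) + t * (c * ∏ l, (x l : ZMod p) ^ C l) := by
    intro t x
    rw [rS_eq f S hS, rS_eq f _ ((Finset.erase_subset _ _).trans hS), ← Finset.add_sum_erase _ _ hC,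
      add_comm]
    have e : ∀ ω : Vec, ∏ l, (sc t x l : ZMod p) ^ ω l = (t:ZMod p) ^ ω i * ∏ l, (x l : ZMod p) ^ ω l := by
      intro ω
      simp only [sc, Pi.mul_apply, Units.val_mul, mul_pow, Finset.prod_mul_distrib]
      congr 1
      rw [Finset.prod_eq_single i]
      · simp
      · intro l _ hl; simp [hl]
      · simp
    congr 1
    · apply Finset.sum_congr rfl
      intro ω hω
      rw [Finset.mem_erase] at hω
      rw [e, ho ω hω.2 hω.1]; simp
    · rw [e, hCi, ← hc]; ring
  have h1 : ∑ t : (ZMod p)ˣ, ∑ x : Fin 3 → (ZMod p)ˣ, (if rS f S (fun l => (sc t x l : ZMod p)) = 0 then 1 else 0)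
      = (p-1) * NS f S := by
    have : ∀ t : (ZMod p)ˣ, ∑ x : Fin 3 → (ZMod p)ˣ,
        (if rS f S (fun l => (sc t x l : ZMod p)) = 0 then 1 else 0) = NS f S := by
      intro t
      rw [NS, Finset.card_filter]
      have key := sum_mul_shift (Pi.mulSingle i t : Fin 3 → (ZMod p)ˣ)
        (fun y => if rS f S (fun l => (y l : ZMod p)) = 0 then 1 else 0)
      convert key
    rw [Finset.sum_congr rfl (fun t _ => this t), Finset.sum_const, Finset.card_univ,
      ZMod.card_units_eq_totient, Nat.totient_prime Fact.out, smul_eq_mul]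
  rw [Finset.sum_comm] at h1
  have h2 : ∀ x : Fin 3 → (ZMod p)ˣ,
      ∑ t : (ZMod p)ˣ, (if rS f S (fun l => (sc t x l : ZMod p)) = 0 then 1 else 0)
        + (if rS f (S.erase C) (fun l => (x l : ZMod p)) = 0 then 1 else 0) = 1 := by
    intro x
    have hb : c * ∏ l, (x l : ZMod p) ^ C l ≠ 0 :=
      mul_ne_zero hu (Finset.prod_ne_zero_iff.mpr fun i _ => pow_ne_zero _ (Units.ne_zero _))
    simp only [hsplit]
    set α := rS f (S.erase C) (fun l => (x l : ZMod p))
    set β := c * ∏ l, (x l : ZMod p) ^ C l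
    by_cases hα : α = 0
    · simp [hα, hb]
    · have hγ : -α / β ≠ 0 := div_ne_zero (neg_ne_zero.mpr hα) hb
      rw [if_neg hα, add_zero, Finset.sum_eq_single (Units.mk0 _ hγ)]
      · rw [if_pos]
        simp [hb]
      · intro t _ ht
        rw [if_neg]
        intro h0
        apply ht
        ext
        simp only [Units.val_mk0]
        field_simp
        linear_combination h0
      · simp
  have h3 := Finset.sum_congr (rfl : (Finset.univ : Finset (Fin 3 → (ZMod p)ˣ)) = _) (fun x _ => h2 x)
  rw [Finset.sum_add_distrib, h1, Finset.sum_const, Finset.card_univ, card_units3, ← Finset.card_filter] at h3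
  simpa [NS] using h3

theorem ellS_two {f : MvPolynomial (Fin 3) ℤ_[p]} (hf : f ≠ 0) (hnd : IsNonDegenerateModP f)
    (i : Fin 3) (C k : Vec) (hk : VPos k) (hC : C ∈ SS (supp f) k) (hCi : C i = 1)
    (ho : ∀ ω ∈ SS (supp f) k, ω ≠ C → ω i = 0) (T : ℂ) :
    (ellS f (SS (supp f) k)).eval T + ((p:ℂ)-1)⁻¹ * (ellS f ((SS (supp f) k).erase C)).eval T
      = ((p:ℂ)⁻¹)^2*((p:ℂ)-1)^3 := by
  have hp : (p:ℂ) ≠ 0 := by exact_mod_cast (Fact.out : p.Prime).ne_zero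
  have h2 : 2 ≤ p := (Fact.out : p.Prime).two_le
  have hp1 : (p:ℂ) - 1 ≠ 0 := by
    rw [sub_ne_zero]
    intro h
    have : p = 1 := by exact_mod_cast h
    omega
  obtain ⟨k', hk', hS'⟩ := exists_isolating hk hC hCi ho
  have hN := NS_count f _ (fun ω h => SS_sub h) i C hC hCi ho (unit_coeff hf hnd hk' hS')
  have hN' : ((p:ℂ) - 1) * NS f (SS (supp f) k) + NS f ((SS (supp f) k).erase C) = ((p:ℂ)-1)^3 := by
    have := congrArg (Nat.cast : ℕ → ℂ) hN
    push_cast [Nat.cast_sub (by omega : 1 ≤ p)] at this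
    exact this
  have e : (NS f ((SS (supp f) k).erase C) : ℂ) = ((p:ℂ)-1)^3 - ((p:ℂ) - 1) * NS f (SS (supp f) k) := by
    linear_combination hN'
  rw [ellS_eval, ellS_eval, e]
  field_simp
  ring

end PartN

open MeasureTheory MvPolynomial

section PartO

variable {p : ℕ} [Fact p.Prime]

theorem taylor_one {R : Type*} [CommRing R] (g : MvPolynomial (Fin 3) R) (u : Fin 3 → R) (i : Fin 3) (t : R) :
    ∃ r, eval (u + Pi.single i t) g = eval u g + t * eval u (pderiv i g) + t ^ 2 * r := by
  induction g using MvPolynomial.induction_on with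
  | C a => exact ⟨0, by simp⟩
  | add g h hg hh =>
    obtain ⟨r, hr⟩ := hg
    obtain ⟨r', hr'⟩ := hh
    refine ⟨r + r', ?_⟩
    rw [map_add, hr, hr', map_add, map_add, map_add]; ring
  | mul_X g j hg =>
    obtain ⟨r, hr⟩ := hg
    by_cases hj : j = i
    · subst hj
      refine ⟨eval u (pderiv j g) + r * (u j + t), ?_⟩
      simp only [map_mul, hr, eval_X, Pi.add_apply, Pi.single_eq_same, Derivation.leibniz, pderiv_X_self, smul_eq_mul, map_add, map_one]
      ring
    · refine ⟨r * u j, ?_⟩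
      simp only [map_mul, hr, eval_X, Pi.add_apply, Pi.single_eq_of_ne hj, Derivation.leibniz, pderiv_X_of_ne hj, smul_eq_mul, map_add, map_zero]
      ring

/-- residue of a vector -/
noncomputable def res (x : Fin 3 → ℤ_[p]) : Fin 3 → ZMod p := fun i => PadicInt.toZMod (x i)

theorem res_add (x y : Fin 3 → ℤ_[p]) : res (x + y) = res x + res y := by
  ext i; simp [res]

theorem toZMod_eval (g : MvPolynomial (Fin 3) ℤ_[p]) (x : Fin 3 → ℤ_[p]) :
    PadicInt.toZMod (eval x g) = eval (res x) (map PadicInt.toZMod g) := map_eval _ _ _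

noncomputable def lift3 (c : Fin 3 → ZMod p) : Fin 3 → ℤ_[p] := fun i => ((c i).val : ℤ_[p])

theorem res_lift3 (c : Fin 3 → ZMod p) : res (lift3 c) = c := by
  ext i; simp [res, lift3]

theorem res_eq_iff (x y : Fin 3 → ℤ_[p]) : res x = res y ↔ ∀ i, ‖x i - y i‖ < 1 := by
  rw [funext_iff]
  refine forall_congr' fun i => ?_
  rw [norm_lt_one_iff_toZMod, map_sub, sub_eq_zero]; rfl

theorem isOpen_class (c : Fin 3 → ZMod p) : IsOpen {x : Fin 3 → ℤ_[p] | res x = c} := by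
  have : {x : Fin 3 → ℤ_[p] | res x = c} = ⋂ i, {x | ‖x i - lift3 c i‖ < 1} := by
    ext x
    simp only [Set.mem_iInter, Set.mem_ofPred_eq]
    rw [← res_eq_iff, res_lift3]
  rw [this]
  refine isOpen_iInter_of_finite fun i => isOpen_lt ?_ continuous_const
  fun_prop

theorem dvd_iff_norm (x : ℤ_[p]) (n : ℕ) : (p:ℤ_[p])^n ∣ x ↔ ‖x‖ ≤ (p:ℝ)^(-(n:ℤ)) := by
  rw [PadicInt.norm_le_pow_iff_mem_span_pow, Ideal.mem_span_singleton]

variable [MeasurableSpace ℤ_[p]] [BorelSpace ℤ_[p]]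

theorem meas_class (c : Fin 3 → ZMod p) : MeasurableSet {x : Fin 3 → ℤ_[p] | res x = c} :=
  (isOpen_class c).measurableSet

theorem measure_class (μ : Measure (Fin 3 → ℤ_[p])) [μ.IsAddHaarMeasure] (hμ : μ Set.univ = 1)
    (c : Fin 3 → ZMod p) : μ {x | res x = c} = ((p:ENNReal)^3)⁻¹ := by
  have h0 : ∀ c c' : Fin 3 → ZMod p, μ {x | res x = c} = μ {x | res x = c'} := by
    intro c c'
    rw [← measure_preimage_add_right μ (lift3 c' - lift3 c) {x | res x = c'}]
    congr 1
    ext x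
    simp only [Set.mem_ofPred_eq, Set.mem_preimage]
    have e : res (lift3 c' - lift3 c) = c' - c := by
      have := res_add (lift3 c' - lift3 c) (lift3 c)
      rw [sub_add_cancel, res_lift3, res_lift3] at this
      exact eq_sub_of_add_eq this.symm
    rw [res_add, e]
    constructor
    · rintro rfl; simp
    · intro h
      have := eq_sub_of_add_eq h
      rwa [sub_sub_cancel] at this
  have h1 : (⋃ c : Fin 3 → ZMod p, {x : Fin 3 → ℤ_[p] | res x = c}) = Set.univ := by
    ext x; simp
  have h2 := measure_iUnion (μ := μ) (f := fun c : Fin 3 → ZMod p => {x : Fin 3 → ℤ_[p] | res x = c})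
    (fun c c' hne => Set.disjoint_left.mpr fun x hx hx' => hne (hx.symm.trans hx'))
    (fun c => meas_class c)
  rw [h1, hμ, tsum_fintype, Finset.sum_congr rfl (fun c' _ => h0 c' c), Finset.sum_const,
    Finset.card_univ, Fintype.card_fun, Fintype.card_fin, ZMod.card, nsmul_eq_mul] at h2
  push_cast at h2
  exact ENNReal.eq_inv_of_mul_eq_one_left (by rw [mul_comm]; exact h2.symm)

/-- points in a class with `p^n ∣ g x` -/
def En (g : MvPolynomial (Fin 3) ℤ_[p]) (c : Fin 3 → ZMod p) (n : ℕ) : Set (Fin 3 → ℤ_[p]) :=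
  {x | res x = c ∧ (p:ℤ_[p])^n ∣ eval x g}

theorem meas_En (g : MvPolynomial (Fin 3) ℤ_[p]) (c : Fin 3 → ZMod p) (n : ℕ) :
    MeasurableSet (En g c n) := by
  refine (meas_class c).inter ?_
  have : {x : Fin 3 → ℤ_[p] | (p:ℤ_[p])^n ∣ eval x g} = {x | ‖eval x g‖ ≤ (p:ℝ)^(-(n:ℤ))} := by
    ext x; exact dvd_iff_norm _ _
  change MeasurableSet {x : Fin 3 → ℤ_[p] | (p:ℤ_[p])^n ∣ eval x g}
  rw [this]
  refine (isClosed_le ?_ continuous_const).measurableSet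
  exact (MvPolynomial.continuous_eval g).norm

theorem En_step (μ : Measure (Fin 3 → ℤ_[p])) [μ.IsAddHaarMeasure]
    (g : MvPolynomial (Fin 3) ℤ_[p]) (c : Fin 3 → ZMod p) (i : Fin 3)
    (hi : eval c (map PadicInt.toZMod (pderiv i g)) ≠ 0) (n : ℕ) (hn : 1 ≤ n) :
    μ (En g c n) = p * μ (En g c (n+1)) := by
  have hp0 : (p:ℤ_[p]) ≠ 0 := by exact_mod_cast (Fact.out : p.Prime).ne_zero
  have hpz : PadicInt.toZMod (p:ℤ_[p]) = 0 := by simp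
  let w : ZMod p → Fin 3 → ℤ_[p] := fun t => Pi.single i ((p:ℤ_[p])^n * (t.val : ℤ_[p]))
  have hw : ∀ t, res (w t) = 0 := by
    intro t
    ext l
    simp only [res, w, Pi.single_apply]
    split_ifs
    · simp [hpz, show n ≠ 0 by omega]
    · simp
  have key : ∀ x t, res x = c → ∀ b, eval x g = (p:ℤ_[p])^n * b →
      ((p:ℤ_[p])^(n+1) ∣ eval (x + w t) g ↔
        PadicInt.toZMod b + t * eval c (map PadicInt.toZMod (pderiv i g)) = 0) := by
    intro x t hx b hb
    obtain ⟨r, hr⟩ := taylor_one g x i ((p:ℤ_[p])^n * (t.val : ℤ_[p]))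
    have e : eval (x + w t) g = (p:ℤ_[p])^n * (b + (t.val : ℤ_[p]) * eval x (pderiv i g)
        + (p:ℤ_[p])^n * (t.val : ℤ_[p])^2 * r) := by
      rw [hr, hb]; ring
    rw [e, pow_succ, mul_dvd_mul_iff_left (pow_ne_zero _ hp0), ← PadicInt.norm_lt_one_iff_dvd,
      norm_lt_one_iff_toZMod]
    simp [hpz, show n ≠ 0 by omega, toZMod_eval, hx]
  have hU : En g c n = ⋃ t : ZMod p, (fun x => x + w t) ⁻¹' (En g c (n+1)) := by
    ext x
    simp only [Set.mem_iUnion, Set.mem_preimage]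
    constructor
    · rintro ⟨hx, b, hb⟩
      refine ⟨- PadicInt.toZMod b / eval c (map PadicInt.toZMod (pderiv i g)), ?_, ?_⟩
      · rw [res_add, hw, add_zero, hx]
      · rw [key x _ hx b hb]
        field_simp
        ring
    · rintro ⟨t, hx, hd⟩
      rw [res_add, hw, add_zero] at hx
      refine ⟨hx, ?_⟩
      obtain ⟨r, hr⟩ := taylor_one g x i ((p:ℤ_[p])^n * (t.val : ℤ_[p]))
      have h1 : (p:ℤ_[p])^n ∣ eval (x + w t) g := dvd_trans (pow_dvd_pow _ (by omega)) hd
      have e : eval x g = eval (x + w t) g - (p:ℤ_[p])^n * ((t.val : ℤ_[p]) * eval x (pderiv i g)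
        + (p:ℤ_[p])^n * (t.val : ℤ_[p])^2 * r) := by
        rw [hr]; ring
      rw [e]
      exact dvd_sub h1 (Dvd.intro _ rfl)
  have hsub : ∀ t x, x ∈ (fun x => x + w t) ⁻¹' (En g c (n+1)) → x ∈ En g c n := by
    intro t x hx
    rw [hU]; exact Set.mem_iUnion.mpr ⟨t, hx⟩
  have hm : ∀ t, MeasurableSet ((fun x => x + w t) ⁻¹' (En g c (n+1))) := fun t =>
    (measurable_add_const _) (meas_En g c (n+1))
  have hdj : Pairwise (Function.onFun Disjoint fun t => (fun x => x + w t) ⁻¹' (En g c (n+1))) := by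
    intro t t' hne
    refine Set.disjoint_left.mpr fun x hx hx' => hne ?_
    obtain ⟨hxc, b, hb⟩ := hsub t x hx
    have h1 := (key x t hxc b hb).mp hx.2
    have h2 := (key x t' hxc b hb).mp hx'.2
    have h3 : (t - t') * eval c (map PadicInt.toZMod (pderiv i g)) = 0 := by linear_combination h1 - h2
    have := (mul_eq_zero.mp h3).resolve_right hi
    exact sub_eq_zero.mp this
  conv_lhs => rw [hU]
  rw [measure_iUnion hdj hm, tsum_fintype]
  simp only [measure_preimage_add_right]
  rw [Finset.sum_const, Finset.card_univ, ZMod.card, nsmul_eq_mul]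

theorem En_one (g : MvPolynomial (Fin 3) ℤ_[p]) (c : Fin 3 → ZMod p)
    (h : eval c (map PadicInt.toZMod g) = 0) : En g c 1 = {x | res x = c} := by
  ext x
  simp only [En, Set.mem_ofPred_eq, pow_one, and_iff_left_iff_imp]
  intro hx
  rw [← PadicInt.norm_lt_one_iff_dvd, norm_lt_one_iff_toZMod, toZMod_eval, hx, h]

theorem En_measure (μ : Measure (Fin 3 → ℤ_[p])) [μ.IsAddHaarMeasure] (hμ : μ Set.univ = 1)
    (g : MvPolynomial (Fin 3) ℤ_[p]) (c : Fin 3 → ZMod p) (i : Fin 3)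
    (h : eval c (map PadicInt.toZMod g) = 0)
    (hi : eval c (map PadicInt.toZMod (pderiv i g)) ≠ 0) (n : ℕ) :
    μ.real (En g c (n+1)) = ((p:ℝ)⁻¹)^(n+3) := by
  have hp0 : (p:ℝ) ≠ 0 := by exact_mod_cast (Fact.out : p.Prime).ne_zero
  induction n with
  | zero =>
    rw [En_one g c h, Measure.real, measure_class μ hμ]
    simp
  | succ n ih =>
    have := En_step μ g c i hi (n+1) (by omega)
    have h2 : μ.real (En g c (n+1)) = p * μ.real (En g c (n+1+1)) := by
      simp [Measure.real, this]
    rw [ih] at h2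
    have : μ.real (En g c (n+1+1)) = (p:ℝ)⁻¹ * (p * μ.real (En g c (n+1+1))) := by
      field_simp
    rw [this, ← h2]; ring

end PartO

open MeasureTheory MvPolynomial

section PartP

variable {p : ℕ} [Fact p.Prime]

noncomputable def phi (g : MvPolynomial (Fin 3) ℤ_[p]) (s : ℂ) (x : Fin 3 → ℤ_[p]) : ℂ :=
  ((‖eval x g‖ : ℝ) : ℂ) ^ s

theorem powT (s : ℂ) (n : ℕ) :
    (((((p:ℝ)⁻¹) ^ n : ℝ)) : ℂ) ^ s = ((p:ℂ) ^ (-s)) ^ n := by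
  have hp : (0:ℝ) ≤ (p:ℝ)⁻¹ := by positivity
  induction n with
  | zero => simp
  | succ n ih =>
    rw [pow_succ, Complex.ofReal_mul, Complex.mul_cpow_ofReal_nonneg (by positivity) hp, ih, pow_succ]
    congr 1
    rw [Complex.ofReal_inv, Complex.ofReal_natCast, Complex.inv_cpow, Complex.cpow_neg]
    rw [Complex.natCast_arg]; exact Real.pi_ne_zero.symm

theorem norm_T_lt {s : ℂ} (hs : 0 < s.re) : ‖(p:ℂ) ^ (-s)‖ < 1 := by
  have hp : 1 < (p:ℝ) := by exact_mod_cast (Fact.out : p.Prime).one_lt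
  rw [Complex.norm_natCast_cpow_of_pos (Fact.out : p.Prime).pos]
  exact Real.rpow_lt_one_of_one_lt_of_neg hp (by simpa using hs)

theorem phi_norm_le {s : ℂ} (hs : 0 < s.re) (g : MvPolynomial (Fin 3) ℤ_[p]) (x : Fin 3 → ℤ_[p]) :
    ‖phi g s x‖ ≤ 1 := by
  rw [phi, Complex.norm_cpow_eq_rpow_re_of_nonneg (norm_nonneg _) hs.ne']
  exact Real.rpow_le_one (norm_nonneg _) (PadicInt.norm_le_one _) hs.le

theorem norm_eq_of_dvd {y : ℤ_[p]} {n : ℕ} (h1 : (p:ℤ_[p])^n ∣ y) (h2 : ¬ (p:ℤ_[p])^(n+1) ∣ y) :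
    ‖y‖ = ((p:ℝ)⁻¹)^n := by
  rw [dvd_iff_norm] at h1 h2
  push Not at h2
  have := PadicInt.norm_lt_pow_iff_norm_le_pow_sub_one y (-(n:ℤ))
  have h3 : ¬ ‖y‖ < (p:ℝ)^(-(n:ℤ)) := by
    rw [this]
    push Not
    convert h2 using 2
    push_cast; ring
  rw [le_antisymm h1 (not_lt.mp h3)]
  simp

variable [MeasurableSpace ℤ_[p]] [BorelSpace ℤ_[p]]

theorem phi_meas (g : MvPolynomial (Fin 3) ℤ_[p]) (s : ℂ) : Measurable (phi g s) := by
  have : Measurable (fun x : Fin 3 → ℤ_[p] => ‖eval x g‖) :=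
    (MvPolynomial.continuous_eval g).norm.measurable
  unfold phi
  fun_prop

theorem phi_int (μ : Measure (Fin 3 → ℤ_[p])) [IsFiniteMeasure μ] {s : ℂ} (hs : 0 < s.re)
    (g : MvPolynomial (Fin 3) ℤ_[p]) : Integrable (phi g s) μ :=
  Integrable.of_bound (phi_meas g s).aestronglyMeasurable 1 (Filter.Eventually.of_forall (phi_norm_le hs g))

theorem class_int_one (μ : Measure (Fin 3 → ℤ_[p])) [μ.IsAddHaarMeasure] (hμ : μ Set.univ = 1)
    (g : MvPolynomial (Fin 3) ℤ_[p]) (c : Fin 3 → ZMod p) (s : ℂ)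
    (h : eval c (map PadicInt.toZMod g) ≠ 0) :
    ∫ x in {x | res x = c}, phi g s x ∂μ = ((p:ℂ)⁻¹)^3 := by
  have : ∫ x in {x | res x = c}, phi g s x ∂μ = ∫ x in {x | res x = c}, (1:ℂ) ∂μ := by
    refine setIntegral_congr_fun (meas_class c) fun x hx => ?_
    have h1 : ‖eval x g‖ = 1 := by
      refine le_antisymm (PadicInt.norm_le_one _) (not_lt.mp fun hlt => h ?_)
      rw [norm_lt_one_iff_toZMod, toZMod_eval] at hlt
      rwa [show res x = c from hx] at hlt
    simp [phi, h1]
  rw [this, setIntegral_const, Measure.real, measure_class μ hμ]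
  simp

theorem class_int_two (μ : Measure (Fin 3 → ℤ_[p])) [μ.IsAddHaarMeasure] (hμ : μ Set.univ = 1)
    (g : MvPolynomial (Fin 3) ℤ_[p]) (c : Fin 3 → ZMod p) {s : ℂ} (hs : 0 < s.re) (i : Fin 3)
    (h : eval c (map PadicInt.toZMod g) = 0)
    (hi : eval c (map PadicInt.toZMod (pderiv i g)) ≠ 0) :
    (p - (p:ℂ)^(-s)) * ∫ x in {x | res x = c}, phi g s x ∂μ
      = ((p:ℂ)⁻¹)^3 * ((p - 1) * (p:ℂ)^(-s)) := by
  have : IsFiniteMeasure μ := ⟨by simp [hμ]⟩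
  have hp0 : (p:ℂ) ≠ 0 := by exact_mod_cast (Fact.out : p.Prime).ne_zero
  have hp1 : 1 < (p:ℝ) := by exact_mod_cast (Fact.out : p.Prime).one_lt
  set T := (p:ℂ)^(-s) with hT
  have hT1 : ‖T‖ < 1 := norm_T_lt hs
  let D : ℕ → Set (Fin 3 → ℤ_[p]) := fun n => En g c (n+1) \ En g c (n+2)
  have hsub : ∀ n, En g c (n+2) ⊆ En g c (n+1) := fun n x hx =>
    ⟨hx.1, dvd_trans (pow_dvd_pow _ (by omega)) hx.2⟩
  have hDm : ∀ n, MeasurableSet (D n) := fun n => (meas_En _ _ _).diff (meas_En _ _ _)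
  have hDn : ∀ n x, x ∈ D n → ‖eval x g‖ = ((p:ℝ)⁻¹)^(n+1) := by
    intro n x hx
    exact norm_eq_of_dvd hx.1.2 (fun hd => hx.2 ⟨hx.1.1, hd⟩)
  have hpinv : ((p:ℝ)⁻¹) < 1 := inv_lt_one_of_one_lt₀ hp1
  have hpi0 : 0 < ((p:ℝ)⁻¹) := by positivity
  have hdj : Pairwise (Function.onFun Disjoint D) := by
    intro n m hnm
    refine Set.disjoint_left.mpr fun x hx hx' => hnm ?_
    have := (hDn n x hx).symm.trans (hDn m x hx')
    have := pow_right_injective₀ hpi0 hpinv.ne this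
    omega
  have hU : ∫ x in {x | res x = c}, phi g s x ∂μ = ∫ x in ⋃ n, D n, phi g s x ∂μ := by
    refine setIntegral_eq_of_subset_of_forall_sdiff_eq_zero (meas_class c) ?_ ?_
    · exact Set.iUnion_subset fun n x hx => hx.1.1
    · rintro x ⟨hx, hx'⟩
      have hall : ∀ n, x ∈ En g c (n+1) := by
        intro n
        induction n with
        | zero => rw [zero_add, En_one g c h]; exact hx
        | succ n ih =>
          by_contra hc
          exact hx' (Set.mem_iUnion.mpr ⟨n, ih, hc⟩)
      have h0 : ‖eval x g‖ = 0 := by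
        refine le_antisymm ?_ (norm_nonneg _)
        refine ge_of_tendsto' (tendsto_pow_atTop_nhds_zero_of_lt_one hpi0.le hpinv) fun n => ?_
        have h3 := (dvd_iff_norm _ _).mp (hall n).2
        refine h3.trans ?_
        rw [zpow_neg, zpow_natCast, ← inv_pow]
        exact pow_le_pow_of_le_one hpi0.le hpinv.le (by omega)
      have hs0 : s ≠ 0 := by rintro rfl; simp at hs
      simp [phi, h0, hs0]
  have hsum := hasSum_integral_iUnion hDm hdj (f := phi g s) (μ := μ) (phi_int μ hs g).integrableOn
  have hterm : ∀ n, ∫ x in D n, phi g s x ∂μ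
      = (((p:ℂ)⁻¹)^3 * ((1 - (p:ℂ)⁻¹) * T)) * ((p:ℂ)⁻¹ * T)^n := by
    intro n
    have e1 : ∫ x in D n, phi g s x ∂μ = ∫ x in D n, T^(n+1) ∂μ := by
      refine setIntegral_congr_fun (hDm n) fun x hx => ?_
      simp only [phi]
      rw [hDn n x hx, powT]
    rw [e1, setIntegral_const, measureReal_sdiff (hsub n) (meas_En _ _ _), En_measure μ hμ g c i h hi,
      En_measure μ hμ g c i h hi (n+1), Complex.real_smul]
    push_cast
    rw [mul_pow]; ring
  have hq : ‖(p:ℂ)⁻¹ * T‖ < 1 := by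
    rw [norm_mul, norm_inv, Complex.norm_natCast]
    exact mul_lt_one_of_nonneg_of_lt_one_left hpi0.le hpinv hT1.le
  have hgeo := (hasSum_geometric_of_norm_lt_one hq).mul_left (((p:ℂ)⁻¹)^3 * ((1 - (p:ℂ)⁻¹) * T))
  rw [← show (fun n => ∫ x in D n, phi g s x ∂μ) = fun n => (((p:ℂ)⁻¹)^3 * ((1 - (p:ℂ)⁻¹) * T)) * ((p:ℂ)⁻¹ * T)^n
      from funext hterm] at hgeo
  have hI := hsum.unique hgeo
  have hne : (p:ℂ) - T ≠ 0 := by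
    intro h0
    have : ‖(p:ℂ)‖ < 1 := by rw [sub_eq_zero.mp h0]; exact hT1
    rw [Complex.norm_natCast] at this
    linarith
  have e : 1 - (p:ℂ)⁻¹ * T = (p - T) * (p:ℂ)⁻¹ := by field_simp
  rw [hU, hI, e, mul_inv, inv_inv]
  field_simp

theorem unit_set : {x : Fin 3 → ℤ_[p] | ∀ i, ‖x i‖ = 1} =
    ⋃ c : Fin 3 → (ZMod p)ˣ, {x | res x = fun i => (c i : ZMod p)} := by
  ext x
  simp only [Set.mem_iUnion, Set.mem_ofPred_eq]
  have key : ∀ i, ‖x i‖ = 1 ↔ PadicInt.toZMod (x i) ≠ 0 := by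
    intro i
    rw [Ne, ← norm_lt_one_iff_toZMod, not_lt]
    exact ⟨fun h => h.ge, fun h => le_antisymm (PadicInt.norm_le_one _) h⟩
  constructor
  · intro h
    refine ⟨fun i => Units.mk0 _ ((key i).mp (h i)), ?_⟩
    ext i; simp [res]
  · rintro ⟨c, hc⟩ i
    rw [key]
    have := congrFun hc i
    simp only [res] at this
    rw [this]; exact (c i).ne_zero

open Classical in
theorem unit_int (μ : Measure (Fin 3 → ℤ_[p])) [μ.IsAddHaarMeasure] (hμ : μ Set.univ = 1)
    (g : MvPolynomial (Fin 3) ℤ_[p]) {s : ℂ} (hs : 0 < s.re)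
    (hnd : ∀ c : Fin 3 → (ZMod p)ˣ, eval (fun i => (c i : ZMod p)) (map PadicInt.toZMod g) = 0 →
      ∃ i, eval (fun i => (c i : ZMod p)) (map PadicInt.toZMod (pderiv i g)) ≠ 0) :
    (p - (p:ℂ)^(-s)) * ∫ x in {x : Fin 3 → ℤ_[p] | ∀ i, ‖x i‖ = 1}, phi g s x ∂μ
      = ((p:ℂ)⁻¹)^3 * (((p:ℂ)-1)^3 * (p - (p:ℂ)^(-s)) -
        ((Finset.univ.filter (fun c : Fin 3 → (ZMod p)ˣ =>
          eval (fun i => (c i : ZMod p)) (map PadicInt.toZMod g) = 0)).card : ℂ) * p * (1 - (p:ℂ)^(-s))) := by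
  have : IsFiniteMeasure μ := ⟨by simp [hμ]⟩
  rw [unit_set, integral_iUnion_fintype (fun c => meas_class _)
    (fun c c' hne => Set.disjoint_left.mpr fun x hx hx' => hne (by
      have := (show res x = _ from hx).symm.trans hx'
      ext i; exact congrFun this i)) (fun c => (phi_int μ hs g).integrableOn), Finset.mul_sum]
  have hterm : ∀ c : Fin 3 → (ZMod p)ˣ,
      (p - (p:ℂ)^(-s)) * ∫ x in {x : Fin 3 → ℤ_[p] | res x = fun i => (c i : ZMod p)}, phi g s x ∂μ
      = ((p:ℂ)⁻¹)^3 * (p - (p:ℂ)^(-s)) -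
        (if eval (fun i => (c i : ZMod p)) (map PadicInt.toZMod g) = 0 then
          ((p:ℂ)⁻¹)^3 * p * (1 - (p:ℂ)^(-s)) else 0) := by
    intro c
    split_ifs with h
    · obtain ⟨i, hi⟩ := hnd c h
      rw [class_int_two μ hμ g _ hs i h hi]; ring
    · rw [class_int_one μ hμ g _ s h]; ring
  rw [Finset.sum_congr rfl (fun c _ => hterm c), Finset.sum_sub_distrib, Finset.sum_const,
    Finset.card_univ, card_units3, ← Finset.sum_filter, Finset.sum_const, nsmul_eq_mul, nsmul_eq_mul]
  have hp1 : 1 ≤ p := (Fact.out : p.Prime).one_lt.le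
  push_cast [Nat.cast_sub hp1]
  ring

end PartP

open MeasureTheory MvPolynomial

section PartQ

variable {p : ℕ} [Fact p.Prime]

/-- coordinatewise scaling by powers of `p` -/
noncomputable def scl (k : Vec) (u : Fin 3 → ℤ_[p]) : Fin 3 → ℤ_[p] := fun i => (p:ℤ_[p])^(k i) * u i

theorem scl_cont (k : Vec) : Continuous (scl (p := p) k) := by
  unfold scl; fun_prop

theorem scl_inj (k : Vec) : Function.Injective (scl (p := p) k) := by
  have hp0 : (p:ℤ_[p]) ≠ 0 := by exact_mod_cast (Fact.out : p.Prime).ne_zero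
  intro u v h
  ext1 i
  exact mul_left_cancel₀ (pow_ne_zero _ hp0) (congrFun h i)

theorem scl_add (k : Vec) (u v : Fin 3 → ℤ_[p]) : scl k (u + v) = scl k u + scl k v := by
  ext1 i; simp [scl, mul_add]

theorem scl_emb (k : Vec) : Topology.IsClosedEmbedding (scl (p := p) k) :=
  (scl_cont k).isClosedEmbedding (scl_inj k)

noncomputable def rk (k : Vec) (x : Fin 3 → ℤ_[p]) : ∀ i, ZMod (p^(k i)) := fun i => PadicInt.toZModPow (k i) (x i)

theorem rk_add (k : Vec) (x y : Fin 3 → ℤ_[p]) : rk k (x + y) = rk k x + rk k y := by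
  ext i; simp [rk]

theorem mem_range_scl (k : Vec) (x : Fin 3 → ℤ_[p]) : x ∈ Set.range (scl (p := p) k) ↔ rk k x = 0 := by
  have h : ∀ i, rk k x i = 0 ↔ (p:ℤ_[p])^(k i) ∣ x i := by
    intro i
    rw [← Ideal.mem_span_singleton, ← PadicInt.ker_toZModPow, RingHom.mem_ker]; rfl
  constructor
  · rintro ⟨u, rfl⟩
    ext1 i
    rw [Pi.zero_apply, h]
    exact Dvd.intro _ rfl
  · intro hx
    choose u hu using fun i => (h i).mp (congrFun hx i)
    exact ⟨u, funext fun i => (hu i).symm⟩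

variable [MeasurableSpace ℤ_[p]] [BorelSpace ℤ_[p]]

theorem box_measure (μ : Measure (Fin 3 → ℤ_[p])) [μ.IsAddHaarMeasure] (hμ : μ Set.univ = 1) (k : Vec) :
    μ (Set.range (scl (p := p) k)) = ((p:ENNReal)^(sg k))⁻¹ := by
  have hne : ∀ n, NeZero (p^n) := fun n => ⟨pow_ne_zero _ (Fact.out : p.Prime).ne_zero⟩
  have hm : MeasurableSet (Set.range (scl (p := p) k)) := (scl_emb k).isClosed_range.measurableSet
  let w : (∀ i, ZMod (p^(k i))) → Fin 3 → ℤ_[p] := fun c i => ((c i).val : ℤ_[p])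
  have hw : ∀ c, rk k (w c) = c := by
    intro c; ext i; simp [rk, w]
  have hmem : ∀ c x, x ∈ (fun x => x + w c) ⁻¹' (Set.range (scl (p := p) k)) ↔ rk k x = -c := by
    intro c x
    rw [Set.mem_preimage, mem_range_scl, rk_add, hw, eq_neg_iff_add_eq_zero]
  have hU : (⋃ c, (fun x => x + w c) ⁻¹' (Set.range (scl (p := p) k))) = Set.univ := by
    ext x
    simp only [Set.mem_iUnion, hmem, Set.mem_univ, iff_true]
    exact ⟨- rk k x, (neg_neg _).symm⟩
  have h2 := measure_iUnion (μ := μ) (f := fun c => (fun x => x + w c) ⁻¹' (Set.range (scl (p := p) k)))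
    (fun c c' hne => Set.disjoint_left.mpr fun x hx hx' => hne (by
      rw [hmem] at hx hx'
      exact neg_injective (hx.symm.trans hx')))
    (fun c => measurable_add_const _ hm)
  simp only [measure_preimage_add_right] at h2
  rw [hU, hμ, tsum_fintype, Finset.sum_const, Finset.card_univ, Fintype.card_pi, nsmul_eq_mul] at h2
  simp only [ZMod.card, Fin.prod_univ_three, ← pow_add] at h2
  push_cast at h2
  exact ENNReal.eq_inv_of_mul_eq_one_left (by rw [mul_comm]; exact h2.symm)

theorem comap_scl (μ : Measure (Fin 3 → ℤ_[p])) [μ.IsAddHaarMeasure] (hμ : μ Set.univ = 1) (k : Vec) :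
    μ.comap (scl k) = ((p:ENNReal)^(sg k))⁻¹ • μ := by
  have hF : IsFiniteMeasure μ := ⟨by simp [hμ]⟩
  have hemb := (scl_emb (p := p) k).measurableEmbedding
  have hinv : (μ.comap (scl k)).IsAddLeftInvariant := by
    refine ⟨fun g => ?_⟩
    ext A hA
    rw [Measure.map_apply (measurable_const_add g) hA, hemb.comap_apply, hemb.comap_apply,
      ← measure_preimage_add μ (scl k g) (scl k '' A)]
    congr 1
    ext x
    simp only [Set.mem_image, Set.mem_preimage]
    constructor
    · rintro ⟨u, hu, rfl⟩
      exact ⟨g + u, hu, scl_add _ _ _⟩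
    · rintro ⟨u, hu, hx⟩
      refine ⟨u - g, by simpa using hu, ?_⟩
      have := scl_add k (u - g) g
      rw [sub_add_cancel, hx, add_comm] at this
      exact (add_right_cancel this).symm
  have hfin : IsFiniteMeasure (μ.comap (scl k)) := ⟨by
    rw [hemb.comap_apply]; exact measure_lt_top _ _⟩
  have h1 := Measure.isAddInvariant_eq_smul_of_compactSpace (μ.comap (scl k)) μ
  generalize Measure.addHaarScalarFactor (μ.comap (scl k)) μ = c at h1
  have h2 : μ.comap (scl k) Set.univ = (c • μ) Set.univ := by rw [h1]
  rw [hemb.comap_apply, Set.image_univ, box_measure μ hμ, Measure.smul_apply, hμ] at h2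
  rw [h1, h2]
  have h3 : c • (1:ENNReal) = (c : ENNReal) := by rw [ENNReal.smul_def, smul_eq_mul, mul_one]
  rw [h3]
  rfl

theorem shell_subst (μ : Measure (Fin 3 → ℤ_[p])) [μ.IsAddHaarMeasure] (hμ : μ Set.univ = 1) (k : Vec)
    (F : (Fin 3 → ℤ_[p]) → ℂ) :
    ∫ x in {x : Fin 3 → ℤ_[p] | ∀ i, ‖x i‖ = ((p:ℝ)⁻¹)^(k i)}, F x ∂μ =
      ((p:ℂ)⁻¹)^(sg k) * ∫ x in {x : Fin 3 → ℤ_[p] | ∀ i, ‖x i‖ = 1}, F (scl k x) ∂μ := by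
  have hemb := (scl_emb (p := p) k).measurableEmbedding
  have hp0 : (p:ℤ_[p]) ≠ 0 := by exact_mod_cast (Fact.out : p.Prime).ne_zero
  have hp1 : 0 < (p:ℝ)⁻¹ := by have := (Fact.out : p.Prime).pos; positivity
  have hpre : scl k ⁻¹' {x : Fin 3 → ℤ_[p] | ∀ i, ‖x i‖ = ((p:ℝ)⁻¹)^(k i)} = {x | ∀ i, ‖x i‖ = 1} := by
    ext x
    simp only [Set.mem_preimage, Set.mem_ofPred_eq]
    refine forall_congr' fun i => ?_
    simp only [scl, norm_mul, norm_pow, PadicInt.norm_p]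
    constructor
    · intro h; exact mul_left_cancel₀ (pow_pos hp1 _).ne' (by rw [h, mul_one])
    · intro h; rw [h, mul_one]
  have hsub : {x : Fin 3 → ℤ_[p] | ∀ i, ‖x i‖ = ((p:ℝ)⁻¹)^(k i)} ⊆ Set.range (scl k) := by
    intro x hx
    have : ∀ i, (p:ℤ_[p])^(k i) ∣ x i := by
      intro i
      rw [dvd_iff_norm, hx i]; simp
    choose u hu using this
    exact ⟨u, funext fun i => (hu i).symm⟩
  have h := hemb.setIntegral_map (μ := μ.comap (scl k)) F {x : Fin 3 → ℤ_[p] | ∀ i, ‖x i‖ = ((p:ℝ)⁻¹)^(k i)}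
  rw [hemb.map_comap, Measure.restrict_restrict_of_subset hsub, hpre, comap_scl μ hμ, Measure.restrict_smul,
    integral_smul_measure] at h
  rw [h, Complex.real_smul]
  simp

end PartQ

open MeasureTheory MvPolynomial

section PartR

variable {p : ℕ} [Fact p.Prime]

/-- the rescaled polynomial `p^(-m) f(p^k u)` -/
noncomputable def gk (f : MvPolynomial (Fin 3) ℤ_[p]) (k : Vec) : MvPolynomial (Fin 3) ℤ_[p] :=
  ∑ a ∈ f.support, monomial a (coeff a f * (p:ℤ_[p])^(dp k ⇑a - mm (supp f) k))

theorem mm_le_dp {f : MvPolynomial (Fin 3) ℤ_[p]} (hf : f ≠ 0) (k : Vec) {a : Fin 3 →₀ ℕ} (ha : a ∈ f.support) :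
    mm (supp f) k ≤ dp k ⇑a := by
  obtain ⟨b, hb⟩ := SS_nonempty (supp_nonempty hf) k
  rw [mm_eq hb]
  exact (mem_SS.mp hb).2 _ (mem_supp.mpr ⟨a, ha, rfl⟩)

theorem eval_gk {f : MvPolynomial (Fin 3) ℤ_[p]} (hf : f ≠ 0) (k : Vec) (u : Fin 3 → ℤ_[p]) :
    eval (scl k u) f = (p:ℤ_[p])^(mm (supp f) k) * eval u (gk f k) := by
  rw [eval_eq', gk, map_sum, Finset.mul_sum]
  refine Finset.sum_congr rfl fun a ha => ?_
  rw [eval_monomial, Finsupp.prod_fintype _ _ (by simp)]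
  have h : (p:ℤ_[p])^(dp k ⇑a) = (p:ℤ_[p])^(mm (supp f) k) * (p:ℤ_[p])^(dp k ⇑a - mm (supp f) k) := by
    rw [← pow_add]; congr 1; have := mm_le_dp hf k ha; omega
  have h2 : ∏ i, scl k u i ^ a i = (p:ℤ_[p])^(dp k ⇑a) * ∏ i, u i ^ a i := by
    simp only [Fin.prod_univ_three, scl, dp, mul_pow, ← pow_mul, pow_add]
    ring
  rw [h2, h]; ring

theorem map_gk {f : MvPolynomial (Fin 3) ℤ_[p]} (hf : f ≠ 0) (k : Vec) :
    map PadicInt.toZMod (gk f k) = map PadicInt.toZMod (fpoly f (SS (supp f) k)) := by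
  classical
  have hpz : PadicInt.toZMod (p:ℤ_[p]) = 0 := by simp
  obtain ⟨b, hb⟩ := SS_nonempty (supp_nonempty hf) k
  have e : fpoly f (SS (supp f) k) = ∑ a ∈ f.support, if (⇑a : Vec) ∈ SS (supp f) k then monomial a (coeff a f) else 0 := by
    rw [fpoly, Finset.sum_filter]
  rw [e, gk, map_sum, map_sum]
  refine Finset.sum_congr rfl fun a ha => ?_
  split_ifs with h
  · rw [mm_eq h, Nat.sub_self, pow_zero, mul_one]
  · have h1 := mm_le_dp hf k ha
    have h2 : dp k ⇑a - mm (supp f) k ≠ 0 := by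
      intro h0
      apply h
      rw [mem_SS_iff_eq hb (mem_supp.mpr ⟨a, ha, rfl⟩), ← mm_eq hb]
      omega
    rw [map_monomial, map_mul, map_pow, hpz, zero_pow h2, mul_zero, monomial_zero, map_zero]

theorem nondeg_gk {f : MvPolynomial (Fin 3) ℤ_[p]} (hf : f ≠ 0) (hnd : IsNonDegenerateModP f)
    {k : Vec} (hk : VPos k) (c : Fin 3 → (ZMod p)ˣ)
    (hc : eval (fun i => (c i : ZMod p)) (map PadicInt.toZMod (gk f k)) = 0) :
    ∃ i, eval (fun i => (c i : ZMod p)) (map PadicInt.toZMod (pderiv i (gk f k))) ≠ 0 := by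
  by_contra hcon
  push Not at hcon
  have hk0 : k ≠ 0 := fun h => by have := hk 0; simp [h] at this
  refine hnd (FLoc f k) (FLoc_face hk0) (FLoc_compact hf hk) ⟨lift3 (fun i => (c i : ZMod p)), ?_, ?_, ?_⟩
  · intro i
    refine le_antisymm (PadicInt.norm_le_one _) (not_lt.mp fun hlt => ?_)
    rw [norm_lt_one_iff_toZMod] at hlt
    have := congrFun (res_lift3 (fun i => (c i : ZMod p))) i
    simp only [res] at this
    rw [this] at hlt
    exact (c i).ne_zero hlt
  · rw [norm_lt_one_iff_toZMod, facePoly_fpoly hf, toZMod_eval, res_lift3, ← map_gk hf, hc]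
  · intro i
    rw [norm_lt_one_iff_toZMod, facePoly_fpoly hf, toZMod_eval, res_lift3, ← pderiv_map, ← map_gk hf,
      pderiv_map, hcon i]

theorem phi_scl {f : MvPolynomial (Fin 3) ℤ_[p]} (hf : f ≠ 0) (k : Vec) (s : ℂ) (u : Fin 3 → ℤ_[p]) :
    phi f s (scl k u) = ((p:ℂ)^(-s))^(mm (supp f) k) * phi (gk f k) s u := by
  rw [phi, phi, eval_gk hf, norm_mul, norm_pow, PadicInt.norm_p, Complex.ofReal_mul,
    Complex.mul_cpow_ofReal_nonneg (by positivity) (norm_nonneg _), powT]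

variable [MeasurableSpace ℤ_[p]] [BorelSpace ℤ_[p]]

def shell (k : Vec) : Set (Fin 3 → ℤ_[p]) := {x | ∀ i, ‖x i‖ = ((p:ℝ)⁻¹)^(k i)}

theorem shell_int (μ : Measure (Fin 3 → ℤ_[p])) [μ.IsAddHaarMeasure] (hμ : μ Set.univ = 1)
    {f : MvPolynomial (Fin 3) ℤ_[p]} (hf : f ≠ 0) (hnd : IsNonDegenerateModP f)
    {k : Vec} (hk : VPos k) {s : ℂ} (hs : 0 < s.re) :
    (p - (p:ℂ)^(-s)) * ∫ x in shell k, phi f s x ∂μ =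
      (ellS f (SS (supp f) k)).eval ((p:ℂ)^(-s)) * wt (supp f) p ((p:ℂ)^(-s)) k := by
  classical
  have h := unit_int μ hμ (gk f k) hs (nondeg_gk hf hnd hk)
  rw [shell, shell_subst μ hμ]
  simp only [phi_scl hf]
  rw [integral_const_mul, ellS_eval, wt]
  have hN : (Finset.univ.filter (fun c : Fin 3 → (ZMod p)ˣ =>
          eval (fun i => (c i : ZMod p)) (map PadicInt.toZMod (gk f k)) = 0)).card = NS f (SS (supp f) k) := by
    rw [NS]
    congr 1
    ext c
    rw [Finset.mem_filter, Finset.mem_filter, rS, map_gk hf]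
  have h' : (p - (p:ℂ)^(-s)) * ∫ x in {x : Fin 3 → ℤ_[p] | ∀ i, ‖x i‖ = 1}, phi (gk f k) s x ∂μ
      = ((p:ℂ)⁻¹)^3 * (((p:ℂ)-1)^3 * (p - (p:ℂ)^(-s)) - (NS f (SS (supp f) k) : ℂ) * p * (1 - (p:ℂ)^(-s))) := by
    rw [← hN]; convert h
  rw [← h']; ring

theorem null_coord (μ : Measure (Fin 3 → ℤ_[p])) [μ.IsAddHaarMeasure] (hμ : μ Set.univ = 1) (i : Fin 3) :
    μ {x | x i = 0} = 0 := by
  have hp1 : (1:ENNReal) < p := by exact_mod_cast (Fact.out : p.Prime).one_lt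
  refine le_antisymm ?_ (zero_le)
  refine ge_of_tendsto' (ENNReal.tendsto_pow_atTop_nhds_zero_of_lt_one (r := (p:ENNReal)⁻¹) (by
    rw [ENNReal.inv_lt_one]; exact hp1)) fun n => ?_
  have h := box_measure μ hμ (Pi.single i n)
  have hsg : sg (Pi.single i n) = n := by
    fin_cases i <;> simp [sg, Pi.single_apply]
  rw [hsg, ENNReal.inv_pow] at h
  rw [← h]
  refine measure_mono fun x hx => ?_
  refine ⟨x, ?_⟩
  ext1 j
  simp only [scl, Pi.single_apply]
  split_ifs with hj
  · subst hj; rw [show x j = 0 from hx]; simp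
  · simp

theorem shell_meas (k : Vec) : MeasurableSet (shell (p := p) k) := by
  have : shell (p := p) k = ⋂ i, {x | ‖x i‖ = ((p:ℝ)⁻¹)^(k i)} := by
    ext x; simp [shell]
  rw [this]
  refine MeasurableSet.iInter fun i => (isClosed_eq ?_ continuous_const).measurableSet
  fun_prop

theorem Z_sum (μ : Measure (Fin 3 → ℤ_[p])) [μ.IsAddHaarMeasure] (hμ : μ Set.univ = 1)
    {f : MvPolynomial (Fin 3) ℤ_[p]} (hf : f ≠ 0) (hnd : IsNonDegenerateModP f)
    {s : ℂ} (hs : 0 < s.re) :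
    (p - (p:ℂ)^(-s)) * Zlocal μ f s = ∑' k, Set.indicator {k | VPos k} (fun k =>
      (ellS f (SS (supp f) k)).eval ((p:ℂ)^(-s)) * wt (supp f) p ((p:ℂ)^(-s)) k) k := by
  have hF : IsFiniteMeasure μ := ⟨by simp [hμ]⟩
  have hp1 : 1 < (p:ℝ) := by exact_mod_cast (Fact.out : p.Prime).one_lt
  have hpinv : ((p:ℝ)⁻¹) < 1 := inv_lt_one_of_one_lt₀ hp1
  have hpi0 : 0 < ((p:ℝ)⁻¹) := by positivity
  have hdj : Pairwise (Function.onFun Disjoint fun k : {k : Vec | VPos k} => shell (p := p) k) := by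
    intro k k' hne
    refine Set.disjoint_left.mpr fun x hx hx' => hne ?_
    ext i
    exact pow_right_injective₀ hpi0 hpinv.ne ((hx i).symm.trans (hx' i))
  have hU : Zlocal μ f s = ∫ x in ⋃ k : {k : Vec | VPos k}, shell (k : Vec), phi f s x ∂μ := by
    refine setIntegral_congr_set ?_
    have hsub : (⋃ k : {k : Vec | VPos k}, shell (p := p) (k : Vec)) ⊆ {x | ∀ i, ‖x i‖ < 1} := by
      refine Set.iUnion_subset fun k x hx i => ?_
      rw [hx i]
      exact pow_lt_one₀ hpi0.le hpinv (k.2 i).ne'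
    have hdiff : {x : Fin 3 → ℤ_[p] | ∀ i, ‖x i‖ < 1} \ (⋃ k : {k : Vec | VPos k}, shell (p := p) (k : Vec))
        ⊆ ⋃ i, {x | x i = 0} := by
      rintro x ⟨hx, hx'⟩
      by_contra hcon
      simp only [Set.mem_iUnion, Set.mem_ofPred_eq, not_exists] at hcon
      apply hx'
      have hn : ∀ i, ‖x i‖ = ((p:ℝ)⁻¹)^((x i).valuation) := by
        intro i
        rw [PadicInt.norm_eq_zpow_neg_valuation (hcon i)]
        simp
      refine Set.mem_iUnion.mpr ⟨⟨fun i => (x i).valuation, fun i => ?_⟩, fun i => hn i⟩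
      by_contra h0
      have h1 : (x i).valuation = 0 := Nat.eq_zero_of_not_pos h0
      have h2 := hn i
      rw [h1, pow_zero] at h2
      exact absurd (hx i) (by rw [h2]; exact lt_irrefl _)
    have hnull : μ ({x : Fin 3 → ℤ_[p] | ∀ i, ‖x i‖ < 1} \ (⋃ k : {k : Vec | VPos k}, shell (p := p) (k : Vec))) = 0 :=
      measure_mono_null hdiff (measure_iUnion_null fun i => null_coord μ hμ i)
    exact Filter.EventuallyLE.antisymm (ae_le_set.mpr hnull) hsub.eventuallyLE
  rw [hU, integral_iUnion (fun k => shell_meas _) hdj (phi_int μ hs f).integrableOn, ← tsum_mul_left]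
  rw [← tsum_subtype {k : Vec | VPos k}]
  exact tsum_congr fun k => shell_int μ hμ hf hnd k.2 hs

end PartR

/-- Theorem on candidate poles of `Z⁰_f` only contributed by `B₁`-facets.
Let `p` be prime and `f ∈ ℤ_p[x,y,z]` nonzero with `f(0,0,0) = 0`, non-degenerated over
`𝔽_p` with respect to all compact faces of its Newton polyhedron.  Let `s₀` be a candidate
pole of `Z⁰_f` with `Re(s₀) ≠ −1` such that every facet of `Γ_f` contributing to `s₀` is a
`B₁`-facet, and such that any two contributing `B₁`-facets either are `B₁` for a same
variable or have at most one point in common.  Then `s₀` is not a pole of `Z⁰_f`: the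
meromorphic continuation of `Z⁰_f` (a rational function of `p^{-s}`) is holomorphic at
`s₀`, i.e. there are polynomials `P, Q` with `Q(p^{-s₀}) ≠ 0` and
`Q(p^{-s})·Z⁰_f(s) = P(p^{-s})` for `Re(s) > 0`. -/
theorem candidate_pole_only_contributed_by_B1_facets_is_no_pole
    (p : ℕ) [Fact p.Prime]
    [MeasurableSpace ℤ_[p]] [BorelSpace ℤ_[p]]
    (μ : Measure (Fin 3 → ℤ_[p])) [μ.IsAddHaarMeasure] (hμ : μ Set.univ = 1)
    (f : MvPolynomial (Fin 3) ℤ_[p]) (hf : f ≠ 0)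
    (hf0 : eval (0 : Fin 3 → ℤ_[p]) f = 0)
    (hnd : IsNonDegenerateModP f)
    (s₀ : ℂ) (hs₀ : s₀.re ≠ -1)
    (hcand : IsCandidatePole p f s₀)
    (hB1 : ∀ τ : Set (Fin 3 → ℝ), IsFacetOf f τ → Contributes p f τ s₀ → IsB1Facet τ)
    (hpairs : ∀ τ τ' : Set (Fin 3 → ℝ), IsFacetOf f τ → IsFacetOf f τ' →
      Contributes p f τ s₀ → Contributes p f τ' s₀ →
      (∃ i, IsB1For τ i ∧ IsB1For τ' i) ∨ (τ ∩ τ').Subsingleton) :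
    ∃ P Q : Polynomial ℂ, Polynomial.eval ((p : ℂ) ^ (-s₀)) Q ≠ 0 ∧
      ∀ s : ℂ, 0 < s.re →
        Polynomial.eval ((p : ℂ) ^ (-s)) Q * Zlocal μ f s =
          Polynomial.eval ((p : ℂ) ^ (-s)) P := by
  have hp1 : 1 < (p:ℝ) := by exact_mod_cast (Fact.out : p.Prime).one_lt
  have hT0 : (p:ℂ)^(-s₀) ≠ p := by
    intro h
    have h1 := congrArg norm h
    rw [Complex.norm_natCast_cpow_of_pos (Fact.out : p.Prime).pos, Complex.norm_natCast] at h1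
    have h2 : (p:ℝ)^((-s₀).re) = (p:ℝ)^(1:ℝ) := by rw [h1, Real.rpow_one]
    have h3 := (Real.rpow_right_inj (by linarith) hp1.ne').mp h2
    rw [Complex.neg_re] at h3
    exact hs₀ (by linarith)
  obtain ⟨var, hvar, hadj⟩ := geom_var hf hB1 hpairs
  obtain ⟨P, Q, hQ, hPQ⟩ := abs_main (supp_nonempty hf) (Fact.out : p.Prime).two_le hT0
    (ℓ := ellS f) (fun C k hk h T => ellS_one hf hnd C k hk h T)
    (fun i C k hk hC hCi ho _ T => ellS_two hf hnd i C k hk hC hCi ho T) hvar hadj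
  refine ⟨P, Q * (Polynomial.C (p:ℂ) - Polynomial.X), ?_, fun s hs => ?_⟩
  · rw [Polynomial.eval_mul]
    refine mul_ne_zero hQ ?_
    rw [Polynomial.eval_sub, Polynomial.eval_C, Polynomial.eval_X]
    exact sub_ne_zero.mpr hT0.symm
  · rw [Polynomial.eval_mul, Polynomial.eval_sub, Polynomial.eval_C, Polynomial.eval_X, mul_assoc,
      Z_sum μ hμ hf hnd hs]
    exact hPQ _ (norm_T_lt hs)

end
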